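/- Let D be a set of positive integers that is not a subset of {1,2}; if D contains only even numbers set d = gcd{i : 2i ∈ D}, otherwise d = 1. For n ≡ 0 (mod d) with M_{D,n} > 0, let a map be chosen uniformly at random among the rooted planar maps with n edges all of whose vertex degrees lie in D, and for each fixed degree k ∈ D let X_n^{(k)} be the random number of vertices of degree k. Then there exists a constant μ_k > 0 such that E[X_n^{(k)}] ~ μ_k · n as n → ∞ along n ≡ 0 (mod d). -/

import Mathlib

/-- The number of cycles of the permutation `σ` that meet the predicate `P`
(cycles = orbits, so fixed points count as cycles of length one). -/
noncomputable def cycleCountOn {m : ℕ} (σ : Equiv.Perm (Fin m)) (P : Fin m → Prop) : ℕ :=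
  Nat.card (Quot (fun x y : {z : Fin m // P z} => σ.SameCycle x.1 y.1))

/-- The total number of cycles (orbits) of a permutation. -/
noncomputable def cycleCount {m : ℕ} (σ : Equiv.Perm (Fin m)) : ℕ :=
  cycleCountOn σ fun _ => True

/-- The subgroup generated by `σ` and `α` acts transitively on the darts. -/
def IsTransitivePair {m : ℕ} (σ α : Equiv.Perm (Fin m)) : Prop :=
  ∀ x y : Fin m, ∃ g ∈ Subgroup.closure ({σ, α} : Set (Equiv.Perm (Fin m))), g x = y

/-- The permutation model of a rooted planar map with `n` edges: `α` is a fixed-point-free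
involution of the `2n` darts, `⟨σ, α⟩` is transitive, and Euler's relation
`c(σ) − n + c(σα) = 2` holds (vertices = cycles of `σ`, faces = cycles of `σα`). -/
def IsPlanarMap {n : ℕ} (σ α : Equiv.Perm (Fin (2 * n))) : Prop :=
  (∀ x, α (α x) = x) ∧ (∀ x, α x ≠ x) ∧ IsTransitivePair σ α ∧
    cycleCount σ + cycleCount (σ * α) = n + 2

open scoped Classical in
/-- The finite set of labeled pairs `(σ, α)` encoding planar maps with `n` edges and all
vertex degrees in `D`. -/
noncomputable def pairFinset (D : Set ℕ) (n : ℕ) :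
    Finset (Equiv.Perm (Fin (2 * n)) × Equiv.Perm (Fin (2 * n))) :=
  Finset.univ.filter fun p =>
    IsPlanarMap p.1 p.2 ∧ ∀ x, Function.minimalPeriod p.1 x ∈ D

/-- The number of vertices of degree `k` of the map encoded by `σ`, i.e. the number of
cycles of `σ` of length `k`. -/
noncomputable def degCount {m : ℕ} (σ : Equiv.Perm (Fin m)) (k : ℕ) : ℕ :=
  cycleCountOn σ fun x => Function.minimalPeriod σ x = k

/-- `E[X_n^{(k)}]`: the expected number of vertices of degree `k` of a uniformly random
rooted planar map with `n` edges and vertex degrees in `D`.  Since the statistic is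
invariant under relabeling and every rooted map corresponds to exactly `(2n−1)!` labeled
pairs, this is the average over all labeled pairs. -/
noncomputable def EX (D : Set ℕ) (k n : ℕ) : ℝ :=
  (∑ p ∈ pairFinset D n, (degCount p.1 k : ℝ)) / ((pairFinset D n).card : ℝ)

section
open Finset

/-- central trinomial coefficient polynomial -/
def tT {A : Type*} [CommSemiring A] (S R : A) (n : ℕ) : A :=
  ∑ j ∈ range (n + 1), ((n.choose (2 * j) * (2 * j).choose j : ℕ) : A) * S ^ (n - 2 * j) * R ^ j

/-- the neighbouring trinomial coefficient polynomial -/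
def tB {A : Type*} [CommSemiring A] (S R : A) (n : ℕ) : A :=
  ∑ j ∈ range (n + 1), ((n.choose (2 * j + 1) * (2 * j + 1).choose j : ℕ) : A) *
    S ^ (n - (2 * j + 1)) * R ^ (j + 1)

lemma tT_ext {A : Type*} [CommSemiring A] (S R : A) (n N : ℕ) (h : n + 1 ≤ N) :
    tT S R n = ∑ j ∈ range N, ((n.choose (2 * j) * (2 * j).choose j : ℕ) : A) *
      S ^ (n - 2 * j) * R ^ j := by
  unfold tT
  apply Finset.sum_subset
  · intro x; simp; omega
  · intro x _ hx
    have : n < 2 * x := by simp at hx; omega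
    rw [Nat.choose_eq_zero_of_lt this]; simp

lemma tB_ext {A : Type*} [CommSemiring A] (S R : A) (n N : ℕ) (h : n + 1 ≤ N) :
    tB S R n = ∑ j ∈ range N, ((n.choose (2 * j + 1) * (2 * j + 1).choose j : ℕ) : A) *
    S ^ (n - (2 * j + 1)) * R ^ (j + 1) := by
  unfold tB
  apply Finset.sum_subset
  · intro x; simp; omega
  · intro x _ hx
    have : n < 2 * x + 1 := by simp at hx; omega
    rw [Nat.choose_eq_zero_of_lt this]; simp

lemma tT_map {A B : Type*} [CommSemiring A] [CommSemiring B] (f : A →+* B) (S R : A) (n : ℕ) :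
    f (tT S R n) = tT (f S) (f R) n := by
  simp [tT]

lemma tB_map {A B : Type*} [CommSemiring A] [CommSemiring B] (f : A →+* B) (S R : A) (n : ℕ) :
    f (tB S R n) = tB (f S) (f R) n := by
  simp [tB]

lemma tT_zero {A : Type*} [CommSemiring A] (S R : A) : tT S R 0 = 1 := by simp [tT]
lemma tB_zero {A : Type*} [CommSemiring A] (S R : A) : tB S R 0 = 0 := by simp [tB]

lemma choose_two_mul_succ (i : ℕ) : (2 * (i + 1)).choose (i + 1) = 2 * (2 * i + 1).choose i := by
  have h := Nat.choose_succ_succ (2 * i + 1) i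
  have h2 : (2 * i + 1).choose (i + 1) = (2 * i + 1).choose i := by
    apply Nat.choose_symm_of_eq_add; omega
  rw [show 2 * (i + 1) = (2 * i + 1).succ by omega, show i + 1 = i.succ from rfl, h]
  simp only [Nat.succ_eq_add_one]; rw [h2]; ring

lemma tT_succ {A : Type*} [CommSemiring A] (S R : A) (n : ℕ) :
    tT S R (n + 1) = S * tT S R n + 2 * tB S R n := by
  rw [tT_ext S R (n + 1) (n + 2) le_rfl, tT_ext S R n (n + 2) (by omega),
    Finset.sum_range_succ' _ (n + 1), Finset.sum_range_succ' _ (n + 1)]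
  unfold tB
  rw [mul_add, mul_sum, mul_sum, add_right_comm, ← sum_add_distrib]
  congr 1
  · apply sum_congr rfl
    intro i hi
    by_cases h1 : n < 2 * i + 1
    · rw [Nat.choose_eq_zero_of_lt (show n < 2 * i + 1 by omega), Nat.choose_eq_zero_of_lt (show n + 1 < 2 * (i + 1) by omega),
        Nat.choose_eq_zero_of_lt (show n < 2 * (i + 1) by omega)]; simp
    · have e : (n + 1).choose (2 * (i + 1)) = n.choose (2 * i + 1) + n.choose (2 * (i + 1)) := by
        rw [show 2 * (i + 1) = (2 * i + 1) + 1 by ring, Nat.choose_succ_succ]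
      rw [e, choose_two_mul_succ]
      by_cases h2 : n < 2 * (i + 1)
      · rw [Nat.choose_eq_zero_of_lt h2, show n + 1 - 2 * (i + 1) = n - (2 * i + 1) by omega]
        push_cast; ring
      · rw [show n + 1 - 2 * (i + 1) = n - (2 * i + 1) by omega,
          show n - (2 * i + 1) = n - 2 * (i + 1) + 1 by omega]
        push_cast; ring
  · simp; ring

lemma choose_aux (n j : ℕ) : (n + 2) * (n + 1).choose (2 * j + 1) * (2 * j + 1).choose j =
    (n + 1) * (n.choose (2 * j + 1) * (2 * j + 1).choose j + 2 * (n.choose (2 * j) * (2 * j).choose j)) := by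
  by_cases h : n < 2 * j
  · rw [Nat.choose_eq_zero_of_lt h, Nat.choose_eq_zero_of_lt (show n < 2 * j + 1 by omega),
      Nat.choose_eq_zero_of_lt (show n + 1 < 2 * j + 1 by omega)]; simp
  have h1 : (n + 1) * n.choose (2 * j) = (n + 1).choose (2 * j + 1) * (2 * j + 1) := by
    have := Nat.add_one_mul_choose_eq n (2 * j); linarith
  have h2 : (2 * j + 1) * (2 * j).choose j = (2 * j + 1).choose j * (j + 1) := by
    have := Nat.add_one_mul_choose_eq (2 * j) j
    have h3 : (2 * j + 1).choose (j + 1) = (2 * j + 1).choose j := by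
      apply Nat.choose_symm_of_eq_add; omega
    rw [h3] at this; linarith
  have h3 : (n + 1) * n.choose (2 * j + 1) = (n + 1).choose (2 * j + 1) * (n - 2 * j) := by
    have h4 := Nat.choose_mul_succ_eq n (2 * j + 1)
    rw [show n + 1 - (2 * j + 1) = n - 2 * j by omega] at h4
    linarith
  obtain ⟨e, rfl⟩ : ∃ e, n = 2 * j + e := ⟨n - 2 * j, by omega⟩
  rw [show 2 * j + e - 2 * j = e by omega] at h3
  calc _ = (2 * j + e + 1).choose (2 * j + 1) * (2 * j + 1).choose j * (e + 2 * (j + 1)) := by ring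
    _ = ((2 * j + e + 1).choose (2 * j + 1) * e) * (2 * j + 1).choose j
      + 2 * ((2 * j + e + 1).choose (2 * j + 1)) * ((2 * j + 1).choose j * (j + 1)) := by ring
    _ = ((2 * j + e + 1) * (2 * j + e).choose (2 * j + 1)) * (2 * j + 1).choose j
      + 2 * ((2 * j + e + 1).choose (2 * j + 1)) * ((2 * j + 1) * (2 * j).choose j) := by rw [h3, h2]
    _ = ((2 * j + e + 1) * (2 * j + e).choose (2 * j + 1)) * (2 * j + 1).choose j
      + 2 * ((2 * j + e + 1).choose (2 * j + 1) * (2 * j + 1)) * ((2 * j).choose j) := by ring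
    _ = _ := by rw [← h1]; ring

lemma tB_succ {A : Type*} [CommSemiring A] (S R : A) (n : ℕ) :
    ((n + 2 : ℕ) : A) * tB S R (n + 1) = ((n + 1 : ℕ) : A) * (S * tB S R n + 2 * R * tT S R n) := by
  rw [tB_ext S R n (n + 2) (by omega), tT_ext S R n (n + 2) (by omega)]
  unfold tB
  rw [mul_sum, mul_sum, mul_sum, ← sum_add_distrib, mul_sum]
  apply sum_congr rfl
  intro j hj
  have key := congrArg (Nat.cast : ℕ → A) (choose_aux n j)
  by_cases h : n < 2 * j
  · rw [Nat.choose_eq_zero_of_lt h, Nat.choose_eq_zero_of_lt (show n < 2 * j + 1 by omega),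
      Nat.choose_eq_zero_of_lt (show n + 1 < 2 * j + 1 by omega)]; simp
  rw [show n + 1 - (2 * j + 1) = n - 2 * j by omega]
  have e2 : S * (((n.choose (2 * j + 1) * (2 * j + 1).choose j : ℕ) : A) * S ^ (n - (2 * j + 1)) * R ^ (j + 1))
     = ((n.choose (2 * j + 1) * (2 * j + 1).choose j : ℕ) : A) * S ^ (n - (2 * j)) * R ^ (j + 1) := by
    by_cases h1 : n < 2 * j + 1
    · rw [Nat.choose_eq_zero_of_lt h1]; simp
    · rw [show n - 2 * j = n - (2 * j + 1) + 1 by omega]; ring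
  rw [e2]
  calc _ = (((n + 2) * (n + 1).choose (2 * j + 1) * (2 * j + 1).choose j : ℕ) : A) * S ^ (n - 2 * j) * R ^ (j + 1) := by
        push_cast; ring
    _ = _ := by rw [key]; push_cast; ring

open PowerSeries in
lemma tT_sq {A : Type*} [CommRing A] [IsAddTorsionFree A] (S R : A) :
    (PowerSeries.mk (tT S R)) ^ 2 * (1 - C (2 * S) * X + C (S ^ 2 - 4 * R) * X ^ 2) = 1 := by
  set T := PowerSeries.mk (tT S R) with hT
  set B := PowerSeries.mk (tB S R) with hB
  set q : PowerSeries A := (1 - C (2 * S) * X + C (S ^ 2 - 4 * R) * X ^ 2) with hq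
  have e1 : T = 1 + C S * X * T + 2 * X * B := by
    ext n
    rcases n with _ | n
    · simp [hT, hB, tT_zero, mul_assoc]
    · have : (2 : PowerSeries A) = C 2 := (map_ofNat C 2).symm
      rw [this]
      simp [hT, hB, mul_assoc, coeff_one, coeff_succ_X_mul, tT_succ]
  have e2 : d⁄dX A (X * B) * (1 - C S * X) = 2 * C R * X * d⁄dX A (X * T) := by
    ext n
    have e3 : d⁄dX A (X * B) * (1 - C S * X) = d⁄dX A (X * B) - C S * (X * d⁄dX A (X * B)) := by ring
    have : (2 : PowerSeries A) = C 2 := (map_ofNat C 2).symm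
    have e4 : 2 * C R * X * d⁄dX A (X * T) = C 2 * (C R * (X * d⁄dX A (X * T))) := by rw [this]; ring
    rw [e3, e4]
    rcases n with _ | n
    · rw [map_sub, coeff_derivative]
      simp [hB, tB_zero]
    · rw [map_sub, coeff_C_mul, coeff_C_mul, coeff_C_mul, coeff_succ_X_mul, coeff_succ_X_mul,
        coeff_derivative, coeff_derivative, coeff_derivative, coeff_succ_X_mul, coeff_succ_X_mul,
        coeff_succ_X_mul]
      simp only [hB, hT, coeff_mk]
      have := tB_succ S R n
      push_cast at this ⊢
      linear_combination this
  have e5 : 2 * (X * B) = T * (1 - C S * X) - 1 := by linear_combination -e1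
  have d5 := congrArg (d⁄dX A) e5
  have dq : d⁄dX A q = - C (2 * S) + 2 * C (S ^ 2 - 4 * R) * X := by
    simp only [hq, map_add, map_sub, Derivation.leibniz, derivative_C, derivative_X, derivative_pow,
      derivative_one]
    simp [smul_eq_mul]; ring
  have e6 : 2 * (d⁄dX A T * q) = - (d⁄dX A q * T) := by
    have d6 : 2 * d⁄dX A (X * B) = d⁄dX A T * (1 - C S * X) - T * C S := by
      have h2 : d⁄dX A (2 * (X * B)) = 2 * d⁄dX A (X * B) := by
        rw [two_mul, map_add, two_mul]
      rw [← h2, d5]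
      simp only [map_sub, Derivation.leibniz, derivative_C, derivative_X,
        derivative_one, smul_eq_mul]
      ring
    have d7 : d⁄dX A (X * T) = T + X * d⁄dX A T := by
      simp only [Derivation.leibniz, derivative_X, smul_eq_mul]; ring
    rw [d7] at e2
    rw [dq, hq]
    have c1 : C (2 * S) = 2 * C S := by rw [map_mul, map_ofNat]
    have c2 : C (S ^ 2 - 4 * R) = C S ^ 2 - 4 * C R := by rw [map_sub, map_pow, map_mul, map_ofNat]
    rw [c1, c2]
    linear_combination (-2 * (1 - C S * X)) * d6 + 4 * e2
  apply derivative.ext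
  · rw [Derivation.leibniz, derivative_pow, derivative_one]
    simp only [smul_eq_mul]
    push_cast
    linear_combination T * e6
  · simp [hT, hq, tT_zero]
end

section
open Finset

open PowerSeries in
lemma coeff_vmul {A : Type*} [CommRing A] (c : ℕ → A) (e : ℕ) (F : PowerSeries A) (m : ℕ) :
    coeff (e + 1 + m) ((X ^ e - ∑ j ∈ range (e + 2), C (c j) * X ^ (e + 1 - j)) * F) =
      coeff (m + 1) F - ∑ j ∈ range (e + 2), c j * coeff (m + j) F := by
  rw [sub_mul, map_sub, sum_mul, map_sum]
  congr 1
  · rw [show e + 1 + m = (m + 1) + e by ring, coeff_X_pow_mul]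
  · apply sum_congr rfl
    intro j hj
    simp at hj
    rw [mul_assoc, coeff_C_mul, show e + 1 + m = (m + j) + (e + 1 - j) by omega, coeff_X_pow_mul]

open PowerSeries in
lemma loop_of_lin {A : Type*} [CommRing A] (h4 : ∀ a : A, 4 * a = 0 → a = 0) (c : ℕ → A) (e : ℕ)
    (T W : PowerSeries A) (S R : A)
    (hT : T ^ 2 * (1 - C (2 * S) * X + C (S ^ 2 - 4 * R) * X ^ 2) = 1)
    (hW : ∀ m, coeff (m + 1) T - ∑ j ∈ range (e + 2), c j * coeff (m + j) T
      = coeff m (2 * X * W * T)) (m : ℕ) :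
    coeff (m + 1) W - ∑ j ∈ range (e + 2), c j * coeff (m + j) W = coeff m (X * W ^ 2) := by
  set q : PowerSeries A := (1 - C (2 * S) * X + C (S ^ 2 - 4 * R) * X ^ 2) with hq
  set v : PowerSeries A := (X ^ e - ∑ j ∈ range (e + 2), C (c j) * X ^ (e + 1 - j)) with hv
  set M : Polynomial A := trunc (e + 1) (v * T) with hM
  obtain ⟨N, hN⟩ : ∃ N : PowerSeries A, N = (M : PowerSeries A) := ⟨_, rfl⟩
  have e1 : v * T = N + X ^ (e + 1) * (2 * X * W * T) := by
    ext i
    rw [map_add, hN, hM, Polynomial.coeff_coe, coeff_trunc]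
    split_ifs with hi
    · rw [coeff_X_pow_mul', if_neg (by omega)]; simp
    · obtain ⟨k, rfl⟩ : ∃ k, i = e + 1 + k := ⟨i - (e + 1), by omega⟩
      rw [hv, coeff_vmul, hW, add_comm (e + 1) k, coeff_X_pow_mul, zero_add]
  have e2 : v = N * q * T + 2 * X ^ (e + 2) * W := by
    calc v = v * (T ^ 2 * q) := by rw [hT, mul_one]
      _ = (v * T) * (q * T) := by ring
      _ = N * q * T + 2 * X ^ (e + 2) * W * (T ^ 2 * q) := by rw [e1]; ring
      _ = _ := by rw [hT, mul_one]
  have e3 : 4 * (X ^ (e + 2) * (v * W - X ^ (e + 2) * W ^ 2)) = v ^ 2 - N ^ 2 * q := by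
    have : N ^ 2 * q = (N * q * T) ^ 2 := by
      calc _ = N ^ 2 * q * (T ^ 2 * q) := by rw [hT, mul_one]
        _ = _ := by ring
    rw [this, show N * q * T = v - 2 * X ^ (e + 2) * W by linear_combination -e2]
    ring
  -- polynomial degrees
  obtain ⟨V, hV, hVd⟩ : ∃ V : Polynomial A, (V : PowerSeries A) = v ∧ V.natDegree ≤ e + 1 := by
    refine ⟨Polynomial.X ^ e - ∑ j ∈ range (e + 2), Polynomial.C (c j) * Polynomial.X ^ (e + 1 - j),
      ?_, ?_⟩
    · rw [hv]
      have : ∀ p : Polynomial A, (p : PowerSeries A) = Polynomial.coeToPowerSeries.ringHom p := fun _ => rfl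
      rw [this, map_sub, map_sum]
      simp
    · refine (Polynomial.natDegree_sub_le _ _).trans (max_le ?_ ?_)
      · exact (Polynomial.natDegree_X_pow_le e).trans (by omega)
      · apply Polynomial.natDegree_sum_le_of_forall_le
        intro j hj
        exact (Polynomial.natDegree_C_mul_X_pow_le _ _).trans (by omega)
  obtain ⟨Q, hQ, hQd⟩ : ∃ Q : Polynomial A, (Q : PowerSeries A) = q ∧ Q.natDegree ≤ 2 := by
    refine ⟨1 - Polynomial.C (2 * S) * Polynomial.X + Polynomial.C (S ^ 2 - 4 * R) * Polynomial.X ^ 2,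
      ?_, ?_⟩
    · rw [hq]
      have : ∀ p : Polynomial A, (p : PowerSeries A) = Polynomial.coeToPowerSeries.ringHom p := fun _ => rfl
      generalize 2 * S = a
      generalize S ^ 2 - 4 * R = b
      rw [this, map_add, map_sub, map_mul, map_mul, map_pow, map_one, ← this, ← this, ← this,
        Polynomial.coe_C, Polynomial.coe_C, Polynomial.coe_X]
    · compute_degree
  have hMd : M.natDegree ≤ e := by
    have := natDegree_trunc_lt (v * T) e
    rw [hM]; omega
  have e4 : coeff (2 * (e + 1) + 1 + m) (v ^ 2 - N ^ 2 * q) = 0 := by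
    rw [← hV, ← hQ, hN]
    have : ((V : PowerSeries A) ^ 2 - (M : PowerSeries A) ^ 2 * Q) = ((V ^ 2 - M ^ 2 * Q : Polynomial A) : PowerSeries A) := by
      have : ∀ p : Polynomial A, (p : PowerSeries A) = Polynomial.coeToPowerSeries.ringHom p := fun _ => rfl
      simp only [this, map_sub, map_mul, map_pow]
    rw [this, Polynomial.coeff_coe]
    apply Polynomial.coeff_eq_zero_of_natDegree_lt
    have h1 : (V ^ 2).natDegree ≤ 2 * (e + 1) := Polynomial.natDegree_pow_le_of_le 2 hVd
    have h2 : (M ^ 2 * Q).natDegree ≤ 2 * (e + 1) :=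
      (Polynomial.natDegree_mul_le_of_le (Polynomial.natDegree_pow_le_of_le 2 hMd) hQd).trans (by omega)
    have := Polynomial.natDegree_sub_le_of_le h1 h2
    simp at this
    omega
  rw [← e3] at e4
  rw [show (4 : PowerSeries A) = C 4 from (map_ofNat C 4).symm, coeff_C_mul] at e4
  have e5 := h4 _ e4
  rw [show 2 * (e + 1) + 1 + m = (e + 1 + m) + (e + 2) by ring, coeff_X_pow_mul, map_sub, hv, coeff_vmul] at e5
  rw [sub_eq_zero] at e5
  rw [e5, show e + 1 + m = m + (e + 1) by ring, show X ^ (e + 2) * W ^ 2 = X ^ (e + 1) * (X * W ^ 2) by ring,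
    coeff_X_pow_mul]
end

section
open Finset

/-- The series `∑ j, g (j+1) x^(j+1) F j`. -/
noncomputable def Sg {A : Type*} [CommSemiring A] (g : ℕ → A) (F : ℕ → PowerSeries A) : PowerSeries A :=
  PowerSeries.mk fun n => ∑ j ∈ range n, g (j + 1) * PowerSeries.coeff (n - 1 - j) (F j)

open PowerSeries

lemma coeff_Sg {A : Type*} [CommSemiring A] (g : ℕ → A) (F : ℕ → A⟦X⟧) (n : ℕ) :
    coeff n (Sg g F) = ∑ j ∈ range n, g (j + 1) * coeff (n - 1 - j) (F j) := by
  simp [Sg]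

lemma coeff_Sg_ext {A : Type*} [CommSemiring A] (g : ℕ → A) (F : ℕ → A⟦X⟧) (n N : ℕ) (h : n ≤ N) :
    coeff n (Sg g F) = coeff n (∑ j ∈ range N, C (g (j + 1)) * X ^ (j + 1) * F j) := by
  rw [coeff_Sg, map_sum]
  rw [← sum_subset (range_mono h)]
  · apply sum_congr rfl
    intro j hj
    simp at hj
    rw [mul_assoc, coeff_C_mul, show n = (n - 1 - j) + (j + 1) by omega, coeff_X_pow_mul]
    congr 3
    omega
  · intro j _ hj
    simp at hj
    rw [mul_assoc, coeff_C_mul, coeff_X_pow_mul', if_neg (by omega), mul_zero]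

lemma Sg_map {A B : Type*} [CommSemiring A] [CommSemiring B] (f : A →+* B) (g : ℕ → A) (F : ℕ → A⟦X⟧) :
    PowerSeries.map f (Sg g F) = Sg (fun j => f (g j)) (fun j => PowerSeries.map f (F j)) := by
  ext n
  simp [coeff_Sg]

lemma Sg_add {A : Type*} [CommSemiring A] (g : ℕ → A) (F G : ℕ → A⟦X⟧) :
    Sg g (fun j => F j + G j) = Sg g F + Sg g G := by
  ext n
  simp [coeff_Sg, mul_add, sum_add_distrib]

lemma Sg_mul_left {A : Type*} [CommSemiring A] (g : ℕ → A) (F : ℕ → A⟦X⟧) (S : A⟦X⟧) :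
    Sg g (fun j => S * F j) = S * Sg g F := by
  ext n
  rw [coeff_Sg_ext g _ n n le_rfl, coeff_mul]
  have : ∀ p ∈ antidiagonal n, coeff p.1 S * coeff p.2 (Sg g F) =
      coeff p.1 S * coeff p.2 (∑ j ∈ range n, C (g (j + 1)) * X ^ (j + 1) * F j) := by
    intro p hp
    rw [coeff_Sg_ext g F p.2 n (by have := mem_antidiagonal.1 hp; omega)]
  rw [sum_congr rfl this, ← coeff_mul, mul_sum]
  congr 1
  apply sum_congr rfl
  intro j _
  ring

/-- agreement of the first coefficients -/
def PCong {A : Type*} [CommSemiring A] (n : ℕ) (F G : A⟦X⟧) : Prop :=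
  ∀ m < n, coeff m F = coeff m G

section cong
variable {A : Type*} [CommSemiring A] {n : ℕ}

lemma PCong.rfl {F : A⟦X⟧} : PCong n F F := fun _ _ => Eq.refl _
lemma PCong.symm {F G : A⟦X⟧} (h : PCong n F G) : PCong n G F := fun m hm => (h m hm).symm
lemma PCong.trans {F G H : A⟦X⟧} (h : PCong n F G) (h' : PCong n G H) : PCong n F H :=
  fun m hm => (h m hm).trans (h' m hm)
lemma PCong.mono {k : ℕ} {F G : A⟦X⟧} (h : PCong n F G) (hk : k ≤ n) : PCong k F G :=
  fun m hm => h m (by omega)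
lemma PCong.add {F G F' G' : A⟦X⟧} (h : PCong n F G) (h' : PCong n F' G') :
    PCong n (F + F') (G + G') := fun m hm => by
  rw [map_add, map_add, h m hm, h' m hm]
lemma PCong.mul {F G F' G' : A⟦X⟧} (h : PCong n F G) (h' : PCong n F' G') :
    PCong n (F * F') (G * G') := fun m hm => by
  rw [coeff_mul, coeff_mul]
  apply sum_congr (Eq.refl _)
  intro p hp
  rw [h _ (by have := mem_antidiagonal.1 hp; omega), h' _ (by have := mem_antidiagonal.1 hp; omega)]
lemma PCong.pow {F G : A⟦X⟧} (h : PCong n F G) (k : ℕ) : PCong n (F ^ k) (G ^ k) := by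
  induction k with
  | zero => simpa using PCong.rfl
  | succ k ih => rw [pow_succ, pow_succ]; exact ih.mul h
lemma PCong.sum {ι : Type*} (s : Finset ι) {F G : ι → A⟦X⟧} (h : ∀ i ∈ s, PCong n (F i) (G i)) :
    PCong n (∑ i ∈ s, F i) (∑ i ∈ s, G i) := fun m hm => by
  rw [map_sum, map_sum]
  exact sum_congr (Eq.refl _) fun i hi => h i hi m hm
lemma PCong.tT {S S' R R' : A⟦X⟧} (h : PCong n S S') (h' : PCong n R R') (j : ℕ) :
    PCong n (tT S R j) (tT S' R' j) := by
  unfold _root_.tT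
  refine PCong.sum _ fun i _ => ?_
  exact (PCong.rfl.mul (h.pow _)).mul (h'.pow _)
lemma PCong.tB {S S' R R' : A⟦X⟧} (h : PCong n S S') (h' : PCong n R R') (j : ℕ) :
    PCong n (tB S R j) (tB S' R' j) := by
  unfold _root_.tB
  refine PCong.sum _ fun i _ => ?_
  exact (PCong.rfl.mul (h.pow _)).mul (h'.pow _)
lemma PCong.Sg {g : ℕ → A} {F G : ℕ → A⟦X⟧} (h : ∀ j, PCong n (F j) (G j)) :
    PCong (n + 1) (Sg g F) (Sg g G) := fun m hm => by
  rw [coeff_Sg, coeff_Sg]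
  apply sum_congr (Eq.refl _)
  intro j hj
  simp at hj
  rw [h j _ (by omega)]
end cong

/-- one step of the iteration for the two-parameter system -/
noncomputable def sysStep {A : Type*} [CommSemiring A] (g : ℕ → A) (P : A⟦X⟧ × A⟦X⟧) : A⟦X⟧ × A⟦X⟧ :=
  (Sg g (tT P.1 P.2), 1 + Sg g (tB P.1 P.2))

lemma sysStep_cong {A : Type*} [CommSemiring A] (g : ℕ → A) {n : ℕ} {P Q : A⟦X⟧ × A⟦X⟧}
    (h1 : PCong n P.1 Q.1) (h2 : PCong n P.2 Q.2) :
    PCong (n + 1) (sysStep g P).1 (sysStep g Q).1 ∧ PCong (n + 1) (sysStep g P).2 (sysStep g Q).2 :=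
  ⟨PCong.Sg fun j => h1.tT h2 j, PCong.rfl.add (PCong.Sg fun j => h1.tB h2 j)⟩

noncomputable def sysIter {A : Type*} [CommSemiring A] (g : ℕ → A) (k : ℕ) : A⟦X⟧ × A⟦X⟧ :=
  (sysStep g)^[k] (0, 0)

lemma sysIter_succ {A : Type*} [CommSemiring A] (g : ℕ → A) (k : ℕ) :
    sysIter g (k + 1) = sysStep g (sysIter g k) := Function.iterate_succ_apply' _ _ _

lemma sysIter_cong {A : Type*} [CommSemiring A] (g : ℕ → A) (k : ℕ) :
    PCong k (sysIter g k).1 (sysIter g (k + 1)).1 ∧ PCong k (sysIter g k).2 (sysIter g (k + 1)).2 := by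
  induction k with
  | zero => exact ⟨fun m hm => by omega, fun m hm => by omega⟩
  | succ k ih =>
    rw [sysIter_succ g (k + 1), sysIter_succ g k]
    have := sysStep_cong g ih.1 ih.2
    rwa [sysIter_succ g k] at this

lemma sysIter_cong' {A : Type*} [CommSemiring A] (g : ℕ → A) (k l : ℕ) :
    PCong k (sysIter g k).1 (sysIter g (k + l)).1 ∧ PCong k (sysIter g k).2 (sysIter g (k + l)).2 := by
  induction l with
  | zero => exact ⟨PCong.rfl, PCong.rfl⟩
  | succ l ih =>
    have := sysIter_cong g (k + l)
    exact ⟨ih.1.trans (this.1.mono (by omega)), ih.2.trans (this.2.mono (by omega))⟩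

noncomputable def fS {A : Type*} [CommSemiring A] (g : ℕ → A) : A⟦X⟧ :=
  PowerSeries.mk fun i => coeff i (sysIter g (i + 1)).1
noncomputable def fR {A : Type*} [CommSemiring A] (g : ℕ → A) : A⟦X⟧ :=
  PowerSeries.mk fun i => coeff i (sysIter g (i + 1)).2

lemma fSR_cong {A : Type*} [CommSemiring A] (g : ℕ → A) (k : ℕ) :
    PCong k (fS g) (sysIter g k).1 ∧ PCong k (fR g) (sysIter g k).2 := by
  constructor
  · intro m hm
    have := (sysIter_cong' g (m + 1) (k - (m + 1))).1 m (by omega)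
    rw [show m + 1 + (k - (m + 1)) = k by omega] at this
    simp [fS, this]
  · intro m hm
    have := (sysIter_cong' g (m + 1) (k - (m + 1))).2 m (by omega)
    rw [show m + 1 + (k - (m + 1)) = k by omega] at this
    simp [fR, this]

lemma fSR_fix {A : Type*} [CommSemiring A] (g : ℕ → A) : sysStep g (fS g, fR g) = (fS g, fR g) := by
  have key : ∀ k, PCong (k + 1) (sysStep g (fS g, fR g)).1 (fS g) ∧
      PCong (k + 1) (sysStep g (fS g, fR g)).2 (fR g) := by
    intro k
    have h := fSR_cong g k
    have h1 := fSR_cong g (k + 1)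
    have h2 := sysStep_cong g (P := (fS g, fR g)) (Q := sysIter g k) h.1 h.2
    rw [← sysIter_succ] at h2
    exact ⟨h2.1.trans h1.1.symm, h2.2.trans h1.2.symm⟩
  ext m
  · exact (key m).1 m (by omega)
  · exact (key m).2 m (by omega)

lemma fS_eq {A : Type*} [CommSemiring A] (g : ℕ → A) : Sg g (tT (fS g) (fR g)) = fS g :=
  congrArg Prod.fst (fSR_fix g)
lemma fR_eq {A : Type*} [CommSemiring A] (g : ℕ → A) : 1 + Sg g (tB (fS g) (fR g)) = fR g :=
  congrArg Prod.snd (fSR_fix g)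

/-- the loop equations -/
def IsW {A : Type*} [CommSemiring A] (g : ℕ → A) (W : ℕ → A⟦X⟧) : Prop :=
  W 0 = 1 ∧ ∀ p, W (p + 1) = ∑ i ∈ range p, W i * W (p - 1 - i) + Sg g (fun j => W (p + j))

lemma IsW.unique {A : Type*} [CommSemiring A] {g : ℕ → A} {W V : ℕ → A⟦X⟧} (hW : IsW g W) (hV : IsW g V) :
    W = V := by
  have : ∀ N p m, 2 * m + p ≤ N → coeff m (W p) = coeff m (V p) := by
    intro N
    induction N with
    | zero => intro p m h
              obtain rfl : p = 0 := by omega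
              rw [hW.1, hV.1]
    | succ N ih =>
      intro p m h
      cases p with
      | zero => rw [hW.1, hV.1]
      | succ p =>
        rw [hW.2, hV.2, map_add, map_add, map_sum, map_sum, coeff_Sg, coeff_Sg]
        congr 1
        · apply sum_congr rfl
          intro i hi
          simp at hi
          rw [coeff_mul, coeff_mul]
          apply sum_congr rfl
          intro q hq
          have h1 := mem_antidiagonal.1 hq
          rw [ih _ _ (by omega), ih _ _ (by omega)]
        · apply sum_congr rfl
          intro i hi
          simp at hi
          rw [ih _ _ (by omega)]
  ext p m
  exact this _ p m le_rfl

lemma IsW.map {A B : Type*} [CommSemiring A] [CommSemiring B] {g : ℕ → A} {W : ℕ → A⟦X⟧} (hW : IsW g W)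
    (f : A →+* B) : IsW (fun j => f (g j)) (fun p => PowerSeries.map f (W p)) := by
  refine ⟨by simp [hW.1], fun p => ?_⟩
  simp only [hW.2 p, map_add, map_sum, map_mul, Sg_map]
end

section
open Finset PowerSeries

lemma Sg_quot {N M : ℕ} (h : N ≤ M) (g : ℕ → ℝ) (F : ℕ → ℝ⟦X⟧) :
    Ideal.Quotient.mk (Ideal.span {(X : ℝ⟦X⟧) ^ (N + 1)}) (Sg g F) =
      ∑ j ∈ range M, Ideal.Quotient.mk (Ideal.span {(X : ℝ⟦X⟧) ^ (N + 1)}) (C (g (j + 1)) * X ^ (j + 1)) *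
        Ideal.Quotient.mk (Ideal.span {(X : ℝ⟦X⟧) ^ (N + 1)}) (F j) := by
  simp only [← map_mul, ← map_sum]
  rw [Ideal.Quotient.eq, Ideal.mem_span_singleton, X_pow_dvd_iff]
  intro m hm
  rw [map_sub, sub_eq_zero, coeff_Sg_ext g F m M (by omega)]

lemma loop_real (g : ℕ → ℝ) (T W : ℝ⟦X⟧⟦X⟧) (S R : ℝ⟦X⟧)
    (hT : T ^ 2 * (1 - C (2 * S) * X + C (S ^ 2 - 4 * R) * X ^ 2) = 1)
    (hW : ∀ m, coeff (m + 1) T - Sg g (fun j => coeff (m + j) T) = coeff m (2 * X * W * T)) (m : ℕ) :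
    coeff (m + 1) W - Sg g (fun j => coeff (m + j) W) = coeff m (X * W ^ 2) := by
  rw [← sub_eq_zero]
  ext N
  set I := Ideal.span {(X : ℝ⟦X⟧) ^ (N + 1)} with hI
  set f := Ideal.Quotient.mk I with hf
  have key := loop_of_lin (A := ℝ⟦X⟧ ⧸ I) (fun a ha => by
      have h1 : algebraMap ℝ (ℝ⟦X⟧ ⧸ I) (1/4) * 4 = 1 := by
        have : (4 : ℝ⟦X⟧ ⧸ I) = algebraMap ℝ (ℝ⟦X⟧ ⧸ I) 4 := (map_ofNat _ 4).symm
        rw [this, ← map_mul]; norm_num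
      calc a = (algebraMap ℝ (ℝ⟦X⟧ ⧸ I) (1/4) * 4) * a := by rw [h1, one_mul]
        _ = 0 := by rw [mul_assoc, ha, mul_zero])
    (fun j => f (C (g (j + 1)) * X ^ (j + 1))) N (PowerSeries.map f T) (PowerSeries.map f W) (f S) (f R)
    (by
      have := congrArg (PowerSeries.map f) hT
      have f2 : f 2 = 2 := map_ofNat f 2
      have f4 : f 4 = 4 := map_ofNat f 4
      simpa [f2, f4] using this)
    (by
      intro m
      have := congrArg f (hW m)
      rw [map_sub, hf, Sg_quot (M := N + 2) (by omega)] at this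
      simp only [coeff_map]
      rw [this, ← coeff_map]
      have : PowerSeries.map (Ideal.Quotient.mk I) 2 = 2 := map_ofNat _ 2
      simp [this, hf]) m
  simp only [coeff_map] at key
  rw [hf, ← Sg_quot (M := N + 2) (by omega)] at key
  have k2 : f (coeff (m + 1) W - Sg g (fun j => coeff (m + j) W)) = f (coeff m (X * W ^ 2)) := by
    rw [map_sub, key, ← coeff_map]
    simp [hf]
  rw [hf, Ideal.Quotient.eq, hI, Ideal.mem_span_singleton, X_pow_dvd_iff] at k2
  rw [k2 N (by omega), map_zero]

lemma coeff_mul_range {A : Type*} [CommSemiring A] (F G : A⟦X⟧) (p : ℕ) :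
    coeff p (X * (F * G)) = ∑ i ∈ range p, coeff i F * coeff (p - 1 - i) G := by
  cases p with
  | zero => simp
  | succ p =>
    rw [coeff_succ_X_mul, coeff_mul, Finset.Nat.sum_antidiagonal_eq_sum_range_succ_mk]
    rfl

instance tfR : IsAddTorsionFree ℝ⟦X⟧ where
  nsmul_right_injective n hn F G h := by
    ext m
    have := congrArg (coeff m) h
    simp only [map_nsmul] at this
    exact nsmul_right_injective hn this

lemma lin_real (g : ℕ → ℝ) (W : ℕ → ℝ⟦X⟧) (hW : IsW g W) (p : ℕ) :
    tT (fS g) (fR g) (p + 1) = 2 * ∑ i ∈ range p, W i * tT (fS g) (fR g) (p - 1 - i) +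
      Sg g (fun j => tT (fS g) (fR g) (p + j)) := by
  set S := fS g with hS
  set R := fR g with hR
  set T : ℝ⟦X⟧⟦X⟧ := PowerSeries.mk (tT S R) with hT
  set q : ℝ⟦X⟧⟦X⟧ := (1 - C (2 * S) * X + C (S ^ 2 - 4 * R) * X ^ 2) with hq
  have hsq : T ^ 2 * q = 1 := tT_sq S R
  have hc : ∀ m, coeff m T = tT S R m := fun m => by rw [hT, coeff_mk]
  set U : ℕ → ℝ⟦X⟧ := fun m => tT S R (m + 1) - Sg g (fun j => tT S R (m + j)) with hU
  set V : ℝ⟦X⟧⟦X⟧ := PowerSeries.mk fun m => U (m + 1) with hV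
  set H : ℝ⟦X⟧⟦X⟧ := C (C (1/2)) * V * (q * T) with hH
  have h2 : (2 : ℝ⟦X⟧⟦X⟧) * C (C (1/2)) = 1 := by
    rw [show (2 : ℝ⟦X⟧⟦X⟧) = C (C 2) by rw [map_ofNat C 2, map_ofNat C 2], ← map_mul, ← map_mul]; norm_num
  have hXV : 2 * X * H * T = X * V := by
    calc 2 * X * H * T = (2 * C (C (1/2))) * (X * V) * (T ^ 2 * q) := by rw [hH]; ring
      _ = _ := by rw [h2, hsq, one_mul, mul_one]
  have hU0 : U 0 = 0 := by
    simp only [hU, zero_add]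
    rw [fS_eq, ← zero_add 1, tT_succ]
    simp [tT_zero, tB_zero, hS]
  have hXVU : ∀ m, coeff m (X * V) = U m := by
    intro m
    cases m with
    | zero => simp [hU0]
    | succ m => rw [coeff_succ_X_mul, hV, coeff_mk]
  have hl := loop_real g T H S R hsq (by
    intro m
    rw [hXV, hXVU]
    simp only [hc, hU])
  have hIs : IsW g (fun p => coeff p H) := by
    constructor
    · have hU1 : U 1 = 2 := by
        simp only [hU]
        have e : Sg g (fun j => tT S R (1 + j)) = S * S + 2 * (R - 1) := by
          have : (fun j => tT S R (1 + j)) = fun j => S * tT S R j + 2 * tB S R j := by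
            ext1 j
            rw [add_comm, tT_succ]
          rw [this, Sg_add, Sg_mul_left, Sg_mul_left]
          rw [fS_eq]
          rw [show R - 1 = Sg g (tB S R) from ?_]
          rw [hR, sub_eq_iff_eq_add', fR_eq]
        rw [e]
        simp [tT, sum_range_succ, Nat.choose]
        ring
      show coeff 0 H = 1
      rw [hH]
      simp only [coeff_zero_eq_constantCoeff, map_mul, constantCoeff_C]
      simp only [← coeff_zero_eq_constantCoeff, hc, hV, coeff_mk, tT_zero]
      simp only [zero_add, hU1, hq]
      simp
      rw [show (2 : ℝ⟦X⟧) = C 2 from (map_ofNat C 2).symm, ← map_mul]; norm_num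
    · intro p
      have := hl p
      rw [sub_eq_iff_eq_add] at this
      simp only [this, pow_two, coeff_mul_range]
  have hWH : W = fun p => coeff p H := hW.unique hIs
  have h3 : coeff p (2 * X * H * T) = U p := by rw [hXV, hXVU]
  have h4 : coeff p (2 * X * H * T) = 2 * ∑ i ∈ range p, W i * tT S R (p - 1 - i) := by
    rw [show 2 * X * H * T = C 2 * (X * (H * T)) by rw [map_ofNat C 2]; ring, coeff_C_mul, coeff_mul_range, hWH]
    simp only [hc]
  rw [← h4, h3]
  simp [hU]
end

section
open Finset PowerSeries
open scoped NNReal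

lemma sysIter_map {A B : Type*} [CommSemiring A] [CommSemiring B] (f : A →+* B) (g : ℕ → A) (k : ℕ) :
    PowerSeries.map f (sysIter g k).1 = (sysIter (fun j => f (g j)) k).1 ∧
    PowerSeries.map f (sysIter g k).2 = (sysIter (fun j => f (g j)) k).2 := by
  induction k with
  | zero => simp [sysIter]
  | succ k ih =>
    rw [sysIter_succ, sysIter_succ]
    simp only [sysStep, Sg_map, map_add, map_one, tT_map, tB_map, ih.1, ih.2]
    exact ⟨trivial, trivial⟩

lemma fS_map {A B : Type*} [CommSemiring A] [CommSemiring B] (f : A →+* B) (g : ℕ → A) :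
    PowerSeries.map f (fS g) = fS (fun j => f (g j)) := by
  ext m
  rw [coeff_map, fS, fS, coeff_mk, coeff_mk, ← (sysIter_map f g _).1, coeff_map]

lemma fR_map {A B : Type*} [CommSemiring A] [CommSemiring B] (f : A →+* B) (g : ℕ → A) :
    PowerSeries.map f (fR g) = fR (fun j => f (g j)) := by
  ext m
  rw [coeff_map, fR, fR, coeff_mk, coeff_mk, ← (sysIter_map f g _).2, coeff_map]

lemma map_toReal_inj : Function.Injective (PowerSeries.map NNReal.toRealHom) :=
  map_injective _ NNReal.coe_injective

lemma lin_nn (g : ℕ → ℝ≥0) (W : ℕ → ℝ≥0⟦X⟧) (hW : IsW g W) (p : ℕ) :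
    tT (fS g) (fR g) (p + 1) = 2 * ∑ i ∈ range p, W i * tT (fS g) (fR g) (p - 1 - i) +
      Sg g (fun j => tT (fS g) (fR g) (p + j)) := by
  apply map_toReal_inj
  rw [map_add, map_mul, map_sum, Sg_map]
  simp only [map_mul, tT_map, fS_map, fR_map]
  rw [lin_real _ _ (hW.map NNReal.toRealHom)]
  rw [map_ofNat (PowerSeries.map NNReal.toRealHom) 2]

lemma W_le_T (g : ℕ → ℝ≥0) (W : ℕ → ℝ≥0⟦X⟧) (hW : IsW g W) : ∀ N p m, 2 * m + p ≤ N →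
    coeff m (W p) ≤ coeff m (tT (fS g) (fR g) p) := by
  intro N
  induction N with
  | zero =>
    intro p m h
    obtain rfl : p = 0 := by omega
    rw [hW.1, tT_zero]
  | succ N ih =>
    intro p m h
    cases p with
    | zero => rw [hW.1, tT_zero]
    | succ p =>
      rw [hW.2, lin_nn g W hW, map_add, map_add, coeff_Sg, coeff_Sg]
      gcongr with j hj
      · rw [two_mul, map_add]
        refine le_trans ?_ (le_add_of_nonneg_right (zero_le))
        rw [map_sum, map_sum]
        gcongr with i hi
        simp at hi
        rw [coeff_mul, coeff_mul]
        gcongr with q hq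
        have h1 := mem_antidiagonal.1 hq
        exact ih _ _ (by omega)
      · simp at hj
        exact ih _ _ (by omega)

lemma T_le_W (g : ℕ → ℝ≥0) (W : ℕ → ℝ≥0⟦X⟧) (hW : IsW g W) : ∀ N p m, 2 * m + p ≤ N →
    coeff m (tT (fS g) (fR g) p) ≤ (p + m + 1 : ℕ) * coeff m (W p) := by
  intro N
  induction N with
  | zero =>
    intro p m h
    obtain rfl : p = 0 := by omega
    obtain rfl : m = 0 := by omega
    rw [hW.1, tT_zero]; simp
  | succ N ih =>
    intro p m h
    cases p with
    | zero =>
      rw [hW.1, tT_zero, zero_add]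
      exact le_mul_of_one_le_left zero_le (by simp)
    | succ p =>
      rw [hW.2, lin_nn g W hW, map_add, map_add, coeff_Sg, coeff_Sg, mul_add]
      gcongr
      · have e1 : coeff m (∑ i ∈ range p, W i * tT (fS g) (fR g) (p - 1 - i)) ≤
            ∑ i ∈ range p, ∑ q ∈ antidiagonal m,
              coeff q.1 (W i) * ((p - 1 - i + q.2 + 1 : ℕ) * coeff q.2 (W (p - 1 - i))) := by
          rw [map_sum]
          gcongr with i hi
          simp at hi
          rw [coeff_mul]
          gcongr with q hq
          have h1 := mem_antidiagonal.1 hq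
          exact ih _ _ (by omega)
        have e2 : ∑ i ∈ range p, ∑ q ∈ antidiagonal m,
              coeff q.1 (W i) * ((p - 1 - i + q.2 + 1 : ℕ) * coeff q.2 (W (p - 1 - i))) =
            ∑ i ∈ range p, ∑ q ∈ antidiagonal m,
              ((i + q.1 + 1 : ℕ) * coeff q.1 (W i)) * coeff q.2 (W (p - 1 - i)) := by
          rw [← sum_range_reflect]
          apply sum_congr rfl
          intro i hi
          simp at hi
          rw [← Finset.Nat.sum_antidiagonal_swap]
          apply sum_congr rfl
          intro q _
          simp only [Prod.fst_swap, Prod.snd_swap]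
          rw [show p - 1 - (p - 1 - i) = i by omega]
          ring
        rw [two_mul, map_add]
        refine (add_le_add e1 (e1.trans e2.le)).trans ?_
        rw [← sum_add_distrib, map_sum, mul_sum]
        gcongr with i hi
        simp at hi
        rw [← sum_add_distrib, coeff_mul, mul_sum]
        gcongr with q hq
        have h1 := mem_antidiagonal.1 hq
        rw [show coeff q.1 (W i) * ((p - 1 - i + q.2 + 1 : ℕ) * coeff q.2 (W (p - 1 - i))) +
          ((i + q.1 + 1 : ℕ) * coeff q.1 (W i)) * coeff q.2 (W (p - 1 - i)) =
          ((p - 1 - i + q.2 + 1 + (i + q.1 + 1) : ℕ) : ℝ≥0) * (coeff q.1 (W i) * coeff q.2 (W (p - 1 - i))) by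
            push_cast; ring]
        refine mul_le_mul_left (Nat.cast_le.2 (by omega)) _
      · rw [mul_sum]
        refine sum_le_sum fun j hj => ?_
        simp at hj
        rw [mul_left_comm]
        refine mul_le_mul_right ((ih _ _ (by omega)).trans ?_) _
        exact mul_le_mul_left (Nat.cast_le.2 (by omega)) _
end

section
open Finset PowerSeries
open scoped NNReal ENNReal

lemma tsum_antidiag (h : ℕ × ℕ → ℝ≥0∞) : ∑' n, ∑ p ∈ antidiagonal n, h p = ∑' a, ∑' b, h (a, b) := by
  rw [← ENNReal.tsum_prod, ← Finset.HasAntidiagonal.sigmaAntidiagonalEquivProd.tsum_eq, ENNReal.tsum_sigma']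
  congr 1
  ext n
  rw [← Finset.sum_coe_sort, tsum_fintype]
  rfl

/-- evaluation of a power series with nonnegative coefficients -/
noncomputable def ev (x : ℝ≥0) : ℝ≥0⟦X⟧ →+* ℝ≥0∞ where
  toFun F := ∑' n, ((coeff n F : ℝ≥0) : ℝ≥0∞) * (x : ℝ≥0∞) ^ n
  map_one' := by
    rw [tsum_eq_single 0]
    · simp
    · intro n hn
      simp [coeff_one, hn]
  map_zero' := by simp
  map_add' F G := by
    rw [← ENNReal.tsum_add]
    simp [add_mul]
  map_mul' F G := by
    have : ∀ n, ((coeff n (F * G) : ℝ≥0) : ℝ≥0∞) * (x : ℝ≥0∞) ^ n =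
        ∑ p ∈ antidiagonal n, (fun p : ℕ × ℕ => (((coeff p.1 F : ℝ≥0) : ℝ≥0∞) * (x : ℝ≥0∞) ^ p.1) *
          (((coeff p.2 G : ℝ≥0) : ℝ≥0∞) * (x : ℝ≥0∞) ^ p.2)) p := by
      intro n
      rw [coeff_mul, ENNReal.ofNNReal_finsetSum, sum_mul]
      apply sum_congr rfl
      intro p hp
      rw [← mem_antidiagonal.1 hp, pow_add]
      push_cast
      ring
    simp_rw [this]
    rw [tsum_antidiag]
    simp_rw [ENNReal.tsum_mul_left, ENNReal.tsum_mul_right]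

lemma ev_def (x : ℝ≥0) (F : ℝ≥0⟦X⟧) : ev x F = ∑' n, ((coeff n F : ℝ≥0) : ℝ≥0∞) * (x : ℝ≥0∞) ^ n := rfl

lemma ev_Sg (x : ℝ≥0) (g : ℕ → ℝ≥0) (F : ℕ → ℝ≥0⟦X⟧) :
    ev x (Sg g F) = ∑' j, (g (j + 1) : ℝ≥0∞) * (x : ℝ≥0∞) ^ (j + 1) * ev x (F j) := by
  simp_rw [ev_def]
  rw [tsum_eq_zero_add' ENNReal.summable]
  have : ∀ n, ((coeff (n + 1) (Sg g F) : ℝ≥0) : ℝ≥0∞) * (x : ℝ≥0∞) ^ (n + 1) =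
      ∑ p ∈ antidiagonal n, (fun p : ℕ × ℕ => ((g (p.1 + 1) : ℝ≥0∞) * (x : ℝ≥0∞) ^ (p.1 + 1)) *
          (((coeff p.2 (F p.1) : ℝ≥0) : ℝ≥0∞) * (x : ℝ≥0∞) ^ p.2)) p := by
    intro n
    rw [Finset.Nat.sum_antidiagonal_eq_sum_range_succ_mk, coeff_Sg, ENNReal.ofNNReal_finsetSum, sum_mul]
    apply sum_congr rfl
    intro j hj
    simp at hj
    obtain ⟨l, rfl⟩ : ∃ l, n = j + l := ⟨n - j, by omega⟩
    simp only [show j + l + 1 - 1 - j = l by omega, show j + l - j = l by omega]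
    push_cast
    ring
  simp_rw [this]
  rw [tsum_antidiag]
  simp_rw [ENNReal.tsum_mul_left]
  simp [coeff_Sg]

lemma coeff_le_ev (x : ℝ≥0) (F : ℝ≥0⟦X⟧) (n : ℕ) : ((coeff n F : ℝ≥0) : ℝ≥0∞) * (x : ℝ≥0∞) ^ n ≤ ev x F :=
  ENNReal.le_tsum (f := fun n => ((coeff n F : ℝ≥0) : ℝ≥0∞) * (x : ℝ≥0∞) ^ n) n

lemma ev_mono_coeff (x : ℝ≥0) (F G : ℝ≥0⟦X⟧) (h : ∀ n, coeff n F ≤ coeff n G) : ev x F ≤ ev x G := by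
  rw [ev_def, ev_def]
  gcongr with n
  exact h n

lemma ev_mono {x y : ℝ≥0} (h : x ≤ y) (F : ℝ≥0⟦X⟧) : ev x F ≤ ev y F := by
  rw [ev_def, ev_def]
  gcongr

lemma tT_mono {S R S' R' : ℝ≥0∞} (h : S ≤ S') (h' : R ≤ R') (j : ℕ) : tT S R j ≤ tT S' R' j := by
  unfold tT; gcongr
lemma tB_mono {S R S' R' : ℝ≥0∞} (h : S ≤ S') (h' : R ≤ R') (j : ℕ) : tB S R j ≤ tB S' R' j := by
  unfold tB; gcongr

/-- right-hand sides of the system -/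
noncomputable def PA (g : ℕ → ℝ≥0) (x : ℝ≥0) (S R : ℝ≥0∞) : ℝ≥0∞ :=
  ∑' j, (g (j + 1) : ℝ≥0∞) * (x : ℝ≥0∞) ^ (j + 1) * tT S R j
noncomputable def PB (g : ℕ → ℝ≥0) (x : ℝ≥0) (S R : ℝ≥0∞) : ℝ≥0∞ :=
  ∑' j, (g (j + 1) : ℝ≥0∞) * (x : ℝ≥0∞) ^ (j + 1) * tB S R j

lemma ev_step (g : ℕ → ℝ≥0) (x : ℝ≥0) (P : ℝ≥0⟦X⟧ × ℝ≥0⟦X⟧) :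
    ev x (sysStep g P).1 = PA g x (ev x P.1) (ev x P.2) ∧
    ev x (sysStep g P).2 = 1 + PB g x (ev x P.1) (ev x P.2) := by
  simp only [sysStep, map_add, map_one, ev_Sg, tT_map, tB_map]
  exact ⟨rfl, rfl⟩

lemma ev_fS (g : ℕ → ℝ≥0) (x : ℝ≥0) : ev x (fS g) = PA g x (ev x (fS g)) (ev x (fR g)) := by
  conv_lhs => rw [← fS_eq]
  exact (ev_step g x (fS g, fR g)).1

lemma ev_fR (g : ℕ → ℝ≥0) (x : ℝ≥0) : ev x (fR g) = 1 + PB g x (ev x (fS g)) (ev x (fR g)) := by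
  conv_lhs => rw [← fR_eq]
  exact (ev_step g x (fS g, fR g)).2

lemma ev_le_of_cong {x : ℝ≥0} {F : ℝ≥0⟦X⟧} {G : ℕ → ℝ≥0⟦X⟧} {c : ℝ≥0∞} (h : ∀ k, PCong k F (G k))
    (hG : ∀ k, ev x (G k) ≤ c) : ev x F ≤ c := by
  rw [ev_def, ENNReal.tsum_eq_iSup_nat]
  refine iSup_le fun k => ?_
  calc _ = ∑ n ∈ range k, ((coeff n (G k) : ℝ≥0) : ℝ≥0∞) * (x : ℝ≥0∞) ^ n := by
        apply sum_congr rfl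
        intro n hn
        rw [h k n (by simpa using hn)]
    _ ≤ ev x (G k) := ENNReal.sum_le_tsum _
    _ ≤ c := hG k

lemma ev_sub_sol (g : ℕ → ℝ≥0) (x : ℝ≥0) (S R : ℝ≥0∞) (hS : PA g x S R ≤ S) (hR : 1 + PB g x S R ≤ R) :
    ev x (fS g) ≤ S ∧ ev x (fR g) ≤ R := by
  have : ∀ k, ev x (sysIter g k).1 ≤ S ∧ ev x (sysIter g k).2 ≤ R := by
    intro k
    induction k with
    | zero => simp [sysIter]
    | succ k ih =>
      rw [sysIter_succ, (ev_step g x _).1, (ev_step g x _).2]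
      constructor
      · refine le_trans ?_ hS
        unfold PA
        gcongr
        exact tT_mono ih.1 ih.2 _
      · refine le_trans ?_ hR
        unfold PB
        gcongr
        exact tB_mono ih.1 ih.2 _
  exact ⟨ev_le_of_cong (fun k => (fSR_cong g k).1) fun k => (this k).1,
    ev_le_of_cong (fun k => (fSR_cong g k).2) fun k => (this k).2⟩

lemma tT_two {A : Type*} [CommSemiring A] (S R : A) : tT S R 2 = S ^ 2 + 2 * R := by
  simp [tT, sum_range_succ, Nat.choose]

/-- upper bound from a sub-solution -/
lemma upper_bound (g : ℕ → ℝ≥0) (W : ℕ → ℝ≥0⟦X⟧) (hW : IsW g W) (x : ℝ≥0) (S R : ℝ≥0∞)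
    (hS : PA g x S R ≤ S) (hR : 1 + PB g x S R ≤ R) (n : ℕ) :
    ((coeff n (W 2) : ℝ≥0) : ℝ≥0∞) * (x : ℝ≥0∞) ^ n ≤ S ^ 2 + 2 * R := by
  obtain ⟨h1, h2⟩ := ev_sub_sol g x S R hS hR
  refine (coeff_le_ev x (W 2) n).trans ?_
  refine (ev_mono_coeff x _ _ fun m => W_le_T g W hW _ 2 m le_rfl).trans ?_
  rw [tT_map, tT_two]
  gcongr

/-- when the system has no finite solution, the coefficients are large -/
lemma ev_infinite (g : ℕ → ℝ≥0) (W : ℕ → ℝ≥0⟦X⟧) (hW : IsW g W) (x : ℝ≥0)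
    (h : ev x (fS g) = ⊤ ∨ ev x (fR g) = ⊤) :
    ∑' m, ((m + 3 : ℕ) : ℝ≥0∞) * (((coeff m (W 2) : ℝ≥0) : ℝ≥0∞) * (x : ℝ≥0∞) ^ m) = ⊤ := by
  have h1 : ev x (tT (fS g) (fR g) 2) = ⊤ := by
    rw [tT_map, tT_two]
    rcases h with h | h <;> simp [h]
  rw [← top_le_iff, ← h1, ev_def]
  refine ENNReal.tsum_le_tsum fun m => ?_
  rw [← mul_assoc]
  refine mul_le_mul_left ?_ _
  have := T_le_W g W hW _ 2 m le_rfl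
  rw [show 2 + m + 1 = m + 3 by ring] at this
  exact_mod_cast this
end

section
open Finset

section setoids
variable {Ω : Type*}

/-- merge the classes of `r` and `s` -/
def mg (t : Setoid Ω) (r s : Ω) : Setoid Ω where
  r x y := t x y ∨ (t x r ∧ t s y) ∨ (t x s ∧ t r y)
  iseqv := by
    refine ⟨fun x => Or.inl (t.refl' x), ?_, ?_⟩
    · rintro x y (h | ⟨h, h'⟩ | ⟨h, h'⟩)
      · exact Or.inl (t.symm' h)
      · exact Or.inr (Or.inr ⟨t.symm' h', t.symm' h⟩)
      · exact Or.inr (Or.inl ⟨t.symm' h', t.symm' h⟩)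
    · rintro x y z (h | ⟨h, h'⟩ | ⟨h, h'⟩) (k | ⟨k, k'⟩ | ⟨k, k'⟩)
      · exact Or.inl (t.trans' h k)
      · exact Or.inr (Or.inl ⟨t.trans' h k, k'⟩)
      · exact Or.inr (Or.inr ⟨t.trans' h k, k'⟩)
      · exact Or.inr (Or.inl ⟨h, t.trans' h' k⟩)
      · exact Or.inr (Or.inl ⟨h, k'⟩)
      · exact Or.inl (t.trans' h k')
      · exact Or.inr (Or.inr ⟨h, t.trans' h' k⟩)
      · exact Or.inl (t.trans' h k')
      · exact Or.inr (Or.inr ⟨h, k'⟩)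

lemma mg_apply (t : Setoid Ω) (r s x y : Ω) :
    mg t r s x y ↔ t x y ∨ (t x r ∧ t s y) ∨ (t x s ∧ t r y) := Iff.rfl

lemma mg_le_iff (t u : Setoid Ω) (r s : Ω) : mg t r s ≤ u ↔ t ≤ u ∧ u r s := by
  constructor
  · intro h
    exact ⟨fun {x y} hxy => h (Or.inl hxy), h (Or.inr (Or.inl ⟨t.refl' r, t.refl' s⟩))⟩
  · rintro ⟨h, hrs⟩ x y (hh | ⟨hh, h'⟩ | ⟨hh, h'⟩)
    · exact h hh
    · exact u.trans' (h hh) (u.trans' hrs (h h'))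
    · exact u.trans' (h hh) (u.trans' (u.symm' hrs) (h h'))

lemma mg_self {t : Setoid Ω} {r s : Ω} (h : t r s) : mg t r s = t :=
  eq_of_forall_ge_iff fun u => by
    rw [mg_le_iff]
    exact ⟨fun h => h.1, fun h' => ⟨h', h' h⟩⟩

lemma mg_congr {t : Setoid Ω} {r s a f : Ω} (h : t r a) (h' : t s f) : mg t r s = mg t a f :=
  eq_of_forall_ge_iff fun u => by
    rw [mg_le_iff, mg_le_iff]
    refine and_congr_right fun hu => ⟨fun k => ?_, fun k => ?_⟩
    · exact u.trans' (u.symm' (hu h)) (u.trans' k (hu h'))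
    · exact u.trans' (hu h) (u.trans' k (u.symm' (hu h')))

lemma mg_sup (t v : Setoid Ω) (r s : Ω) : mg (t ⊔ v) r s = mg t r s ⊔ v :=
  eq_of_forall_ge_iff fun u => by
    rw [mg_le_iff, sup_le_iff, sup_le_iff, mg_le_iff]
    tauto

/-- the cycle partition -/
abbrev cyc (σ : Equiv.Perm Ω) : Setoid Ω := Equiv.Perm.SameCycle.setoid σ

lemma cyc_apply (σ : Equiv.Perm Ω) (x y : Ω) : cyc σ x y ↔ σ.SameCycle x y := Iff.rfl

lemma cyc_le_iff (σ : Equiv.Perm Ω) (t : Setoid Ω) : cyc σ ≤ t ↔ ∀ x, t x (σ x) := by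
  constructor
  · intro h x
    exact h (Equiv.Perm.sameCycle_apply_right.2 (Equiv.Perm.SameCycle.refl σ x))
  · intro h x y
    rintro ⟨i, rfl⟩
    have hn : ∀ n : ℕ, ∀ z, t z ((σ ^ n) z) := by
      intro n
      induction n with
      | zero => intro z; simpa using t.refl' z
      | succ n ih =>
        intro z
        rw [pow_succ']
        exact t.trans' (ih z) (h _)
    obtain ⟨n, rfl | rfl⟩ := i.eq_nat_or_neg
    · exact_mod_cast hn n x
    · have := hn n ((σ ^ (-(n : ℤ))) x)
      apply t.symm'
      simpa using this

lemma cyc_one : cyc (1 : Equiv.Perm Ω) = ⊥ := by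
  rw [eq_bot_iff, cyc_le_iff]
  intro x
  exact Setoid.refl' _ x

lemma mg_cyc_swap [DecidableEq Ω] (σ : Equiv.Perm Ω) (r s : Ω) :
    mg (cyc (σ * Equiv.swap r s)) r s = mg (cyc σ) r s := by
  have key : ∀ σ : Equiv.Perm Ω, mg (cyc (σ * Equiv.swap r s)) r s ≤ mg (cyc σ) r s := by
    intro σ
    obtain ⟨h1, h2⟩ := (mg_le_iff (cyc σ) _ r s).1 le_rfl
    rw [cyc_le_iff] at h1
    rw [mg_le_iff, cyc_le_iff]
    refine ⟨fun x => ?_, h2⟩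
    rw [Equiv.Perm.mul_apply]
    rcases eq_or_ne x r with rfl | hr
    · rw [Equiv.swap_apply_left]; exact Setoid.trans' _ h2 (h1 s)
    rcases eq_or_ne x s with rfl | hs
    · rw [Equiv.swap_apply_right]; exact Setoid.trans' _ (Setoid.symm' _ h2) (h1 r)
    rw [Equiv.swap_apply_of_ne_of_ne hr hs]; exact h1 x
  refine le_antisymm (key σ) ?_
  have := key (σ * Equiv.swap r s)
  rwa [mul_assoc, Equiv.swap_mul_self, mul_one] at this

/-- transversals -/
def IsTr (t : Setoid Ω) (A : Finset Ω) : Prop :=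
  (∀ x, ∃ a ∈ A, t a x) ∧ ∀ a ∈ A, ∀ b ∈ A, t a b → a = b

lemma IsTr.card {t : Setoid Ω} {A : Finset Ω} (h : IsTr t A) : Nat.card (Quotient t) = A.card := by
  rw [← Fintype.card_coe, ← Nat.card_eq_fintype_card]
  symm
  refine Nat.card_eq_of_bijective (fun a : A => (Quotient.mk t a.1)) ⟨?_, ?_⟩
  · intro a b hab
    exact Subtype.ext (h.2 _ a.2 _ b.2 (Quotient.exact hab))
  · intro q
    induction q using Quotient.inductionOn with
    | h x =>
      obtain ⟨a, ha, hx⟩ := h.1 x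
      exact ⟨⟨a, ha⟩, Quotient.sound hx⟩

lemma exists_IsTr [Fintype Ω] (t : Setoid Ω) : ∃ A, IsTr t A := by
  classical
  refine ⟨univ.image (fun x => (Quotient.mk t x).out), fun x => ⟨_, mem_image_of_mem _ (mem_univ x), ?_⟩, ?_⟩
  · exact Quotient.mk_out x
  · intro a ha b hb hab
    simp only [mem_image, mem_univ, true_and] at ha hb
    obtain ⟨x, rfl⟩ := ha
    obtain ⟨y, rfl⟩ := hb
    have h1 : t x y := t.trans' (t.symm' (Quotient.mk_out x)) (t.trans' hab (Quotient.mk_out y))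
    rw [show Quotient.mk t x = Quotient.mk t y from Quotient.sound h1]

lemma IsTr.merge [DecidableEq Ω] {t : Setoid Ω} {A : Finset Ω} (h : IsTr t A) {a f : Ω} (ha : a ∈ A)
    (hf : f ∈ A) (haf : a ≠ f) : IsTr (mg t a f) (A.erase f) := by
  constructor
  · intro x
    obtain ⟨b, hb, hx⟩ := h.1 x
    by_cases hbf : b = f
    · subst hbf
      exact ⟨a, mem_erase.2 ⟨haf, ha⟩, Or.inr (Or.inl ⟨t.refl' a, hx⟩)⟩
    · exact ⟨b, mem_erase.2 ⟨hbf, hb⟩, Or.inl hx⟩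
  · intro b hb c hc hbc
    rw [mem_erase] at hb hc
    rcases hbc with k | ⟨k, k'⟩ | ⟨k, k'⟩
    · exact h.2 _ hb.2 _ hc.2 k
    · exact absurd (h.2 _ hf _ hc.2 k').symm hc.1
    · exact absurd (h.2 _ hb.2 _ hf k) hb.1

lemma card_mg [Fintype Ω] {t : Setoid Ω} {r s : Ω} (h : ¬ t r s) :
    Nat.card (Quotient (mg t r s)) + 1 = Nat.card (Quotient t) := by
  classical
  obtain ⟨A, hA⟩ := exists_IsTr t
  obtain ⟨a, ha, hr⟩ := hA.1 r
  obtain ⟨f, hf, hs⟩ := hA.1 s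
  have haf : a ≠ f := by
    rintro rfl
    exact h (t.trans' (t.symm' hr) hs)
  rw [mg_congr (t.symm' hr) (t.symm' hs), (hA.merge ha hf haf).card, hA.card, card_erase_add_one hf]

lemma IsTr.split [DecidableEq Ω] {t : Setoid Ω} {A : Finset Ω} {r s a : Ω} (h : IsTr (mg t r s) A)
    (ha : a ∈ A) (har : mg t r s a r) (hrs : ¬ t r s) :
    IsTr t (insert s (insert r (A.erase a))) := by
  have h1 : ∀ b ∈ A.erase a, ¬ t b r ∧ ¬ t b s := by
    intro b hb
    rw [mem_erase] at hb
    refine ⟨fun hbr => hb.1 (h.2 b hb.2 a ha ?_), fun hbs => hb.1 (h.2 b hb.2 a ha ?_)⟩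
    · exact Setoid.trans' _ (Or.inl hbr) (Setoid.symm' _ har)
    · exact Setoid.trans' _ (Or.inr (Or.inr ⟨hbs, t.refl' r⟩)) (Setoid.symm' _ har)
  constructor
  · intro x
    obtain ⟨b, hb, hx⟩ := h.1 x
    by_cases hxr : t r x
    · exact ⟨r, by simp, hxr⟩
    by_cases hxs : t s x
    · exact ⟨s, by simp, hxs⟩
    rcases hx with k | ⟨k, k'⟩ | ⟨k, k'⟩
    · refine ⟨b, ?_, k⟩
      have : b ≠ a := by
        rintro rfl
        rcases har with e | ⟨e, e'⟩ | ⟨e, e'⟩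
        · exact hxr (t.trans' (t.symm' e) k)
        · exact hxr (t.trans' (t.symm' e) k)
        · exact hxs (t.trans' (t.symm' e) k)
      simp [this, hb]
    · exact absurd k' hxs
    · exact absurd k' hxr
  · intro b hb c hc hbc
    rw [mem_insert, mem_insert] at hb hc
    rcases hb with rfl | rfl | hb <;> rcases hc with rfl | rfl | hc
    · rfl
    · exact absurd (t.symm' hbc) hrs
    · exact absurd (t.symm' hbc) (h1 _ hc).2
    · exact absurd hbc hrs
    · rfl
    · exact absurd (t.symm' hbc) (h1 _ hc).1
    · exact absurd hbc (h1 _ hb).2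
    · exact absurd hbc (h1 _ hb).1
    · exact h.2 _ (mem_erase.1 hb).2 _ (mem_erase.1 hc).2 (Or.inl hbc)

lemma IsTr.unsplit [DecidableEq Ω] {t : Setoid Ω} {B : Finset Ω} {r s a : Ω}
    (h : IsTr t (insert s (insert r B))) (hr : r ∉ B) (hs : s ∉ B) (har : mg t r s a r) :
    IsTr (mg t r s) (insert a B) := by
  have hsr : mg t r s a s := Setoid.trans' _ har (Or.inr (Or.inl ⟨t.refl' r, t.refl' s⟩))
  have h1 : ∀ b ∈ B, ¬ t b r ∧ ¬ t b s := by
    intro b hb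
    refine ⟨fun k => hr ?_, fun k => hs ?_⟩
    · rwa [← h.2 b (by simp [hb]) r (by simp) k]
    · rwa [← h.2 b (by simp [hb]) s (by simp) k]
  have h2 : ∀ b ∈ B, ¬ mg t r s r b := by
    rintro b hb (k | ⟨k, k'⟩ | ⟨k, k'⟩)
    · exact (h1 b hb).1 (t.symm' k)
    · exact (h1 b hb).2 (t.symm' k')
    · exact (h1 b hb).1 (t.symm' k')
  constructor
  · intro x
    obtain ⟨b, hb, hx⟩ := h.1 x
    rw [mem_insert, mem_insert] at hb
    rcases hb with rfl | rfl | hb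
    · exact ⟨a, by simp, Setoid.trans' _ hsr (Or.inl hx)⟩
    · exact ⟨a, by simp, Setoid.trans' _ har (Or.inl hx)⟩
    · exact ⟨b, by simp [hb], Or.inl hx⟩
  · intro b hb c hc hbc
    rw [mem_insert] at hb hc
    rcases hb with rfl | hb <;> rcases hc with rfl | hc
    · rfl
    · exact absurd (Setoid.trans' _ (Setoid.symm' _ har) hbc) (h2 c hc)
    · exact absurd (Setoid.symm' _ (Setoid.trans' _ hbc har)) (h2 b hb)
    · rcases hbc with k | ⟨k, k'⟩ | ⟨k, k'⟩
      · exact h.2 b (by simp [hb]) c (by simp [hc]) k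
      · exact absurd k (h1 b hb).1
      · exact absurd k (h1 b hb).2

end setoids

section swaps
variable {Ω : Type*} [Fintype Ω] [DecidableEq Ω]

/-- the cycle of `s = σ^m r` in `σ * swap r s` -/
lemma cyc_swap_arc (σ : Equiv.Perm Ω) (r : Ω) (m : ℕ) (hm : m < Function.minimalPeriod σ r) (hm0 : 0 < m) (x : Ω) :
    (σ * Equiv.swap r ((σ ^ m) r)).SameCycle ((σ ^ m) r) x ↔ ∃ i, 1 ≤ i ∧ i ≤ m ∧ (σ ^ i) r = x := by
  set s := (σ ^ m) r with hs
  have hinj : ∀ i j, i < Function.minimalPeriod σ r → j < Function.minimalPeriod σ r →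
      (σ ^ i) r = (σ ^ j) r → i = j := by
    intro i j hi hj hij
    rw [← Equiv.Perm.iterate_eq_pow, ← Equiv.Perm.iterate_eq_pow] at hij
    exact Function.iterate_injOn_Iio_minimalPeriod hi hj hij
  have step : ∀ i, 1 ≤ i → i < m → (σ * Equiv.swap r s) ((σ ^ i) r) = (σ ^ (i + 1)) r := by
    intro i h1 h2
    rw [Equiv.Perm.mul_apply, Equiv.swap_apply_of_ne_of_ne, pow_succ', Equiv.Perm.mul_apply]
    · intro h
      have := hinj i 0 (by omega) (by omega) (by simpa using h)
      omega
    · intro h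
      have := hinj i m (by omega) (by omega) h
      omega
  have stepS : (σ * Equiv.swap r s) s = (σ ^ 1) r := by
    rw [Equiv.Perm.mul_apply, Equiv.swap_apply_right, pow_one]
  constructor
  · intro h
    obtain ⟨n, rfl⟩ := h.exists_nat_pow_eq
    clear h
    induction n with
    | zero => exact ⟨m, hm0, le_rfl, by simp [hs]⟩
    | succ n ih =>
      obtain ⟨i, h1, h2, h3⟩ := ih
      rw [pow_succ', Equiv.Perm.mul_apply, ← h3]
      rcases h2.lt_or_eq with h | h
      · exact ⟨i + 1, by omega, by omega, (step i h1 h).symm⟩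
      · subst h
        exact ⟨1, le_rfl, hm0, by rw [← hs, stepS]⟩
  · rintro ⟨i, h1, h2, rfl⟩
    obtain ⟨j, rfl⟩ : ∃ j, i = j + 1 := ⟨i - 1, by omega⟩
    have : ∀ j, j + 1 ≤ m → (((σ * Equiv.swap r s) ^ (j + 1)) s) = (σ ^ (j + 1)) r := by
      intro j
      induction j with
      | zero => intro _; rw [zero_add, pow_one (σ * _), stepS]
      | succ j ih =>
        intro hj
        rw [pow_succ' (σ * _), Equiv.Perm.mul_apply, ih (by omega), step _ (by omega) (by omega)]
    exact ⟨(j + 1 : ℕ), by rw [zpow_natCast]; exact this j h2⟩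

lemma exists_arc {σ : Equiv.Perm Ω} {r s : Ω} (h : σ.SameCycle r s) :
    ∃ m, m < Function.minimalPeriod σ r ∧ (σ ^ m) r = s := by
  obtain ⟨n, rfl⟩ := h.exists_nat_pow_eq
  refine ⟨n % Function.minimalPeriod σ r, Nat.mod_lt _ ?_, ?_⟩
  · exact Function.minimalPeriod_pos_of_mem_periodicPts (Function.Injective.mem_periodicPts σ.injective r)
  · rw [← Equiv.Perm.iterate_eq_pow, ← Equiv.Perm.iterate_eq_pow, Function.iterate_mod_minimalPeriod_eq]

lemma swap_split {σ : Equiv.Perm Ω} {r s : Ω} (hrs : r ≠ s) (h : σ.SameCycle r s) :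
    ¬ (σ * Equiv.swap r s).SameCycle r s := by
  obtain ⟨m, hm, rfl⟩ := exists_arc h
  have hm0 : 0 < m := by
    rcases Nat.eq_zero_or_pos m with rfl | h
    · simp at hrs
    · exact h
  intro hh
  obtain ⟨i, h1, h2, h3⟩ := (cyc_swap_arc σ r m hm hm0 r).1 hh.symm
  rw [← Equiv.Perm.iterate_eq_pow] at h3
  have : Function.IsPeriodicPt σ i r := h3
  have := this.minimalPeriod_le (by omega)
  omega

lemma swap_merge {σ : Equiv.Perm Ω} {r s : Ω} (h : ¬ σ.SameCycle r s) :
    (σ * Equiv.swap r s).SameCycle r s := by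
  have hp : 0 < Function.minimalPeriod σ s :=
    Function.minimalPeriod_pos_of_mem_periodicPts (Function.Injective.mem_periodicPts σ.injective s)
  have key : ∀ j, j < Function.minimalPeriod σ s → (σ * Equiv.swap r s).SameCycle r ((σ ^ (j + 1)) s) := by
    intro j
    induction j with
    | zero =>
      intro _
      refine ⟨1, ?_⟩
      simp
    | succ j ih =>
      intro hj
      refine (ih (by omega)).trans ⟨1, ?_⟩
      rw [zpow_one, Equiv.Perm.mul_apply, Equiv.swap_apply_of_ne_of_ne, pow_succ' σ (j + 1), Equiv.Perm.mul_apply]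
      · intro hh
        exact h (Equiv.Perm.SameCycle.symm ⟨(j + 1 : ℕ), by rw [zpow_natCast]; exact hh⟩)
      · intro hh
        rw [← Equiv.Perm.iterate_eq_pow] at hh
        have : Function.IsPeriodicPt σ (j + 1) s := hh
        have := this.minimalPeriod_le (by omega)
        omega
  have := key (Function.minimalPeriod σ s - 1) (by omega)
  rwa [show Function.minimalPeriod σ s - 1 + 1 = Function.minimalPeriod σ s by omega,
    ← Equiv.Perm.iterate_eq_pow, Function.iterate_minimalPeriod] at this

end swaps
end

section
open Finset

section contr
variable {Ω : Type*} [Fintype Ω] [DecidableEq Ω]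

def oo (σ α : Equiv.Perm Ω) : Setoid Ω := cyc σ ⊔ cyc α

noncomputable def kap (t : Setoid Ω) : ℕ := Nat.card (Quotient t)

lemma kap_split {σ : Equiv.Perm Ω} {r s : Ω} (hrs : r ≠ s) (h : σ.SameCycle r s) :
    kap (cyc (σ * Equiv.swap r s)) = kap (cyc σ) + 1 ∧ mg (cyc (σ * Equiv.swap r s)) r s = cyc σ := by
  have h1 := card_mg (t := cyc (σ * Equiv.swap r s)) (r := r) (s := s) (swap_split hrs h)
  have h2 : mg (cyc (σ * Equiv.swap r s)) r s = cyc σ := by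
    rw [mg_cyc_swap, mg_self (t := cyc σ) h]
  rw [h2] at h1
  exact ⟨h1.symm, h2⟩

lemma kap_merge {σ : Equiv.Perm Ω} {r s : Ω} (h : ¬ σ.SameCycle r s) :
    kap (cyc (σ * Equiv.swap r s)) + 1 = kap (cyc σ) ∧ cyc (σ * Equiv.swap r s) = mg (cyc σ) r s := by
  have h1 := card_mg (t := cyc σ) (r := r) (s := s) h
  have h2 : cyc (σ * Equiv.swap r s) = mg (cyc σ) r s := by
    rw [← mg_cyc_swap, mg_self (t := cyc (σ * Equiv.swap r s)) (swap_merge h)]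
  rw [← h2] at h1
  exact ⟨h1, h2⟩

lemma contr_comm {α : Equiv.Perm Ω} (hα : ∀ x, α (α x) = x) {r s : Ω} (hr : α r = s) :
    α * Equiv.swap r s = Equiv.swap r s * α := by
  have hs : α s = r := by rw [← hr, hα]
  rw [Equiv.mul_swap_eq_swap_mul, hr, hs, Equiv.swap_comm]

lemma contr_face {σ α : Equiv.Perm Ω} (hα : ∀ x, α (α x) = x) {r s : Ω} (hr : α r = s) :
    (σ * Equiv.swap r s) * (α * Equiv.swap r s) = σ * α := by
  rw [contr_comm hα hr, mul_assoc, ← mul_assoc (Equiv.swap r s), Equiv.swap_mul_self, one_mul]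

lemma contr_invol {α : Equiv.Perm Ω} (hα : ∀ x, α (α x) = x) {r s : Ω} (hr : α r = s) (x : Ω) :
    (α * Equiv.swap r s) ((α * Equiv.swap r s) x) = x := by
  have h : (α * Equiv.swap r s) * (α * Equiv.swap r s) = α * α := by
    nth_rewrite 2 [contr_comm hα hr]
    rw [mul_assoc, ← mul_assoc (Equiv.swap r s), Equiv.swap_mul_self, one_mul]
  rw [← Equiv.Perm.mul_apply, h, Equiv.Perm.mul_apply, hα]

lemma contr_supp {α : Equiv.Perm Ω} (hα : ∀ x, α (α x) = x) {r s : Ω} (hr : α r = s) (L : Finset Ω)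
    (hL : ∀ x, x ∈ L ↔ α x ≠ x) (x : Ω) : x ∈ (L.erase r).erase s ↔ (α * Equiv.swap r s) x ≠ x := by
  have hs : α s = r := by rw [← hr, hα]
  rw [mem_erase, mem_erase, Equiv.Perm.mul_apply]
  rcases eq_or_ne x r with rfl | h
  · simp [hs]
  rcases eq_or_ne x s with rfl | h'
  · simp [hr]
  rw [Equiv.swap_apply_of_ne_of_ne h h', hL]
  simp [h, h']

lemma contr_oo {σ α : Equiv.Perm Ω} {r s : Ω} (hr : α r = s) :
    oo σ α = mg (oo (σ * Equiv.swap r s) (α * Equiv.swap r s)) r s := by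
  have h1 : cyc α r s := ⟨1, by simpa using hr⟩
  rw [oo, oo, mg_sup, mg_cyc_swap, ← mg_sup, sup_comm (cyc σ) (cyc (α * Equiv.swap r s)), mg_sup,
    mg_cyc_swap, mg_self h1, sup_comm]

lemma genus_ineq : ∀ (N : ℕ) (σ α : Equiv.Perm Ω) (L : Finset Ω), L.card = N → (∀ x, α (α x) = x) →
    (∀ x, x ∈ L ↔ α x ≠ x) → 2 * (kap (cyc σ) + kap (cyc (σ * α))) ≤ L.card + 4 * kap (oo σ α) := by
  intro N
  induction N using Nat.strong_induction_on with
  | _ N ih =>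
    intro σ α L hN hα hL
    rcases L.eq_empty_or_nonempty with rfl | ⟨r, hrL⟩
    · have h1 : α = 1 := by
        ext x
        by_contra h
        have := (hL x).2 (by simpa using h)
        simp at this
      subst h1
      rw [oo, cyc_one, mul_one, sup_bot_eq]
      omega
    · obtain ⟨s, hs⟩ : ∃ s, α r = s := ⟨_, rfl⟩
      have hrs : r ≠ s := by rw [← hs]; exact ((hL r).1 hrL).symm
      have hsL : s ∈ L := by rw [hL, ← hs, hα, hs]; exact hrs
      have hc : ((L.erase r).erase s).card + 2 = L.card := by
        rw [← card_erase_add_one hrL, ← card_erase_add_one (mem_erase.2 ⟨hrs.symm, hsL⟩)]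
      have := ih _ (by omega) (σ * Equiv.swap r s) (α * Equiv.swap r s) ((L.erase r).erase s) rfl
        (contr_invol hα hs) (contr_supp hα hs L hL)
      rw [contr_face hα hs] at this
      have ho := contr_oo (σ := σ) hs
      by_cases h : σ.SameCycle r s
      · have h1 := (kap_split hrs h).1
        have h2 : kap (oo (σ * Equiv.swap r s) (α * Equiv.swap r s)) ≤ kap (oo σ α) + 1 := by
          rw [ho]
          by_cases h3 : oo (σ * Equiv.swap r s) (α * Equiv.swap r s) r s
          · rw [mg_self h3]; omega
          · exact (card_mg h3).ge
        omega
      · have h1 := (kap_merge h).1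
        have h2 : oo (σ * Equiv.swap r s) (α * Equiv.swap r s) r s :=
          (le_sup_left : cyc (σ * Equiv.swap r s) ≤ _) (swap_merge h)
        rw [mg_self h2] at ho
        rw [ho]
        omega

def good (σ : Equiv.Perm Ω) (A L : Finset Ω) (α : Equiv.Perm Ω) : Prop :=
  (∀ x, α (α x) = x) ∧ (∀ x, x ∈ L ↔ α x ≠ x) ∧ IsTr (oo σ α) A ∧
    2 * (kap (cyc σ) + kap (cyc (σ * α))) = L.card + 4 * A.card

lemma card_erase2 {L : Finset Ω} {r s : Ω} (hrL : r ∈ L) (hsL : s ∈ L) (hrs : r ≠ s) :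
    ((L.erase r).erase s).card + 2 = L.card := by
  rw [← card_erase_add_one hrL, ← card_erase_add_one (mem_erase.2 ⟨hrs.symm, hsL⟩)]

/-- merging with a free cycle -/
lemma good_merge {σ α : Equiv.Perm Ω} {A L : Finset Ω} {r s : Ω} (hrL : r ∈ L) (hsL : s ∈ L)
    (hrs : r ≠ s) (hs : α r = s) (hα : ∀ x, α (α x) = x) (h : ¬ σ.SameCycle r s) :
    good σ A L α ↔ good (σ * Equiv.swap r s) A ((L.erase r).erase s) (α * Equiv.swap r s) := by
  have hc := card_erase2 hrL hsL hrs
  have h1 := (kap_merge h).1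
  have h2 : oo (σ * Equiv.swap r s) (α * Equiv.swap r s) r s :=
    (le_sup_left : cyc (σ * Equiv.swap r s) ≤ _) (swap_merge h)
  have ho := contr_oo (σ := σ) hs
  rw [mg_self h2] at ho
  unfold good
  rw [contr_face hα hs, ← ho]
  constructor
  · rintro ⟨a, b, c, d⟩
    exact ⟨contr_invol hα hs, contr_supp hα hs L b, c, by omega⟩
  · rintro ⟨a, b, c, d⟩
    refine ⟨hα, ?_, c, by omega⟩
    intro x
    have := b x
    have hs' : α s = r := by rw [← hs, hα]
    rcases eq_or_ne x r with rfl | hxr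
    · simp [hrL, hs, hrs.symm]
    rcases eq_or_ne x s with rfl | hxs
    · simp [hsL, hs', hrs]
    rw [mem_erase, mem_erase, Equiv.Perm.mul_apply, Equiv.swap_apply_of_ne_of_ne hxr hxs] at this
    rw [← this]
    simp [hxr, hxs]

/-- splitting the root cycle; `A = insert a B` -/
lemma good_split {σ α : Equiv.Perm Ω} {B L : Finset Ω} {r s a : Ω} (hrL : r ∈ L) (hsL : s ∈ L)
    (hrs : r ≠ s) (hs : α r = s) (hα : ∀ x, α (α x) = x) (h : σ.SameCycle r s) (ha : a ∉ B)
    (har : σ.SameCycle a r) (hrB : r ∉ B) (hsB : s ∉ B) :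
    good σ (insert a B) L α ↔ good (σ * Equiv.swap r s) (insert s (insert r B))
      ((L.erase r).erase s) (α * Equiv.swap r s) := by
  have hc := card_erase2 hrL hsL hrs
  have h1 := (kap_split hrs h).1
  have ho := contr_oo (σ := σ) hs
  have hcard : (insert s (insert r B)).card = (insert a B).card + 1 := by
    rw [card_insert_of_notMem, card_insert_of_notMem hrB, card_insert_of_notMem ha]
    simp [hsB, hrs.symm]
  have har' : oo σ α a r := (le_sup_left : cyc σ ≤ cyc σ ⊔ cyc α) har
  unfold good
  rw [contr_face hα hs, hcard]
  constructor
  · rintro ⟨_, b, c, d⟩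
    refine ⟨contr_invol hα hs, contr_supp hα hs L b, ?_, by omega⟩
    have hn : ¬ oo (σ * Equiv.swap r s) (α * Equiv.swap r s) r s := by
      intro h3
      rw [mg_self h3] at ho
      have := genus_ineq _ (σ * Equiv.swap r s) (α * Equiv.swap r s) ((L.erase r).erase s) rfl
        (contr_invol hα hs) (contr_supp hα hs L b)
      rw [contr_face hα hs, ← ho] at this
      have hk : kap (oo σ α) = (insert a B).card := c.card
      omega
    rw [ho] at c har'
    have := c.split (mem_insert_self a B) har' hn
    rwa [erase_insert ha] at this
  · rintro ⟨_, b, c, d⟩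
    refine ⟨hα, ?_, ?_, by omega⟩
    · intro x
      have := b x
      have hs' : α s = r := by rw [← hs, hα]
      rcases eq_or_ne x r with rfl | hxr
      · simp [hrL, hs, hrs.symm]
      rcases eq_or_ne x s with rfl | hxs
      · simp [hsL, hs', hrs]
      rw [mem_erase, mem_erase, Equiv.Perm.mul_apply, Equiv.swap_apply_of_ne_of_ne hxr hxs] at this
      rw [← this]
      simp [hxr, hxs]
    · rw [ho] at har' ⊢
      exact c.unsplit hrB hsB har'

open Classical in
noncomputable def Ngood (σ : Equiv.Perm Ω) (A L : Finset Ω) : ℕ := (univ.filter (good σ A L)).card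

open Classical in
/-- the number of good involutions, by the partner of `r` -/
lemma Ngood_sum (σ : Equiv.Perm Ω) (A L : Finset Ω) {r : Ω} (hrL : r ∈ L) :
    Ngood σ A L = ∑ s ∈ L.erase r, (univ.filter fun α => good σ A L α ∧ α r = s).card := by
  rw [Ngood, card_eq_sum_card_fiberwise (f := fun α => α r) (t := L.erase r)]
  · simp only [filter_filter]
  · intro α hα
    simp only [coe_filter, mem_univ, true_and, Set.mem_ofPred_eq] at hα
    have h := (hα.2.1 r).1 hrL
    rw [mem_coe, mem_erase]
    refine ⟨h, ?_⟩
    rw [hα.2.1, hα.1]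
    exact h.symm

open Classical in
lemma card_contr (σ : Equiv.Perm Ω) (A A' L : Finset Ω) {r s : Ω} (hrs : r ≠ s)
    (h : ∀ α : Equiv.Perm Ω, α r = s → (∀ x, α (α x) = x) →
      (good σ A L α ↔ good (σ * Equiv.swap r s) A' ((L.erase r).erase s) (α * Equiv.swap r s))) :
    (univ.filter fun α => good σ A L α ∧ α r = s).card =
      Ngood (σ * Equiv.swap r s) A' ((L.erase r).erase s) := by
  rw [Ngood]
  refine card_bij' (fun α _ => α * Equiv.swap r s) (fun α _ => α * Equiv.swap r s) ?_ ?_ ?_ ?_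
  · intro α hα
    simp only [mem_filter, mem_univ, true_and] at hα ⊢
    exact (h α hα.2 hα.1.1).1 hα.1
  · intro α hα
    simp only [mem_filter, mem_univ, true_and] at hα ⊢
    have fr : α r = r := by
      have := (hα.2.1 r).not.1 (by simp)
      simpa using this
    have fs : α s = s := by
      have := (hα.2.1 s).not.1 (by simp)
      simpa using this
    have e1 : (α * Equiv.swap r s) r = s := by simp [fs]
    have comm : α * Equiv.swap r s = Equiv.swap r s * α := by
      rw [Equiv.mul_swap_eq_swap_mul, fr, fs]
    have e2 : ∀ x, (α * Equiv.swap r s) ((α * Equiv.swap r s) x) = x := by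
      intro x
      have h : (α * Equiv.swap r s) * (α * Equiv.swap r s) = α * α := by
        nth_rewrite 2 [comm]
        rw [mul_assoc, ← mul_assoc (Equiv.swap r s), Equiv.swap_mul_self, one_mul]
      rw [← Equiv.Perm.mul_apply, h, Equiv.Perm.mul_apply, hα.1]
    refine ⟨(h _ e1 e2).2 ?_, e1⟩
    rwa [mul_assoc, Equiv.swap_mul_self, mul_one]
  · intro α _
    simp [mul_assoc]
  · intro α _
    simp [mul_assoc]

end contr
end

section
open Finset

def FF : List ℕ → Multiset ℕ → ℕ
  | [], K => if K = 0 then 1 else 0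
  | 0 :: P, K => FF P K
  | (p + 1) :: P, K => ∑ i : Fin p, FF (i.1 :: (p - 1 - i.1) :: P) K +
      (K.attach.map fun k => k.1 * FF ((p + k.1 - 1) :: P) (K.erase k.1)).sum
termination_by P K => 2 * (P.sum + K.sum) + P.length
decreasing_by
  · simp
  · simp only [List.sum_cons, List.length_cons]
    have := i.2
    omega
  · simp only [List.sum_cons, List.length_cons]
    have h := Multiset.sum_erase k.2
    omega

lemma FF_nil (K : Multiset ℕ) : FF [] K = if K = 0 then 1 else 0 := by rw [FF]
lemma FF_zero (P : List ℕ) (K : Multiset ℕ) : FF (0 :: P) K = FF P K := by rw [FF]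
lemma FF_succ (p : ℕ) (P : List ℕ) (K : Multiset ℕ) : FF ((p + 1) :: P) K =
    ∑ i ∈ range p, FF (i :: (p - 1 - i) :: P) K +
      (K.map fun k => k * FF ((p + k - 1) :: P) (K.erase k)).sum := by
  rw [FF, Finset.sum_range, Multiset.attach_map_val' K (fun k => k * FF ((p + k - 1) :: P) (K.erase k))]

/-- summing a function of the rank -/
lemma sum_rank (Q : Finset ℕ) (f : ℕ → ℕ) :
    ∑ m ∈ Q, f (Q.filter (· < m)).card = ∑ i ∈ range Q.card, f i := by
  induction Q using Finset.induction_on_max with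
  | empty => simp
  | insert a s ha ih =>
    have hn : a ∉ s := fun h => lt_irrefl _ (ha a h)
    rw [sum_insert hn, card_insert_of_notMem hn, sum_range_succ, ← ih, add_comm]
    congr 1
    · refine sum_congr rfl fun m hm => ?_
      rw [filter_insert, if_neg (not_lt.2 (ha m hm).le)]
    · rw [filter_insert, if_neg (lt_irrefl a), filter_true_of_mem ha]

section state
variable {Ω : Type*} [Fintype Ω] [DecidableEq Ω]

open Classical in
noncomputable def ell (σ : Equiv.Perm Ω) (L : Finset Ω) (x : Ω) : ℕ := (L.filter (σ.SameCycle x)).card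

lemma ell_congr {σ : Equiv.Perm Ω} {L : Finset Ω} {x y : Ω} (h : σ.SameCycle x y) : ell σ L x = ell σ L y := by
  unfold ell
  congr 1
  ext z
  simp only [mem_filter]
  exact and_congr_right fun _ => ⟨fun k => h.symm.trans k, fun k => h.trans k⟩

lemma ell_other {σ : Equiv.Perm Ω} {L : Finset Ω} {r s x : Ω} (h1 : ¬ σ.SameCycle x r) (h2 : ¬ σ.SameCycle x s) :
    ell (σ * Equiv.swap r s) ((L.erase r).erase s) x = ell σ L x := by
  have key : ∀ y, (σ * Equiv.swap r s).SameCycle x y ↔ σ.SameCycle x y := by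
    have e := mg_cyc_swap σ r s
    have k1 : ∀ y, mg (cyc σ) r s x y ↔ σ.SameCycle x y := by
      intro y
      rw [mg_apply]
      constructor
      · rintro (h | ⟨h, _⟩ | ⟨h, _⟩)
        · exact h
        · exact absurd h h1
        · exact absurd h h2
      · exact Or.inl
    have hxr : ¬ (σ * Equiv.swap r s).SameCycle x r := by
      intro h
      have : mg (cyc (σ * Equiv.swap r s)) r s x r := Or.inl h
      rw [e] at this
      exact h1 ((k1 r).1 this)
    have hxs : ¬ (σ * Equiv.swap r s).SameCycle x s := by
      intro h
      have : mg (cyc (σ * Equiv.swap r s)) r s x s := Or.inl h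
      rw [e] at this
      exact h2 ((k1 s).1 this)
    intro y
    rw [← k1, ← e, mg_apply]
    constructor
    · exact Or.inl
    · rintro (h | ⟨h, _⟩ | ⟨h, _⟩)
      · exact h
      · exact absurd h hxr
      · exact absurd h hxs
  unfold ell
  congr 1
  ext y
  simp only [mem_filter, mem_erase, key]
  constructor
  · tauto
  · rintro ⟨a, b⟩
    refine ⟨⟨?_, ?_, a⟩, b⟩
    · rintro rfl; exact h2 b
    · rintro rfl; exact h1 b

/-- cycle sizes after a merge -/
lemma ell_merge {σ : Equiv.Perm Ω} {L : Finset Ω} {r s : Ω} (hr : r ∈ L) (hs : s ∈ L) (h : ¬ σ.SameCycle r s) :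
    ell (σ * Equiv.swap r s) ((L.erase r).erase s) r + 2 = ell σ L r + ell σ L s := by
  classical
  have hrs : r ≠ s := fun e => h (e ▸ Equiv.Perm.SameCycle.refl _ _)
  have key : ∀ y, (σ * Equiv.swap r s).SameCycle r y ↔ σ.SameCycle r y ∨ σ.SameCycle s y := by
    intro y
    have e := (kap_merge h).2
    have : cyc (σ * Equiv.swap r s) r y ↔ mg (cyc σ) r s r y := by rw [e]
    rw [← cyc_apply, this, mg_apply]
    constructor
    · rintro (a | ⟨_, a⟩ | ⟨a, _⟩)
      · exact Or.inl a
      · exact Or.inr a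
      · exact absurd a h
    · rintro (a | a)
      · exact Or.inl a
      · exact Or.inr (Or.inl ⟨Equiv.Perm.SameCycle.refl _ _, a⟩)
  unfold ell
  have e1 : (((L.erase r).erase s).filter ((σ * Equiv.swap r s).SameCycle r)) =
      ((L.filter (σ.SameCycle r) ∪ L.filter (σ.SameCycle s)).erase r).erase s := by
    ext y
    simp only [mem_filter, mem_erase, mem_union, key]
    tauto
  rw [e1, card_erase2 (by simp [hr, Equiv.Perm.SameCycle.refl]) (by simp [hs, Equiv.Perm.SameCycle.refl]) hrs, card_union_of_disjoint]
  rw [disjoint_left]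
  intro y hy hy'
  simp only [mem_filter] at hy hy'
  exact h (hy.2.trans hy'.2.symm)

/-- positions of the live elements on the cycle of `r` -/
noncomputable def apos (σ : Equiv.Perm Ω) (L : Finset Ω) (r : Ω) : Finset ℕ :=
  (Ico 1 (Function.minimalPeriod σ r)).filter fun i => (σ ^ i) r ∈ L

lemma pow_inj {σ : Equiv.Perm Ω} {r : Ω} {i j : ℕ} (hi : i < Function.minimalPeriod σ r)
    (hj : j < Function.minimalPeriod σ r) (h : (σ ^ i) r = (σ ^ j) r) : i = j := by
  rw [← Equiv.Perm.iterate_eq_pow, ← Equiv.Perm.iterate_eq_pow] at h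
  exact Function.iterate_injOn_Iio_minimalPeriod hi hj h

lemma pow_ne_self {σ : Equiv.Perm Ω} {r : Ω} {i : ℕ} (hi : i < Function.minimalPeriod σ r) (h1 : 1 ≤ i) :
    (σ ^ i) r ≠ r := by
  intro h
  have := pow_inj (σ := σ) (r := r) (i := i) (j := 0) hi (by omega) (by simpa using h)
  omega

lemma sum_apos {σ : Equiv.Perm Ω} {L : Finset Ω} {r : Ω} (f : Ω → ℕ) :
    (∑ s ∈ L.erase r, if σ.SameCycle r s then f s else 0) = ∑ m ∈ apos σ L r, f ((σ ^ m) r) := by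
  classical
  rw [← sum_filter]
  symm
  refine sum_bij (fun m _ => (σ ^ m) r) ?_ ?_ ?_ ?_
  · intro m hm
    simp only [apos, mem_filter, mem_Ico] at hm
    simp only [mem_filter, mem_erase]
    exact ⟨⟨pow_ne_self hm.1.2 hm.1.1, hm.2⟩, ⟨m, by simp⟩⟩
  · intro m hm m' hm' h
    simp only [apos, mem_filter, mem_Ico] at hm hm'
    exact pow_inj hm.1.2 hm'.1.2 h
  · intro s hs
    simp only [mem_filter, mem_erase] at hs
    obtain ⟨m, hm, rfl⟩ := exists_arc hs.2
    refine ⟨m, ?_, rfl⟩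
    simp only [apos, mem_filter, mem_Ico]
    refine ⟨⟨?_, hm⟩, hs.1.2⟩
    rcases Nat.eq_zero_or_pos m with rfl | h
    · simp at hs
    · exact h
  · intros; rfl

lemma card_apos {σ : Equiv.Perm Ω} {L : Finset Ω} {r : Ω} (hr : r ∈ L) : (apos σ L r).card + 1 = ell σ L r := by
  classical
  have := sum_apos (σ := σ) (L := L) (r := r) (fun _ => 1)
  rw [← sum_filter, sum_const, sum_const, smul_eq_mul, smul_eq_mul, mul_one, mul_one] at this
  rw [← this, ell, filter_erase, card_erase_add_one]
  simp [hr, Equiv.Perm.SameCycle.refl]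

lemma ell_split_s {σ : Equiv.Perm Ω} {L : Finset Ω} {r : Ω} {m : ℕ} (hm : m ∈ apos σ L r) :
    ell (σ * Equiv.swap r ((σ ^ m) r)) ((L.erase r).erase ((σ ^ m) r)) ((σ ^ m) r) =
      ((apos σ L r).filter (· < m)).card := by
  classical
  simp only [apos, mem_filter, mem_Ico] at hm
  unfold ell
  symm
  refine card_bij (fun i _ => (σ ^ i) r) ?_ ?_ ?_
  · intro i hi
    simp only [apos, mem_filter, mem_Ico] at hi
    simp only [mem_filter, mem_erase]
    refine ⟨⟨?_, pow_ne_self hi.1.1.2 hi.1.1.1, hi.1.2⟩, ?_⟩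
    · intro h
      have := pow_inj hi.1.1.2 hm.1.2 h
      omega
    · rw [cyc_swap_arc σ r m hm.1.2 hm.1.1]
      exact ⟨i, hi.1.1.1, hi.2.le, rfl⟩
  · intro i hi j hj h
    simp only [apos, mem_filter, mem_Ico] at hi hj
    exact pow_inj hi.1.1.2 hj.1.1.2 h
  · intro x hx
    simp only [mem_filter, mem_erase] at hx
    rw [cyc_swap_arc σ r m hm.1.2 hm.1.1] at hx
    obtain ⟨⟨h1, h2, h3⟩, i, hi1, him, rfl⟩ := hx
    refine ⟨i, ?_, rfl⟩
    simp only [apos, mem_filter, mem_Ico]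
    have : i ≠ m := by rintro rfl; exact h1 rfl
    exact ⟨⟨⟨hi1, lt_of_le_of_lt him hm.1.2⟩, h3⟩, by omega⟩

lemma ell_split_sum {σ : Equiv.Perm Ω} {L : Finset Ω} {r s : Ω} (hr : r ∈ L) (hs : s ∈ L) (hrs : r ≠ s)
    (h : σ.SameCycle r s) :
    ell (σ * Equiv.swap r s) ((L.erase r).erase s) s + ell (σ * Equiv.swap r s) ((L.erase r).erase s) r + 2
      = ell σ L r := by
  have hn := swap_split hrs h
  have hh := ell_merge (σ := σ * Equiv.swap r s) (L := L) hr hs hn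
  rw [mul_assoc, Equiv.swap_mul_self, mul_one] at hh
  classical
  have e1 : ell σ ((L.erase r).erase s) r + 2 = ell σ L r := by
    rw [ell, ell, filter_erase, filter_erase, card_erase2 _ _ hrs]
    · simp [hr, Equiv.Perm.SameCycle.refl]
    · simp [hs, h]
  have e2 : ell (σ * Equiv.swap r s) ((L.erase r).erase s) r + 1 = ell (σ * Equiv.swap r s) L r := by
    rw [ell, ell, filter_erase, filter_erase, erase_right_comm, card_erase_add_one, erase_eq_of_notMem]
    · simp [hn]
    · simp [hr, hrs, Equiv.Perm.SameCycle.refl, hn]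
  have e3 : ell (σ * Equiv.swap r s) ((L.erase r).erase s) s + 1 = ell (σ * Equiv.swap r s) L s := by
    rw [ell, ell, filter_erase, filter_erase, card_erase_add_one, erase_eq_of_notMem]
    · simp only [mem_filter, not_and]
      exact fun _ k => hn k.symm
    · simp [hs, hrs.symm, Equiv.Perm.SameCycle.refl]
  omega

end state
end

section
open Finset

section mainc
variable {Ω : Type*} [Fintype Ω] [DecidableEq Ω]

structure St (σ : Equiv.Perm Ω) (L Z : Finset Ω) (act : List Ω) (Fr : Finset Ω) : Prop where
  tr : IsTr (cyc σ) (Z ∪ act.toFinset ∪ Fr)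
  dead : ∀ z ∈ Z, ell σ L z = 0
  nd : act.Nodup
  d1 : ∀ a ∈ act, a ∉ Z
  d2 : ∀ f ∈ Fr, f ∉ Z ∧ f ∉ act

lemma dead_class {σ α : Equiv.Perm Ω} {L : Finset Ω} {z y : Ω} (hz : ell σ L z = 0)
    (hα : ∀ x, α (α x) = x) (hL : ∀ x, x ∈ L ↔ α x ≠ x) (h : oo σ α z y) : σ.SameCycle z y := by
  classical
  have hz' : ∀ x, σ.SameCycle z x → α x = x := by
    intro x hx
    by_contra h
    rw [ell, card_eq_zero, filter_eq_empty_iff] at hz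
    exact hz ((hL x).2 h) hx
  have : oo σ α ≤ Setoid.ker (fun x => σ.SameCycle z x) := by
    rw [oo, sup_le_iff, cyc_le_iff, cyc_le_iff]
    refine ⟨fun x => ?_, fun x => ?_⟩
    · rw [Setoid.ker_def]
      simp
    · rw [Setoid.ker_def]
      refine propext ⟨fun h => ?_, fun h => ?_⟩
      · rwa [hz' x h]
      · have := hz' _ h
        rw [hα] at this
        rwa [← this] at h
  have := this h
  rw [Setoid.ker_def] at this
  exact this ▸ Equiv.Perm.SameCycle.refl _ _

lemma main_nil {σ : Equiv.Perm Ω} {L Z Fr : Finset Ω} (h : St σ L Z [] Fr) :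
    Ngood σ Z L = FF [] (Fr.val.map (ell σ L)) := by
  classical
  have htr : IsTr (cyc σ) (Z ∪ Fr) := by simpa using h.tr
  rw [FF_nil]
  rcases Fr.eq_empty_or_nonempty with rfl | ⟨f, hf⟩
  · rw [if_pos (by simp)]
    rw [union_empty] at htr
    have hL : L = ∅ := by
      rw [eq_empty_iff_forall_notMem]
      intro x hx
      obtain ⟨z, hz, hzx⟩ := htr.1 x
      have := h.dead z hz
      rw [ell, card_eq_zero, filter_eq_empty_iff] at this
      exact this hx hzx
    subst hL
    rw [Ngood, card_eq_one]
    refine ⟨1, ?_⟩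
    ext α
    simp only [mem_filter, mem_univ, true_and, mem_singleton]
    constructor
    · intro hα
      ext x
      have := (hα.2.1 x).not.1 (by simp)
      simpa using this
    · rintro rfl
      have e : kap (cyc σ) = Z.card := htr.card
      refine ⟨by simp, by simp, ?_, ?_⟩
      · rw [oo, cyc_one, sup_bot_eq]; exact htr
      · rw [mul_one, e]; simp; ring
  · rw [if_neg (by simp; exact ne_empty_of_mem hf), Ngood, card_eq_zero, filter_eq_empty_iff]
    intro α _ hα
    obtain ⟨z, hz, hzf⟩ := hα.2.2.1.1 f
    have h1 := dead_class (h.dead z hz) hα.1 hα.2.1 hzf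
    have := htr.2 z (by simp [hz]) f (by simp [hf]) h1
    subst this
    exact (h.d2 z hf).1 hz

lemma St.pop {σ : Equiv.Perm Ω} {L Z Fr : Finset Ω} {a : Ω} {act : List Ω} (h : St σ L Z (a :: act) Fr)
    (ha : ell σ L a = 0) : St σ L (insert a Z) act Fr := by
  have hnd := List.nodup_cons.1 h.nd
  refine ⟨?_, ?_, hnd.2, ?_, ?_⟩
  · have := h.tr
    rw [List.toFinset_cons, union_insert, insert_union] at this
    rw [insert_union, insert_union]
    exact this
  · intro z hz
    rcases mem_insert.1 hz with rfl | hz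
    · exact ha
    · exact h.dead z hz
  · intro b hb hb'
    rcases mem_insert.1 hb' with rfl | hb'
    · exact hnd.1 hb
    · exact h.d1 b (List.mem_cons_of_mem _ hb) hb'
  · intro f hf
    have := h.d2 f hf
    simp only [List.mem_cons, not_or] at this
    simp [this]

/-- a root and the rest are in different cycles -/
lemma St.sep {σ : Equiv.Perm Ω} {L Z Fr : Finset Ω} {a : Ω} {act : List Ω} (h : St σ L Z (a :: act) Fr)
    {b : Ω} (hb : b ∈ Z ∨ b ∈ act ∨ b ∈ Fr) : ¬ σ.SameCycle a b := by
  intro hab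
  have hnd := List.nodup_cons.1 h.nd
  have := h.tr.2 a (by simp) b (by simp only [mem_union, List.mem_toFinset, List.mem_cons]; tauto) hab
  subst this
  rcases hb with hb | hb | hb
  · exact h.d1 a (by simp) hb
  · exact hnd.1 hb
  · exact (h.d2 a hb).2 (by simp)

lemma St.split {σ : Equiv.Perm Ω} {L Z Fr : Finset Ω} {a r s : Ω} {act : List Ω} (h : St σ L Z (a :: act) Fr)
    (har : σ.SameCycle a r) (hrs : r ≠ s) (hs : σ.SameCycle r s) :
    St (σ * Equiv.swap r s) ((L.erase r).erase s) Z (s :: r :: act) Fr := by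
  have hnd := List.nodup_cons.1 h.nd
  have hasm := har.trans hs
  have hr' : ∀ b, (b ∈ Z ∨ b ∈ act ∨ b ∈ Fr) → ¬ σ.SameCycle b r ∧ ¬ σ.SameCycle b s ∧ r ≠ b ∧ s ≠ b := by
    intro b hb
    have := h.sep hb
    refine ⟨fun k => this (har.trans k.symm), fun k => this (hasm.trans k.symm), ?_, ?_⟩
    · rintro rfl; exact this har
    · rintro rfl; exact this hasm
  refine ⟨?_, ?_, ?_, ?_, ?_⟩
  · have e := (kap_split hrs hs).2
    have htr := h.tr
    rw [← e] at htr
    have := htr.split (a := a) (by simp) (by rw [e]; exact har) (swap_split hrs hs)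
    convert this using 1
    ext x
    simp only [mem_union, List.mem_toFinset, List.mem_cons, mem_insert, mem_erase]
    have := h.sep (b := x)
    by_cases hx : x = a
    · subst hx
      have : ¬ (x ∈ Z ∨ x ∈ act ∨ x ∈ Fr) := fun k => this k (Equiv.Perm.SameCycle.refl _ _)
      tauto
    · tauto
  · intro z hz
    have := hr' z (Or.inl hz)
    rw [ell_other this.1 this.2.1, h.dead z hz]
  · rw [List.nodup_cons, List.nodup_cons, List.mem_cons]
    refine ⟨?_, ?_, hnd.2⟩
    · rintro (k | k)
      · exact hrs k.symm
      · exact (hr' s (Or.inr (Or.inl k))).2.2.2 rfl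
    · intro k
      exact (hr' r (Or.inr (Or.inl k))).2.2.1 rfl
  · intro b hb hbZ
    have := hr' b (Or.inl hbZ)
    rw [List.mem_cons, List.mem_cons] at hb
    rcases hb with rfl | rfl | hb
    · exact this.2.2.2 rfl
    · exact this.2.2.1 rfl
    · exact h.d1 b (by simp [hb]) hbZ
  · intro f hf
    have h1 := h.d2 f hf
    have h2 := hr' f (Or.inr (Or.inr hf))
    simp only [List.mem_cons, not_or] at h1 ⊢
    exact ⟨h1.1, h2.2.2.2.symm, h2.2.2.1.symm, h1.2.2⟩

lemma St.merge {σ : Equiv.Perm Ω} {L Z Fr : Finset Ω} {a r s f : Ω} {act : List Ω} (h : St σ L Z (a :: act) Fr)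
    (har : σ.SameCycle a r) (hf : f ∈ Fr) (hs : σ.SameCycle f s) :
    St (σ * Equiv.swap r s) ((L.erase r).erase s) Z (a :: act) (Fr.erase f) := by
  have hnd := List.nodup_cons.1 h.nd
  have haf := h.sep (Or.inr (Or.inr hf))
  have hrs : ¬ σ.SameCycle r s := fun k => haf ((har.trans k).trans hs.symm)
  have hfa : f ∉ (Z ∪ (a :: act).toFinset) := by
    rw [mem_union, List.mem_toFinset, not_or]; exact h.d2 f hf
  refine ⟨?_, ?_, h.nd, h.d1, ?_⟩
  · rw [(kap_merge hrs).2, mg_congr (t := cyc σ) (r := r) (s := s) (a := a) (f := f) har.symm hs.symm]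
    have := h.tr.merge (a := a) (f := f) (by simp) (by simp [hf]) (by
      rintro rfl; exact haf (Equiv.Perm.SameCycle.refl _ _))
    convert this using 1
    rw [erase_union_distrib, erase_eq_of_notMem hfa]
  · intro z hz
    rw [ell_other, h.dead z hz]
    · intro k; exact h.sep (Or.inl hz) (har.trans k.symm)
    · intro k
      have := h.tr.2 z (by simp [hz]) f (by simp [hf]) (k.trans hs.symm)
      subst this
      exact (h.d2 z hf).1 hz
  · intro g hg
    exact h.d2 g (mem_of_mem_erase hg)
end mainc
end

section
open Finset

section mainc2
variable {Ω : Type*} [Fintype Ω] [DecidableEq Ω]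

theorem main_count : ∀ (N : ℕ) (σ : Equiv.Perm Ω) (L Z : Finset Ω) (act : List Ω) (Fr : Finset Ω),
    2 * L.card + act.length = N → St σ L Z act Fr →
    Ngood σ (Z ∪ act.toFinset) L = FF (act.map (ell σ L)) (Fr.val.map (ell σ L)) := by
  classical
  intro N
  induction N using Nat.strong_induction_on with
  | _ N ih =>
  intro σ L Z act Fr hN h
  cases act with
  | nil => simpa using main_nil h
  | cons a act =>
  obtain ⟨p, hp⟩ : ∃ p, ell σ L a = p := ⟨_, rfl⟩
  rw [List.map_cons, hp]
  cases p with
  | zero =>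
    rw [FF_zero, ← ih _ (by simp at hN; omega) σ L (insert a Z) act Fr rfl (h.pop hp)]
    congr 1
    rw [List.toFinset_cons, union_insert, insert_union]
  | succ p =>
  have hnd := List.nodup_cons.1 h.nd
  obtain ⟨r, hrL, har⟩ : ∃ r ∈ L, σ.SameCycle a r := by
    have : (L.filter (σ.SameCycle a)).Nonempty := by
      rw [← Finset.card_pos]; show 0 < ell σ L a; omega
    obtain ⟨r, hr⟩ := this
    rw [mem_filter] at hr
    exact ⟨r, hr⟩
  have hlr : ell σ L r = p + 1 := by rw [← ell_congr har, hp]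
  rw [Ngood_sum _ _ _ hrL, FF_succ]
  have hA : Z ∪ (a :: act).toFinset = insert a (Z ∪ act.toFinset) := by
    rw [List.toFinset_cons, union_insert]
  have haB : a ∉ Z ∪ act.toFinset := by
    rw [mem_union, List.mem_toFinset, not_or]
    exact ⟨h.d1 a (by simp), hnd.1⟩
  -- the split terms
  have hsplit : ∀ s ∈ L.erase r, σ.SameCycle r s →
      (univ.filter fun α => good σ (Z ∪ (a :: act).toFinset) L α ∧ α r = s).card =
      FF (ell (σ * Equiv.swap r s) ((L.erase r).erase s) s ::
        (p - 1 - ell (σ * Equiv.swap r s) ((L.erase r).erase s) s) :: act.map (ell σ L)) (Fr.val.map (ell σ L)) := by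
    intro s hs hrs
    rw [mem_erase] at hs
    have hne : r ≠ s := hs.1.symm
    have hrB : ∀ b ∈ Z ∪ act.toFinset, ¬ σ.SameCycle a b := by
      intro b hb
      rw [mem_union, List.mem_toFinset] at hb
      exact h.sep (by tauto)
    rw [card_contr σ _ (insert s (insert r (Z ∪ act.toFinset))) L hne]
    · have hst := h.split har hne hrs
      have hc := card_erase2 hrL hs.2 hne
      have := ih _ (by simp at hN; simp; omega) _ _ _ _ _ rfl hst
      have e1 : Z ∪ (s :: r :: act).toFinset = insert s (insert r (Z ∪ act.toFinset)) := by
        rw [List.toFinset_cons, union_insert, List.toFinset_cons, union_insert]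
      rw [← e1, this, List.map_cons, List.map_cons]
      have hoth : ∀ b, (b ∈ Z ∨ b ∈ act ∨ b ∈ Fr) →
          ell (σ * Equiv.swap r s) ((L.erase r).erase s) b = ell σ L b := by
        intro b hb
        refine ell_other (fun k => h.sep hb (har.trans k.symm)) (fun k => h.sep hb ((har.trans hrs).trans k.symm))
      have e2 : act.map (ell (σ * Equiv.swap r s) ((L.erase r).erase s)) = act.map (ell σ L) :=
        List.map_congr_left fun b hb => hoth b (Or.inr (Or.inl hb))
      have e3 : Fr.val.map (ell (σ * Equiv.swap r s) ((L.erase r).erase s)) = Fr.val.map (ell σ L) :=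
        Multiset.map_congr rfl fun b hb => hoth b (Or.inr (Or.inr hb))
      have e4 := ell_split_sum hrL hs.2 hne hrs
      rw [e2, e3]
      congr 3
      omega
    · intro α hα hinv
      rw [hA]
      exact good_split hrL hs.2 hne hα hinv hrs haB har (fun k => hrB r k har) (fun k => hrB s k (har.trans hrs))
  -- the merge terms
  have hmerge : ∀ s ∈ L.erase r, ∀ f ∈ Fr, σ.SameCycle f s →
      (univ.filter fun α => good σ (Z ∪ (a :: act).toFinset) L α ∧ α r = s).card =
      FF ((p + ell σ L f - 1) :: act.map (ell σ L)) ((Fr.val.map (ell σ L)).erase (ell σ L f)) := by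
    intro s hs f hf hfs
    rw [mem_erase] at hs
    have hne : r ≠ s := hs.1.symm
    have haf := h.sep (Or.inr (Or.inr hf))
    have hrs : ¬ σ.SameCycle r s := fun k => haf ((har.trans k).trans hfs.symm)
    rw [card_contr σ _ (Z ∪ (a :: act).toFinset) L hne
      (fun α hα hinv => good_merge hrL hs.2 hne hα hinv hrs)]
    have hc := card_erase2 hrL hs.2 hne
    rw [ih _ (by simp at hN; simp; omega) _ _ _ _ _ rfl (h.merge har hf hfs), List.map_cons]
    have hoth : ∀ b, (b ∈ Z ∨ b ∈ act ∨ b ∈ Fr.erase f) →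
          ell (σ * Equiv.swap r s) ((L.erase r).erase s) b = ell σ L b := by
      intro b hb
      have hb' : b ∈ Z ∨ b ∈ act ∨ b ∈ Fr := by
        rcases hb with hb | hb | hb
        · exact Or.inl hb
        · exact Or.inr (Or.inl hb)
        · exact Or.inr (Or.inr (mem_of_mem_erase hb))
      refine ell_other (fun k => h.sep hb' (har.trans k.symm)) (fun k => ?_)
      have hbf := h.tr.2 b (by simp; tauto) f (by simp [hf]) (k.trans hfs.symm)
      subst hbf
      have := h.d2 b hf
      simp only [List.mem_cons, not_or] at this
      simp [this] at hb
    have e2 : act.map (ell (σ * Equiv.swap r s) ((L.erase r).erase s)) = act.map (ell σ L) :=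
      List.map_congr_left fun b hb => hoth b (Or.inr (Or.inl hb))
    have e3 : (Fr.erase f).val.map (ell (σ * Equiv.swap r s) ((L.erase r).erase s)) = (Fr.erase f).val.map (ell σ L) :=
      Multiset.map_congr rfl fun b hb => hoth b (Or.inr (Or.inr hb))
    have e5 : (σ * Equiv.swap r s).SameCycle a r := by
      rw [← cyc_apply, (kap_merge hrs).2]; exact Or.inl har
    have e6 := ell_merge hrL hs.2 hrs
    rw [e2, e3, ell_congr e5, erase_val, Multiset.map_erase_of_mem _ _ hf]
    congr 2
    rw [← ell_congr hfs] at e6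
    omega
  have hzero : ∀ s ∈ L.erase r, ¬ σ.SameCycle r s → (∀ f ∈ Fr, ¬ σ.SameCycle f s) →
      (univ.filter fun α => good σ (Z ∪ (a :: act).toFinset) L α ∧ α r = s).card = 0 := by
    intro s hs h1 h2
    rw [card_eq_zero, filter_eq_empty_iff]
    rintro α - ⟨hg, hα⟩
    obtain ⟨b, hb, hbs⟩ := h.tr.1 s
    rw [mem_union] at hb
    rcases hb with hb | hb
    · have k1 : oo σ α a b := by
        have t1 : oo σ α a r := (le_sup_left : cyc σ ≤ cyc σ ⊔ cyc α) har
        have t2 : oo σ α r s := (le_sup_right : cyc α ≤ cyc σ ⊔ cyc α) ⟨1, by simpa using hα⟩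
        have t3 : oo σ α b s := (le_sup_left : cyc σ ≤ cyc σ ⊔ cyc α) hbs
        exact Setoid.trans' _ (Setoid.trans' _ t1 t2) (Setoid.symm' _ t3)
      have := hg.2.2.1.2 a (by simp) b hb k1
      subst this
      exact h1 (har.symm.trans hbs)
    · exact h2 b hb hbs
  have hall : ∀ s ∈ L.erase r, (univ.filter fun α => good σ (Z ∪ (a :: act).toFinset) L α ∧ α r = s).card =
      (if σ.SameCycle r s then FF (ell (σ * Equiv.swap r s) ((L.erase r).erase s) s ::
        (p - 1 - ell (σ * Equiv.swap r s) ((L.erase r).erase s) s) :: act.map (ell σ L)) (Fr.val.map (ell σ L)) else 0)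
      + ∑ f ∈ Fr, if σ.SameCycle f s then
        FF ((p + ell σ L f - 1) :: act.map (ell σ L)) ((Fr.val.map (ell σ L)).erase (ell σ L f)) else 0 := by
    intro s hs
    by_cases h1 : σ.SameCycle r s
    · rw [if_pos h1, hsplit s hs h1, sum_eq_zero, add_zero]
      intro f hf
      rw [if_neg]
      intro k
      exact h.sep (Or.inr (Or.inr hf)) ((har.trans h1).trans k.symm)
    · rw [if_neg h1, zero_add]
      by_cases h2 : ∃ f ∈ Fr, σ.SameCycle f s
      · obtain ⟨f, hf, hfs⟩ := h2
        rw [hmerge s hs f hf hfs, sum_eq_single f, if_pos hfs]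
        · intro g hg hgf
          rw [if_neg]
          intro k
          exact hgf (h.tr.2 g (by simp [hg]) f (by simp [hf]) (k.trans hfs.symm))
        · exact fun k => absurd hf k
      · push Not at h2
        rw [hzero s hs h1 h2, sum_eq_zero]
        intro f hf
        rw [if_neg (h2 f hf)]
  rw [sum_congr rfl hall, sum_add_distrib, sum_comm]
  congr 1
  · rw [sum_apos]
    have hc := card_apos (σ := σ) hrL
    have hc' : (apos σ L r).card = p := by omega
    rw [← hc', ← sum_rank (apos σ L r)
      (fun i => FF (i :: ((apos σ L r).card - 1 - i) :: act.map (ell σ L)) (Fr.val.map (ell σ L)))]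
    refine sum_congr rfl fun m hm => ?_
    rw [ell_split_s hm]
  · rw [Multiset.map_map]
    refine sum_congr rfl fun f hf => ?_
    rw [← sum_filter, sum_const, smul_eq_mul]
    simp only [Function.comp_apply]
    congr 1
    rw [ell, filter_erase, erase_eq_of_notMem]
    rw [mem_filter, not_and]
    intro _ k
    exact h.sep (Or.inr (Or.inr hf)) (har.trans k.symm)

end mainc2
end

section
open Finset

section lamS
variable {Ω : Type*} [Fintype Ω] [DecidableEq Ω]

def lam (σ : Equiv.Perm Ω) : Multiset ℕ := σ.partition.parts

lemma ell_univ (σ : Equiv.Perm Ω) (x : Ω) : ell σ univ x = Function.minimalPeriod σ x := by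
  classical
  have hp : 0 < Function.minimalPeriod σ x :=
    Function.minimalPeriod_pos_of_mem_periodicPts (Function.Injective.mem_periodicPts σ.injective x)
  rw [← card_apos (mem_univ x), apos, filter_true_of_mem (by simp)]
  simp; omega

lemma lam_eq (σ : Equiv.Perm Ω) (A : Finset Ω) (hA : IsTr (cyc σ) A) : A.val.map (ell σ univ) = lam σ := by
  classical
  have h1 : A.val = (A.filter (fun a => σ a ≠ a)).val + (A.filter (fun a => ¬ σ a ≠ a)).val := by
    rw [filter_val, filter_val, Multiset.filter_add_not]
  rw [h1, Multiset.map_add, lam, Equiv.Perm.parts_partition]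
  congr 1
  · rw [Equiv.Perm.cycleType_def]
    have h2 : σ.cycleFactorsFinset = (A.filter (fun a => σ a ≠ a)).image (fun a => σ.cycleOf a) := by
      ext c
      rw [mem_image]
      constructor
      · intro hc
        have hcyc := (Equiv.Perm.mem_cycleFactorsFinset_iff.1 hc).1
        obtain ⟨x, hx, -⟩ := hcyc
        have hxs : x ∈ c.support := Equiv.Perm.mem_support.2 hx
        have := Equiv.Perm.cycle_is_cycleOf hxs hc
        obtain ⟨a, ha, hax⟩ := hA.1 x
        refine ⟨a, ?_, ?_⟩
        · rw [mem_filter]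
          refine ⟨ha, ?_⟩
          have hx' : σ x ≠ x := by
            rw [← Equiv.Perm.mem_support]
            exact Equiv.Perm.mem_cycleFactorsFinset_support_le hc hxs
          intro k
          exact hx' ((Equiv.Perm.SameCycle.apply_eq_self_iff hax).1 k)
        · rw [this]
          exact Equiv.Perm.SameCycle.cycleOf_eq hax
      · rintro ⟨a, ha, rfl⟩
        rw [mem_filter] at ha
        exact Equiv.Perm.cycleOf_mem_cycleFactorsFinset_iff.2 (Equiv.Perm.mem_support.2 ha.2)
    rw [h2, image_val_of_injOn, Multiset.map_map]
    · refine Multiset.map_congr rfl fun a ha => ?_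
      have ha' : a ∈ A.filter (fun a => σ a ≠ a) := ha
      rw [mem_filter] at ha'
      simp only [Function.comp_apply, ell]
      congr 1
      ext y
      rw [mem_filter, Equiv.Perm.mem_support_cycleOf_iff' ha'.2]
      simp
    · intro a ha b hb hab
      rw [mem_coe, mem_filter] at ha hb
      refine hA.2 a ha.1 b hb.1 ?_
      have : b ∈ (σ.cycleOf a).support := by
        have hab' : σ.cycleOf a = σ.cycleOf b := hab
        rw [hab', Equiv.Perm.mem_support_cycleOf_iff' hb.2]
      rwa [Equiv.Perm.mem_support_cycleOf_iff' ha.2] at this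
  · rw [Multiset.eq_replicate]
    constructor
    · rw [Multiset.card_map, ← card_compl]
      show (A.filter (fun a => ¬ σ a ≠ a)).card = _
      congr 1
      ext x
      rw [mem_filter, mem_compl, Equiv.Perm.mem_support]
      constructor
      · exact fun h => h.2
      · intro h
        refine ⟨?_, h⟩
        obtain ⟨a, ha, i, hi⟩ := hA.1 x
        push Not at h
        have : a = x := by
          have h3 : σ.SameCycle a x := ⟨i, hi⟩
          obtain ⟨j, hj⟩ := h3.symm
          rw [← hj, Equiv.Perm.zpow_apply_eq_self_of_apply_eq_self h]
        rwa [← this]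
    · intro b hb
      rw [Multiset.mem_map] at hb
      obtain ⟨a, ha, rfl⟩ := hb
      have ha' : a ∈ A.filter (fun a => ¬ σ a ≠ a) := ha
      rw [mem_filter, not_not] at ha'
      rw [ell_univ, Function.minimalPeriod_eq_one_iff_isFixedPt]
      exact ha'.2

lemma lam_sum (σ : Equiv.Perm Ω) : (lam σ).sum = Fintype.card Ω := σ.partition.parts_sum

lemma lam_pos (σ : Equiv.Perm Ω) : ∀ i ∈ lam σ, 0 < i := fun _ h => σ.partition.parts_pos h

lemma Ngood_lam (σ : Equiv.Perm Ω) (c : ℕ) (hc : ∀ a, Ngood σ {a} univ = c) :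
    Fintype.card Ω * c = ((lam σ).map fun k => k * FF [k] ((lam σ).erase k)).sum := by
  classical
  obtain ⟨A, hA⟩ := exists_IsTr (cyc σ)
  have h1 : ∀ a ∈ A, FF [ell σ univ a] ((lam σ).erase (ell σ univ a)) = c := by
    intro a ha
    rw [← hc a, ← lam_eq σ A hA, ← Multiset.map_erase_of_mem _ _ ha, ← erase_val]
    have := main_count _ σ univ ∅ [a] (A.erase a) rfl ⟨?_, by simp, by simp, by simp, ?_⟩
    · simpa using this.symm
    · convert hA using 1
      simp [insert_erase ha]
    · simp +contextual
  have h2 : ((lam σ).map fun k => k * FF [k] ((lam σ).erase k)) = (lam σ).map fun k => k * c := by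
    refine Multiset.map_congr rfl fun k hk => ?_
    rw [← lam_eq σ A hA, Multiset.mem_map] at hk
    obtain ⟨a, ha, rfl⟩ := hk
    rw [h1 a ha]
  rw [h2, Multiset.sum_map_mul_right, Multiset.map_id', lam_sum]

def zz (K : Multiset ℕ) : ℕ := K.prod * ∏ n ∈ K.toFinset, (K.count n).factorial

lemma lam_eq_iff (σ : Equiv.Perm Ω) (K : Multiset ℕ) (hs : K.sum = Fintype.card Ω) (hp : ∀ i ∈ K, 0 < i) :
    lam σ = K ↔ σ.cycleType = K.filter (2 ≤ ·) := by
  constructor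
  · rintro rfl
    exact (Equiv.Perm.filter_parts_partition_eq_cycleType).symm
  · intro h
    rw [lam, Equiv.Perm.parts_partition, ← Equiv.Perm.sum_cycleType, h]
    have h1 : K = K.filter (2 ≤ ·) + K.filter (fun i => ¬ 2 ≤ i) := (Multiset.filter_add_not _ _).symm
    have h2 : K.filter (fun i => ¬ 2 ≤ i) = Multiset.replicate (K.filter (fun i => ¬ 2 ≤ i)).card 1 := by
      rw [Multiset.eq_replicate_card]
      intro b hb
      rw [Multiset.mem_filter] at hb
      have := hp b hb.1
      omega
    have h3 : K.sum = (K.filter (2 ≤ ·)).sum + (K.filter (fun i => ¬ 2 ≤ i)).card := by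
      conv_lhs => rw [h1, h2]
      simp
    conv_rhs => rw [h1, h2]
    congr 2
    omega

lemma zz_eq (K : Multiset ℕ) (hp : ∀ i ∈ K, 0 < i) :
    (K.sum - (K.filter (2 ≤ ·)).sum).factorial * (K.filter (2 ≤ ·)).prod *
      ∏ n ∈ (K.filter (2 ≤ ·)).toFinset, ((K.filter (2 ≤ ·)).count n).factorial = zz K := by
  have h1 : K.filter (2 ≤ ·) + K.filter (fun i => ¬ 2 ≤ i) = K := (Multiset.filter_add_not _ _)
  have h2 : K.filter (fun i => ¬ 2 ≤ i) = Multiset.replicate (K.count 1) 1 := by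
    rw [← Multiset.filter_eq']
    refine Multiset.filter_congr fun b hb => ?_
    have := hp b hb
    omega
  have h3 : K.sum - (K.filter (2 ≤ ·)).sum = K.count 1 := by
    have : K.sum = (K.filter (2 ≤ ·)).sum + K.count 1 := by
      conv_lhs => rw [← h1, h2]
      simp
    omega
  have h4 : K.prod = (K.filter (2 ≤ ·)).prod := by
    conv_lhs => rw [← h1, h2]
    simp
  have h5 : ∏ n ∈ K.toFinset, (K.count n).factorial =
      (K.count 1).factorial * ∏ n ∈ (K.filter (2 ≤ ·)).toFinset, ((K.filter (2 ≤ ·)).count n).factorial := by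
    have e : (K.filter (2 ≤ ·)).toFinset = K.toFinset.erase 1 := by
      ext i
      simp only [Multiset.mem_toFinset, Multiset.mem_filter, mem_erase]
      constructor
      · rintro ⟨a, b⟩; exact ⟨by omega, a⟩
      · rintro ⟨a, b⟩; have := hp i b; exact ⟨b, by omega⟩
    have e2 : ∏ n ∈ K.toFinset.erase 1, ((K.filter (2 ≤ ·)).count n).factorial =
        ∏ n ∈ K.toFinset.erase 1, (K.count n).factorial := by
      refine prod_congr rfl fun i hi => ?_
      simp only [Multiset.mem_toFinset, mem_erase] at hi
      have := hp i hi.2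
      rw [Multiset.count_filter_of_pos (by omega)]
    rw [e, e2]
    by_cases hK : 1 ∈ K
    · rw [mul_prod_erase _ (fun n => (K.count n).factorial) (by simpa using hK)]
    · rw [erase_eq_of_notMem (by simpa using hK), Multiset.count_eq_zero_of_notMem hK]
      simp
  rw [zz, h5, h3, h4]
  ring

lemma card_class (K : Multiset ℕ) (hs : K.sum = Fintype.card Ω) (hp : ∀ i ∈ K, 0 < i) :
    (univ.filter fun σ : Equiv.Perm Ω => lam σ = K).card * zz K = (Fintype.card Ω).factorial := by
  have h := Equiv.Perm.card_of_cycleType_mul_eq (α := Ω) (K.filter (2 ≤ ·))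
  rw [if_pos, ← hs, zz_eq K hp] at h
  · rw [← hs, ← h]
    congr 2
    ext σ
    simp only [mem_filter, mem_univ, true_and]
    exact lam_eq_iff σ K hs hp
  · refine ⟨?_, ?_⟩
    · rw [← hs]
      have h1 : K.filter (2 ≤ ·) + K.filter (fun i => ¬ 2 ≤ i) = K := (Multiset.filter_add_not _ _)
      conv_rhs => rw [← h1]
      simp
    · intro a ha
      exact (Multiset.mem_filter.1 ha).2

end lamS

section planar

lemma cycleCount_eq {m : ℕ} (σ : Equiv.Perm (Fin m)) : cycleCount σ = kap (cyc σ) := by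
  unfold cycleCount cycleCountOn kap
  refine Nat.card_eq_of_bijective (Quot.lift (fun x => Quotient.mk (cyc σ) x.1)
    (fun x y h => Quotient.sound (s := cyc σ) h)) ⟨?_, ?_⟩
  · rintro ⟨x⟩ ⟨y⟩ h
    exact Quot.sound (Quotient.exact (s := cyc σ) h)
  · rintro ⟨x⟩
    exact ⟨Quot.mk _ ⟨x, trivial⟩, rfl⟩

lemma degCount_eq {m : ℕ} (σ : Equiv.Perm (Fin m)) (k : ℕ) : degCount σ k = (lam σ).count k := by
  classical
  obtain ⟨A, hA⟩ := exists_IsTr (cyc σ)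
  rw [← lam_eq σ A hA, Multiset.count_map]
  unfold degCount cycleCountOn
  have : (A.filter fun a => k = ell σ univ a).card = Multiset.card (A.val.filter fun a => k = ell σ univ a) := rfl
  rw [← this, ← Fintype.card_coe, ← Nat.card_eq_fintype_card]
  symm
  refine Nat.card_eq_of_bijective (fun a => Quot.mk _ ⟨a.1, by
    have := (mem_filter.1 a.2).2
    rw [ell_univ] at this
    exact this.symm⟩) ⟨?_, ?_⟩
  · intro a b hab
    have h1 : σ.SameCycle a.1 b.1 := by
      have := congrArg (Quot.lift (fun x : {z : Fin m // Function.minimalPeriod σ z = k} => Quotient.mk (cyc σ) x.1)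
        (fun x y h => Quotient.sound (s := cyc σ) h)) hab
      exact Quotient.exact (s := cyc σ) this
    exact Subtype.ext (hA.2 _ (mem_filter.1 a.2).1 _ (mem_filter.1 b.2).1 h1)
  · rintro ⟨x, hx⟩
    obtain ⟨a, ha, hax⟩ := hA.1 x
    refine ⟨⟨a, ?_⟩, Quot.sound hax⟩
    rw [mem_filter]
    refine ⟨ha, ?_⟩
    rw [ell_congr hax, ell_univ, hx]

lemma mem_lam_iff {m : ℕ} (σ : Equiv.Perm (Fin m)) (D : Set ℕ) :
    (∀ x, Function.minimalPeriod σ x ∈ D) ↔ ∀ k ∈ lam σ, k ∈ D := by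
  obtain ⟨A, hA⟩ := exists_IsTr (cyc σ)
  rw [← lam_eq σ A hA]
  constructor
  · intro h k hk
    obtain ⟨a, _, rfl⟩ := Multiset.mem_map.1 hk
    rw [ell_univ]
    exact h a
  · intro h x
    obtain ⟨a, ha, hax⟩ := hA.1 x
    rw [← ell_univ, ← ell_congr hax]
    exact h _ (Multiset.mem_map_of_mem _ ha)

lemma trans_iff {m : ℕ} (σ α : Equiv.Perm (Fin m)) (a : Fin m) :
    IsTransitivePair σ α ↔ IsTr (oo σ α) {a} := by
  constructor
  · intro h
    refine ⟨fun x => ⟨a, by simp, ?_⟩, by simp⟩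
    obtain ⟨g, hg, rfl⟩ := h a x
    have : ∀ x, oo σ α x (g x) := by
      refine Subgroup.closure_induction (p := fun g _ => ∀ x, oo σ α x (g x)) ?_ ?_ ?_ ?_ hg
      · rintro g (rfl | rfl) x
        · exact (le_sup_left : cyc g ≤ cyc g ⊔ cyc α) ⟨1, by simp⟩
        · exact (le_sup_right : cyc g ≤ cyc σ ⊔ cyc g) ⟨1, by simp⟩
      · intro x; exact Setoid.refl' _ x
      · intro g g' _ _ h h' x
        exact Setoid.trans' _ (h' x) (h _)
      · intro g _ h x
        have := h (g⁻¹ x)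
        rw [← Equiv.Perm.mul_apply, mul_inv_cancel, Equiv.Perm.one_apply] at this
        exact Setoid.symm' _ this
    exact this a
  · intro h x y
    let S := Subgroup.closure ({σ, α} : Set (Equiv.Perm (Fin m)))
    let t : Setoid (Fin m) := ⟨fun x y => ∃ g ∈ S, g x = y, fun x => ⟨1, S.one_mem, rfl⟩,
      fun ⟨g, hg, hxy⟩ => ⟨g⁻¹, S.inv_mem hg, by rw [← hxy]; simp⟩,
      fun ⟨g, hg, hxy⟩ ⟨g', hg', hyz⟩ => ⟨g' * g, S.mul_mem hg' hg, by rw [← hyz, ← hxy]; rfl⟩⟩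
    have hle : oo σ α ≤ t := by
      rw [oo, sup_le_iff, cyc_le_iff, cyc_le_iff]
      exact ⟨fun x => ⟨σ, Subgroup.subset_closure (by simp), rfl⟩,
        fun x => ⟨α, Subgroup.subset_closure (by simp), rfl⟩⟩
    obtain ⟨b, hb, hx⟩ := h.1 x
    obtain ⟨c, hc, hy⟩ := h.1 y
    rw [mem_singleton] at hb hc
    subst hb hc
    exact t.trans' (t.symm' (hle hx)) (hle hy)

lemma planar_iff {n : ℕ} (σ α : Equiv.Perm (Fin (2 * n))) (a : Fin (2 * n)) :
    IsPlanarMap σ α ↔ good σ {a} univ α := by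
  unfold IsPlanarMap good
  rw [trans_iff σ α a, cycleCount_eq, cycleCount_eq]
  simp only [mem_univ, true_iff, card_univ, Fintype.card_fin, card_singleton]
  refine and_congr_right fun _ => and_congr_right fun _ => and_congr_right fun _ => ?_
  omega

open Classical in
lemma planar_count {n : ℕ} (σ : Equiv.Perm (Fin (2 * n))) :
    2 * n * (univ.filter fun α => IsPlanarMap σ α).card =
      ((lam σ).map fun k => k * FF [k] ((lam σ).erase k)).sum := by
  rw [← Ngood_lam σ (univ.filter fun α => IsPlanarMap σ α).card, Fintype.card_fin]
  intro a
  rw [Ngood]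
  congr 1
  ext α
  simp only [mem_filter, mem_univ, true_and]
  exact (planar_iff σ α a).symm

end planar
end

section
open Finset PowerSeries
open scoped NNReal

def pts (m : ℕ) : Finset (Multiset ℕ) := (univ : Finset (Nat.Partition m)).image Nat.Partition.parts

lemma mem_pts {m : ℕ} {K : Multiset ℕ} : K ∈ pts m ↔ K.sum = m ∧ ∀ i ∈ K, 0 < i := by
  simp only [pts, mem_image, mem_univ, true_and]
  constructor
  · rintro ⟨p, rfl⟩
    exact ⟨p.parts_sum, fun i hi => p.parts_pos hi⟩
  · rintro ⟨h, h'⟩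
    exact ⟨⟨K, fun {i} hi => h' i hi, h⟩, rfl⟩

lemma zz_cons (k : ℕ) (K : Multiset ℕ) : zz (k ::ₘ K) = k * (K.count k + 1) * zz K := by
  unfold zz
  have h1 : ∏ n ∈ K.toFinset, (K.count n).factorial = ∏ n ∈ insert k K.toFinset, (K.count n).factorial := by
    refine prod_subset (subset_insert _ _) fun n _ hn => ?_
    rw [Multiset.count_eq_zero_of_notMem (by simpa using hn)]
    rfl
  rw [h1, Multiset.prod_cons, Multiset.toFinset_cons, ← mul_prod_erase _ _ (mem_insert_self k K.toFinset),
    ← mul_prod_erase _ (fun n => (K.count n).factorial) (mem_insert_self k K.toFinset),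
    Multiset.count_cons_self, Nat.factorial_succ]
  have h2 : ∏ x ∈ (insert k K.toFinset).erase k, ((k ::ₘ K).count x).factorial =
      ∏ x ∈ (insert k K.toFinset).erase k, (K.count x).factorial := by
    refine prod_congr rfl fun n hn => ?_
    rw [Multiset.count_cons_of_ne (ne_of_mem_erase hn)]
  rw [h2]
  ring

lemma zz_pos {K : Multiset ℕ} (h : ∀ i ∈ K, 0 < i) : 0 < zz K := by
  unfold zz
  refine Nat.mul_pos ?_ (prod_pos fun n _ => Nat.factorial_pos _)
  rw [pos_iff_ne_zero, Ne, Multiset.prod_eq_zero_iff]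
  exact fun h0 => lt_irrefl _ (h 0 h0)

lemma peel (m : ℕ) (Q : ℕ → Multiset ℕ → ℝ≥0) :
    ∑ K ∈ pts m, ((zz K : ℝ≥0))⁻¹ * (K.map fun k : ℕ => (k : ℝ≥0) * Q k (K.erase k)).sum =
      ∑ j ∈ range m, ∑ K ∈ pts (m - 1 - j), ((zz K : ℝ≥0))⁻¹ * Q (j + 1) K := by
  have h1 : ∀ K ∈ pts m, ((zz K : ℝ≥0))⁻¹ * (K.map fun k : ℕ => (k : ℝ≥0) * Q k (K.erase k)).sum =
      ∑ k ∈ K.toFinset, ((zz (K.erase k) : ℝ≥0))⁻¹ * Q k (K.erase k) := by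
    intro K hK
    rw [mem_pts] at hK
    rw [Finset.sum_multiset_map_count, mul_sum]
    refine sum_congr rfl fun k hk => ?_
    rw [Multiset.mem_toFinset] at hk
    obtain ⟨K', rfl⟩ := Multiset.exists_cons_of_mem hk
    have hk0 : (k : ℝ≥0) ≠ 0 := by exact_mod_cast (hK.2 k hk).ne'
    have hz : (zz K' : ℝ≥0) ≠ 0 := by
      exact_mod_cast (zz_pos fun i hi => hK.2 i (Multiset.mem_cons_of_mem hi)).ne'
    have hc : ((K'.count k : ℝ≥0) + 1) ≠ 0 := by positivity
    rw [Multiset.erase_cons_head, zz_cons, Multiset.count_cons_self, nsmul_eq_mul]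
    push_cast
    field_simp
  rw [sum_congr rfl h1, sum_sigma', sum_sigma']
  refine sum_bij' (fun x _ => ⟨x.2 - 1, x.1.erase x.2⟩) (fun x _ => ⟨(x.1 + 1) ::ₘ x.2, x.1 + 1⟩) ?_ ?_ ?_ ?_ ?_
  · rintro ⟨K, k⟩ hx
    simp only [mem_sigma, mem_pts, Multiset.mem_toFinset, mem_range] at hx ⊢
    obtain ⟨⟨hs, hp⟩, hk⟩ := hx
    have := hp k hk
    have h2 := Multiset.sum_erase hk
    refine ⟨by omega, by omega, fun i hi => hp i (Multiset.mem_of_mem_erase hi)⟩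
  · rintro ⟨j, K⟩ hx
    simp only [mem_sigma, mem_pts, Multiset.mem_toFinset, mem_range, Multiset.sum_cons, Multiset.mem_cons] at hx ⊢
    refine ⟨⟨by omega, ?_⟩, Or.inl trivial⟩
    rintro i (rfl | hi)
    · omega
    · exact hx.2.2 i hi
  · rintro ⟨K, k⟩ hx
    simp only [mem_sigma, mem_pts, Multiset.mem_toFinset] at hx
    have := hx.1.2 k hx.2
    have e : k - 1 + 1 = k := by omega
    simp only [e, Multiset.cons_erase hx.2]
  · rintro ⟨j, K⟩ hx
    simp
  · rintro ⟨K, k⟩ hx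
    simp only [mem_sigma, mem_pts, Multiset.mem_toFinset] at hx
    have := hx.1.2 k hx.2
    have e : k - 1 + 1 = k := by omega
    simp only [e]

section hs
variable (g : ℕ → ℝ≥0)

noncomputable def hs (P : List ℕ) : ℝ≥0⟦X⟧ :=
  PowerSeries.mk fun m => ∑ K ∈ pts m, ((zz K : ℝ≥0))⁻¹ * ((K.map g).prod * FF P K)

lemma hs_nil : hs g [] = 1 := by
  ext m
  rw [hs, coeff_mk, coeff_one]
  simp only [FF_nil]
  split_ifs with h
  · subst h
    rw [sum_eq_single_of_mem 0]
    · simp [zz]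
    · simp [mem_pts]
    · intro K _ hK
      simp [hK]
  · congr 1
    refine sum_eq_zero fun K hK => ?_
    rw [mem_pts] at hK
    have : K ≠ 0 := by rintro rfl; simp at hK; omega
    simp [this]

lemma hs_zero (P : List ℕ) : hs g (0 :: P) = hs g P := by
  ext m
  simp only [hs, coeff_mk, FF_zero]

lemma peel_hs (m : ℕ) (F : ℕ → List ℕ) :
    ∑ K ∈ pts m, ((zz K : ℝ≥0))⁻¹ * ((K.map g).prod * (K.map fun k : ℕ => (k : ℝ≥0) * (FF (F k) (K.erase k) : ℝ≥0)).sum)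
      = ∑ j ∈ range m, g (j + 1) * coeff (m - 1 - j) (hs g (F (j + 1))) := by
  have h := peel m (fun k K => g k * (K.map g).prod * FF (F k) K)
  have h1 : ∀ K ∈ pts m, ((zz K : ℝ≥0))⁻¹ * ((K.map g).prod * (K.map fun k : ℕ => (k : ℝ≥0) * (FF (F k) (K.erase k) : ℝ≥0)).sum)
      = ((zz K : ℝ≥0))⁻¹ * (K.map fun k : ℕ => (k : ℝ≥0) * (g k * ((K.erase k).map g).prod * FF (F k) (K.erase k))).sum := by
    intro K _
    rw [← Multiset.sum_map_mul_left]
    congr 2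
    refine Multiset.map_congr rfl fun k hk => ?_
    rw [← Multiset.prod_map_erase hk]
    ring
  rw [sum_congr rfl h1, h]
  refine sum_congr rfl fun j _ => ?_
  rw [hs, coeff_mk, mul_sum]
  refine sum_congr rfl fun K _ => ?_
  ring

lemma hs_succ (p : ℕ) (P : List ℕ) : hs g ((p + 1) :: P) =
    ∑ i ∈ range p, hs g (i :: (p - 1 - i) :: P) + Sg g (fun j => hs g ((p + j) :: P)) := by
  ext m
  congr 1
  rw [map_add, map_sum, coeff_Sg]
  have h := peel_hs g m (fun k => (p + k - 1) :: P)
  have e : ∀ j, p + (j + 1) - 1 = p + j := fun j => by omega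
  simp only [e] at h
  rw [← h]
  simp only [hs, coeff_mk]
  rw [sum_comm, ← sum_add_distrib]
  refine sum_congr rfl fun K _ => ?_
  rw [FF_succ, ← mul_sum, ← mul_sum, ← mul_add, ← mul_add]
  congr 2
  push_cast
  congr 1
  rw [Multiset.map_map]
  congr 1
  refine Multiset.map_congr rfl fun k _ => ?_
  simp

lemma hs_append : ∀ (n : ℕ) (N : ℕ) (P Q : List ℕ), 2 * P.sum + P.length = N →
    coeff n (hs g (P ++ Q)) = coeff n (hs g P * hs g Q) := by
  intro n
  induction n using Nat.strong_induction_on with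
  | _ n ihn =>
  intro N
  induction N using Nat.strong_induction_on with
  | _ N ih =>
  intro P Q hN
  match P with
  | [] => rw [hs_nil, one_mul]; rfl
  | 0 :: P =>
    rw [List.cons_append, hs_zero, hs_zero]
    exact ih _ (by simp at hN; omega) P Q rfl
  | (p + 1) :: P =>
    rw [List.cons_append, hs_succ, hs_succ, add_mul, mul_comm (Sg _ _), ← Sg_mul_left, sum_mul, map_add,
      map_add, map_sum, map_sum, coeff_Sg, coeff_Sg]
    congr 1
    · refine sum_congr rfl fun i hi => ?_
      rw [mem_range] at hi
      exact ih _ (by simp at hN; simp; omega) (i :: (p - 1 - i) :: P) Q rfl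
    · refine sum_congr rfl fun j hj => ?_
      rw [mem_range] at hj
      rw [mul_comm (hs g Q)]
      congr 1
      exact ihn _ (by omega) _ ((p + j) :: P) Q rfl

lemma hs_isW : IsW g (fun p => hs g [p]) := by
  refine ⟨by simp only [hs_zero, hs_nil], fun p => ?_⟩
  simp only [hs_succ]
  congr 1
  refine sum_congr rfl fun i _ => ?_
  ext n
  congr 1
  exact hs_append g n _ [i] [p - 1 - i] rfl

open Classical in
lemma perm_sum (n : ℕ) (hn : 0 < n) : ∑ σ : Equiv.Perm (Fin (2 * n)), ((lam σ).map g).prod *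
      ((univ.filter fun α => IsPlanarMap σ α).card : ℝ≥0) =
    ((2 * n - 1).factorial : ℝ≥0) * coeff (2 * n) (hs g [2]) := by
  have hN : ((2 * n : ℕ) : ℝ≥0) ≠ 0 := by exact_mod_cast (by omega : 2 * n ≠ 0)
  apply mul_left_cancel₀ hN
  have hfac : ((2 * n : ℕ) : ℝ≥0) * ((2 * n - 1).factorial : ℝ≥0) = ((2 * n).factorial : ℝ≥0) := by
    exact_mod_cast Nat.mul_factorial_pred (by omega)
  have hw : coeff (2 * n) (hs g [2]) = ∑ j ∈ range (2 * n), g (j + 1) * coeff (2 * n - 1 - j) (hs g [j + 1]) := by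
    have h2 : hs g [2] = _ := (hs_isW g).2 1
    rw [h2, map_add, coeff_Sg]
    simp only [add_comm 1]
    simp [hs_zero, hs_nil, coeff_one]
    omega
  rw [← mul_assoc, hfac, hw, ← peel_hs g (2 * n) (fun k => [k]), mul_sum, mul_sum]
  have h1 : ∀ σ : Equiv.Perm (Fin (2 * n)), ((2 * n : ℕ) : ℝ≥0) * (((lam σ).map g).prod *
      ((univ.filter fun α => IsPlanarMap σ α).card : ℝ≥0)) =
      ((lam σ).map g).prod * ((lam σ).map fun k : ℕ => (k : ℝ≥0) * (FF [k] ((lam σ).erase k) : ℝ≥0)).sum := by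
    intro σ
    have := congrArg (Nat.cast : ℕ → ℝ≥0) (planar_count σ)
    rw [Nat.cast_mul, ← Nat.coe_castAddMonoidHom (α := ℝ≥0), map_multiset_sum, Multiset.map_map] at this
    simp only [Nat.coe_castAddMonoidHom, Function.comp_def, Nat.cast_mul] at this
    push_cast
    rw [← this]
    push_cast
    ring
  simp only [h1]
  rw [← sum_fiberwise_of_maps_to (s := univ) (t := pts (2 * n)) (g := fun σ : Equiv.Perm (Fin (2 * n)) => lam σ)]
  · refine sum_congr rfl fun K hK => ?_
    rw [mem_pts] at hK
    have h2 := card_class (Ω := Fin (2 * n)) K (by rw [hK.1, Fintype.card_fin]) hK.2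
    rw [Fintype.card_fin] at h2
    rw [sum_congr rfl (g := fun _ => (K.map g).prod * (K.map fun k : ℕ => (k : ℝ≥0) * (FF [k] (K.erase k) : ℝ≥0)).sum),
      sum_const, nsmul_eq_mul, ← h2]
    · have hz : (zz K : ℝ≥0) ≠ 0 := by exact_mod_cast (zz_pos hK.2).ne'
      push_cast
      field_simp
    · intro σ hσ
      rw [(mem_filter.1 hσ).2]
  · intro σ _
    rw [mem_pts]
    exact ⟨by rw [lam_sum, Fintype.card_fin], lam_pos σ⟩
end hs

open Classical in
noncomputable def gw (D : Set ℕ) (k : ℕ) (u : ℝ≥0) (j : ℕ) : ℝ≥0 := if j ∈ D then (if j = k then u else 1) else 0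

open Classical in
lemma prod_gw (D : Set ℕ) (k : ℕ) (hk : k ∈ D) (u : ℝ≥0) (K : Multiset ℕ) :
    (K.map (gw D k u)).prod = if ∀ i ∈ K, i ∈ D then u ^ K.count k else 0 := by
  induction K using Multiset.induction_on with
  | empty => simp
  | cons a K ih =>
    rw [Multiset.map_cons, Multiset.prod_cons, ih, gw]
    by_cases ha : a ∈ D
    · by_cases hak : a = k
      · subst hak
        simp [ha, pow_succ, mul_comm]
      · simp [ha, hak, Multiset.count_cons_of_ne (Ne.symm hak)]
    · simp [ha]

theorem pair_sum (D : Set ℕ) (k : ℕ) (hk : k ∈ D) (u : ℝ≥0) (n : ℕ) (hn : 0 < n) :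
    ∑ p ∈ pairFinset D n, u ^ degCount p.1 k =
      ((2 * n - 1).factorial : ℝ≥0) * coeff (2 * n) (hs (gw D k u) [2]) := by
  classical
  rw [← perm_sum _ n hn, pairFinset, sum_filter, Fintype.sum_prod_type]
  refine sum_congr rfl fun σ _ => ?_
  simp only [degCount_eq, mem_lam_iff]
  rw [prod_gw D k hk, ← sum_filter]
  split_ifs with h
  · rw [sum_const, nsmul_eq_mul, mul_comm]
    congr 3
    ext α
    simp only [mem_filter, mem_univ, true_and]
    exact ⟨fun k => k.1, fun k => ⟨k, h⟩⟩
  · rw [zero_mul, filter_false_of_mem, sum_empty]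
    exact fun α _ k => h k.2
end

section
open Finset PowerSeries
open scoped NNReal ENNReal

lemma IsW.mul_le {g : ℕ → ℝ≥0} {W : ℕ → ℝ≥0⟦X⟧} (hW : IsW g W) (i j m n : ℕ) :
    coeff m (W i) * coeff n (W j) ≤ coeff (m + n) (W (i + j + 2)) := by
  have h1 := hW.2 (i + j + 1)
  rw [show i + j + 2 = i + j + 1 + 1 from rfl, h1, map_add, map_sum]
  refine le_trans ?_ (le_add_of_nonneg_right (zero_le))
  have h2 : coeff (m + n) (W i * W (i + j + 1 - 1 - i)) ≤
      ∑ i_1 ∈ range (i + j + 1), coeff (m + n) (W i_1 * W (i + j + 1 - 1 - i_1)) :=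
    single_le_sum (f := fun i_1 => coeff (m + n) (W i_1 * W (i + j + 1 - 1 - i_1)))
      (fun _ _ => zero_le) (by simp)
  refine le_trans ?_ h2
  rw [show i + j + 1 - 1 - i = j by omega, coeff_mul]
  exact single_le_sum (f := fun p : ℕ × ℕ => coeff p.1 (W i) * coeff p.2 (W j))
      (fun _ _ => zero_le) (a := (m, n)) (by simp)

lemma IsW.le_two {g : ℕ → ℝ≥0} {W : ℕ → ℝ≥0⟦X⟧} (hW : IsW g W) (p q m : ℕ) :
    coeff m (W p) ≤ coeff m (W (p + 2 * q)) := by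
  induction q with
  | zero => exact le_rfl
  | succ q ih =>
    refine ih.trans ?_
    have := hW.mul_le (p + 2 * q) 0 m 0
    rw [hW.1] at this
    simpa [mul_add, ← add_assoc] using this

lemma IsW.le_shift {g : ℕ → ℝ≥0} {W : ℕ → ℝ≥0⟦X⟧} (hW : IsW g W) (k : ℕ) (hg : g (k + 1) = 1) (p m : ℕ) :
    coeff m (W (p + k)) ≤ coeff (m + (k + 1)) (W (p + 1)) := by
  rw [hW.2 p, map_add, coeff_Sg]
  refine le_trans ?_ (le_add_of_nonneg_left (zero_le))
  have := single_le_sum (f := fun j => g (j + 1) * coeff (m + (k + 1) - 1 - j) (W (p + j)))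
      (s := range (m + (k + 1))) (fun _ _ => zero_le) (a := k) (by simp; omega)
  refine le_trans ?_ this
  simp only [hg, one_mul]
  rw [show m + (k + 1) - 1 - k = m by omega]

lemma IsW.supmul {g : ℕ → ℝ≥0} {W : ℕ → ℝ≥0⟦X⟧} (hW : IsW g W) (k : ℕ) (hk : 2 ≤ k) (hg : g (k + 1) = 1)
    (m n : ℕ) : coeff m (W 2) * coeff n (W 2) ≤ coeff (m + n + 4 * (k + 1)) (W 2) := by
  obtain ⟨l, rfl⟩ : ∃ l, k = l + 2 := ⟨k - 2, by omega⟩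
  have h := hW.mul_le 2 2 m n
  have h0 := hW.le_two 6 (2 * l) (m + n)
  have h1 := hW.le_shift _ hg (3 * l + 4) (m + n)
  have h2 := hW.le_shift _ hg (2 * l + 3) (m + n + (l + 3))
  have h3 := hW.le_shift _ hg (l + 2) (m + n + (l + 3) + (l + 3))
  have h4 := hW.le_shift _ hg 1 (m + n + (l + 3) + (l + 3) + (l + 3))
  ring_nf at *
  exact h.trans (h0.trans (h1.trans (h2.trans (h3.trans h4))))

lemma sup_lower (a : ℕ → ℝ≥0) (K : ℕ) (hK : 0 < K) (ha : ∀ m n, a m * a n ≤ a (m + n + K)) (x y : ℝ≥0)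
    (hxy : x < y) (h : ∑' m, ((m + 3 : ℕ) : ℝ≥0∞) * ((a m : ℝ≥0∞) * (x : ℝ≥0∞) ^ m) = ⊤) :
    ∃ c : ℝ≥0, 0 < c ∧ ∀ N, a N ≠ 0 → c ≤ a N * y ^ N := by
  have hy : 0 < y := lt_of_le_of_lt (zero_le) hxy
  obtain ⟨M, hM⟩ : ∃ M, 1 ≤ a M * y ^ (M + K) := by
    by_contra! hcon
    have h1 : Summable fun m : ℕ => ((m + 3 : ℕ) : ℝ) * ((x / y : ℝ≥0) : ℝ) ^ m := by
      have hr : ‖((x / y : ℝ≥0) : ℝ)‖ < 1 := by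
        rw [Real.norm_of_nonneg (NNReal.coe_nonneg _)]
        have : x / y < 1 := by rwa [div_lt_one hy]
        exact_mod_cast this
      have e1 := summable_pow_mul_geometric_of_norm_lt_one 1 hr
      have e2 := (summable_geometric_of_norm_lt_one hr).mul_left 3
      refine (e1.add e2).congr fun m => ?_
      push_cast
      ring
    have h2 : Summable fun m : ℕ => ((m + 3 : ℕ) : ℝ≥0) * (x / y) ^ m := by
      rw [← NNReal.summable_coe]
      exact_mod_cast h1
    have h3 : Summable fun m : ℕ => ((m + 3 : ℕ) : ℝ≥0) * (a m * x ^ m) := by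
      refine NNReal.summable_of_le (fun m => ?_) (h2.mul_left (y ^ K)⁻¹)
      have := (hcon m).le
      rw [mul_left_comm _ _ ((x / y) ^ m)]
      apply mul_le_mul_of_nonneg_left _ (by positivity)
      rw [div_pow, ← div_eq_inv_mul, div_div, ← pow_add, le_div_iff₀ (by positivity)]
      calc a m * x ^ m * y ^ (m + K) = x ^ m * (a m * y ^ (m + K)) := by ring
        _ ≤ x ^ m * 1 := by gcongr
        _ = _ := mul_one _
    have h4 := ENNReal.tsum_coe_ne_top_iff_summable.2 h3
    apply h4
    rw [← h]
    push_cast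
    rfl
  set P := M + K with hP
  have hP0 : 0 < P := by omega
  have step : ∀ N q, a N * y ^ N ≤ a (N + q * P) * y ^ (N + q * P) := by
    intro N q
    induction q with
    | zero => simp
    | succ q ih =>
      refine ih.trans ?_
      have e1 := ha (N + q * P) M
      have e2 : N + (q + 1) * P = N + q * P + M + K := by rw [add_mul, one_mul, hP]; ring
      rw [e2]
      calc a (N + q * P) * y ^ (N + q * P) ≤ a (N + q * P) * y ^ (N + q * P) * (a M * y ^ P) :=
            le_mul_of_one_le_right (zero_le) hM
        _ = (a (N + q * P) * a M) * y ^ (N + q * P + M + K) := by rw [hP]; ring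
        _ ≤ _ := by gcongr
  have hr : ∀ r : ℕ, ∃ c : ℝ≥0, 0 < c ∧ ∀ q, a (r + q * P) ≠ 0 → c ≤ a (r + q * P) * y ^ (r + q * P) := by
    intro r
    classical
    by_cases hex : ∃ q, a (r + q * P) ≠ 0
    · refine ⟨_, mul_pos (pos_iff_ne_zero.2 (Nat.find_spec hex)) (pow_pos hy (r + Nat.find hex * P)), fun q hq => ?_⟩
      have hle := Nat.find_min' hex hq
      have := step (r + Nat.find hex * P) (q - Nat.find hex)
      rwa [add_assoc, ← add_mul, Nat.add_sub_cancel' hle] at this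
    · push Not at hex
      exact ⟨1, one_pos, fun q hq => absurd (hex q) hq⟩
  choose c hc hc' using hr
  have hne : (range P).Nonempty := by simp; omega
  refine ⟨(range P).inf' hne c, by simp [Finset.lt_inf'_iff, hc], fun N hN => ?_⟩
  have hd : N % P + N / P * P = N := by rw [mul_comm]; exact Nat.mod_add_div N P
  have := hc' (N % P) (N / P)
  rw [hd] at this
  exact (Finset.inf'_le _ (by simp; exact Nat.mod_lt _ hP0)).trans (this hN)

lemma lower_bound (g : ℕ → ℝ≥0) (W : ℕ → ℝ≥0⟦X⟧) (hW : IsW g W) (k : ℕ) (hk : 3 ≤ k) (hg : g k = 1)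
    (x y : ℝ≥0) (hxy : x < y) (h : ev x (fS g) = ⊤ ∨ ev x (fR g) = ⊤) :
    ∃ c : ℝ≥0, 0 < c ∧ ∀ N, coeff N (W 2) ≠ 0 → c ≤ coeff N (W 2) * y ^ N := by
  obtain ⟨l, rfl⟩ : ∃ l, k = l + 1 := ⟨k - 1, by omega⟩
  exact sup_lower (fun N => coeff N (W 2)) (4 * (l + 1)) (by omega) (hW.supmul l (by omega) hg) x y hxy
    (ev_infinite g W hW x h)
end

section
open Finset PowerSeries
open scoped NNReal ENNReal

lemma exp_le_quad (y : ℝ) : Real.exp y ≤ 1 + y + y ^ 2 * Real.exp |y| := by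
  have h := Complex.norm_exp_sub_sum_le_norm_mul_exp (y : ℂ) 2
  simp [Finset.sum_range_succ] at h
  have h2 : ‖Complex.exp (y : ℂ) - (1 + (y : ℂ))‖ = |Real.exp y - (1 + y)| := by
    rw [← Real.norm_eq_abs, ← Complex.norm_real]
    push_cast
    rfl
  rw [h2] at h
  have := le_abs_self (Real.exp y - (1 + y))
  linarith

lemma sq_le_exp (δ k : ℝ) (hδ : 0 < δ) (hk : 0 ≤ k) : k ^ 2 ≤ 8 / δ ^ 2 * Real.exp (δ / 2 * k) := by
  have h := Real.quadratic_le_exp_of_nonneg (x := δ / 2 * k) (by positivity)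
  rw [div_mul_eq_mul_div, le_div_iff₀ (by positivity)]
  have h1 : 0 ≤ δ / 2 * k := by positivity
  nlinarith

lemma summable_mul_k {ι : Type*} (t k e : ι → ℝ) (ht : ∀ i, 0 ≤ t i) (hk : ∀ i, 1 ≤ k i) (C δ : ℝ) (hδ : 0 < δ)
    (he : ∀ i, |e i| ≤ C * k i) (hsum : Summable fun i => t i * Real.exp (δ * k i)) :
    Summable fun i => t i * e i := by
  refine Summable.of_norm_bounded (hsum.mul_left (|C| / δ)) fun i => ?_
  have h1 : δ * k i ≤ Real.exp (δ * k i) := by linarith [Real.add_one_le_exp (δ * k i)]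
  rw [norm_mul, Real.norm_of_nonneg (ht i), Real.norm_eq_abs]
  calc t i * |e i| ≤ t i * (|C| / δ * Real.exp (δ * k i)) := by
        refine mul_le_mul_of_nonneg_left ?_ (ht i)
        calc |e i| ≤ |C| * k i := (he i).trans (mul_le_mul_of_nonneg_right (le_abs_self C) (by linarith [hk i]))
          _ = |C| / δ * (δ * k i) := by field_simp
          _ ≤ _ := by gcongr
    _ = _ := by ring

lemma lemQ {ι : Type*} (t k e : ι → ℝ) (ht : ∀ i, 0 ≤ t i) (hk : ∀ i, 1 ≤ k i) (C δ ε : ℝ) (hC : 0 ≤ C)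
    (hδ : 0 < δ) (hε : 0 < ε)
    (he : ∀ i, |e i| ≤ C * k i) (hsum : Summable fun i => t i * Real.exp (δ * k i)) :
    ∃ s0 : ℝ, 0 < s0 ∧ ∀ s : ℝ, |s| ≤ s0 →
      Summable (fun i => t i * Real.exp (s * e i - ε * |s| * k i)) ∧
      ∑' i, t i * Real.exp (s * e i - ε * |s| * k i) ≤ ∑' i, t i + s * ∑' i, t i * e i := by
  have ste := summable_mul_k t k e ht hk C δ hδ he hsum
  have stk := summable_mul_k t k k ht hk 1 δ hδ (fun i => by rw [abs_of_nonneg (by linarith [hk i])]; simp) hsum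
  have st := summable_mul_k t k (fun _ => 1) ht hk 1 δ hδ (fun i => by simpa using hk i) hsum
  simp only [mul_one] at st
  by_cases h0 : ∀ i, t i = 0
  · exact ⟨1, one_pos, fun s _ => by simp [h0, summable_zero]⟩
  push Not at h0
  obtain ⟨i0, hi0⟩ := h0
  set L := ∑' i, t i * k i with hL
  have hLpos : 0 < L := stk.tsum_pos (fun i => mul_nonneg (ht i) (by linarith [hk i])) i0
    (mul_pos (lt_of_le_of_ne (ht i0) (Ne.symm hi0)) (by linarith [hk i0]))
  set M := ∑' i, t i * Real.exp (δ * k i) with hM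
  have hM0 : 0 ≤ M := tsum_nonneg fun i => mul_nonneg (ht i) (Real.exp_pos _).le
  set C' := C + ε with hC'
  have hC'pos : 0 < C' := by positivity
  set K := C' ^ 2 * (8 / δ ^ 2) with hK
  have hKpos : 0 < K := by positivity
  refine ⟨min (δ / (2 * C')) (ε * L / (K * M + 1)), by positivity, fun s hs => ?_⟩
  have hs1 : |s| * C' ≤ δ / 2 := by
    have := hs.trans (min_le_left _ _)
    rw [le_div_iff₀ (by positivity)] at this
    linarith
  have hs2 : |s| * (K * M) ≤ ε * L := by
    have := hs.trans (min_le_right _ _)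
    rw [le_div_iff₀ (by positivity)] at this
    linarith [abs_nonneg s]
  have hpt : ∀ i, t i * Real.exp (s * e i - ε * |s| * k i) ≤
      t i + s * (t i * e i) - ε * |s| * (t i * k i) + s ^ 2 * K * (t i * Real.exp (δ * k i)) := by
    intro i
    set y := s * e i - ε * |s| * k i with hy
    have hk0 : 0 ≤ k i := by linarith [hk i]
    have hya : |y| ≤ |s| * C' * k i := by
      calc |y| ≤ |s * e i| + |ε * |s| * k i| := abs_sub _ _
        _ ≤ |s| * (C * k i) + ε * |s| * k i := by
          rw [abs_mul, abs_of_nonneg (show 0 ≤ ε * |s| * k i by positivity)]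
          gcongr
          exact he i
        _ = _ := by rw [hC']; ring
    have hy2 : y ^ 2 * Real.exp |y| ≤ s ^ 2 * K * Real.exp (δ * k i) := by
      have e1 : y ^ 2 ≤ s ^ 2 * C' ^ 2 * k i ^ 2 := by
        rw [← sq_abs y, ← sq_abs s, ← mul_pow, ← mul_pow]
        gcongr
      have e2 : Real.exp |y| ≤ Real.exp (δ / 2 * k i) := by
        apply Real.exp_le_exp.2
        exact hya.trans (mul_le_mul_of_nonneg_right hs1 hk0)
      calc y ^ 2 * Real.exp |y| ≤ (s ^ 2 * C' ^ 2 * k i ^ 2) * Real.exp (δ / 2 * k i) := by gcongr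
        _ ≤ (s ^ 2 * C' ^ 2 * (8 / δ ^ 2 * Real.exp (δ / 2 * k i))) * Real.exp (δ / 2 * k i) := by
          gcongr
          exact sq_le_exp δ (k i) hδ hk0
        _ = s ^ 2 * K * (Real.exp (δ / 2 * k i) * Real.exp (δ / 2 * k i)) := by rw [hK]; ring
        _ = _ := by rw [← Real.exp_add]; ring_nf
    have := mul_le_mul_of_nonneg_left (exp_le_quad y) (ht i)
    have := mul_le_mul_of_nonneg_left hy2 (ht i)
    have e3 : t i * y = s * (t i * e i) - ε * |s| * (t i * k i) := by rw [hy]; ring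
    linarith
  have hS : Summable fun i => t i + s * (t i * e i) - ε * |s| * (t i * k i) + s ^ 2 * K * (t i * Real.exp (δ * k i)) :=
    ((st.add (ste.mul_left s)).sub (stk.mul_left _)).add (hsum.mul_left _)
  have hS' : Summable (fun i => t i * Real.exp (s * e i - ε * |s| * k i)) :=
    Summable.of_nonneg_of_le (fun i => mul_nonneg (ht i) (Real.exp_pos _).le) hpt hS
  refine ⟨hS', (hS'.tsum_le_tsum hpt hS).trans ?_⟩
  rw [Summable.tsum_add ((st.add (ste.mul_left s)).sub (stk.mul_left _)) (hsum.mul_left _),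
    Summable.tsum_sub (st.add (ste.mul_left s)) (stk.mul_left _), Summable.tsum_add st (ste.mul_left s),
    tsum_mul_left, tsum_mul_left, tsum_mul_left, ← hL, ← hM]
  have : s ^ 2 * K * M = |s| * (|s| * (K * M)) := by rw [← sq_abs]; ring
  have := mul_le_mul_of_nonneg_left hs2 (abs_nonneg s)
  linarith
end

section
open Finset PowerSeries
open scoped NNReal ENNReal

noncomputable def ex (y : ℝ) : ℝ≥0 := ⟨Real.exp y, (Real.exp_pos y).le⟩
lemma ex_coe (y : ℝ) : ((ex y : ℝ≥0) : ℝ) = Real.exp y := rfl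

/-- generic term -/
noncomputable def tm (c m r : ℕ × ℕ → ℕ) (g : ℕ → ℝ≥0) (x S R : ℝ≥0) (p : ℕ × ℕ) : ℝ≥0 :=
  g (p.1 + 1) * x ^ (p.1 + 1) * c p * S ^ (m p) * R ^ (r p)

def cA (p : ℕ × ℕ) : ℕ := p.1.choose (2 * p.2) * (2 * p.2).choose p.2
def mA (p : ℕ × ℕ) : ℕ := p.1 - 2 * p.2
def rA (p : ℕ × ℕ) : ℕ := p.2
def cB (p : ℕ × ℕ) : ℕ := p.1.choose (2 * p.2 + 1) * (2 * p.2 + 1).choose p.2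
def mB (p : ℕ × ℕ) : ℕ := p.1 - (2 * p.2 + 1)
def rB (p : ℕ × ℕ) : ℕ := p.2 + 1

lemma tT_tsum (S R : ℝ≥0) (j : ℕ) :
    tT (S : ℝ≥0∞) (R : ℝ≥0∞) j = ∑' i, ((cA (j, i) * S ^ mA (j, i) * R ^ rA (j, i) : ℝ≥0) : ℝ≥0∞) := by
  rw [tsum_eq_sum (s := range (j + 1))]
  · simp [tT, cA, mA, rA]
  · intro i hi
    have : j < 2 * i := by simp at hi; omega
    simp [cA, Nat.choose_eq_zero_of_lt this]

lemma tB_tsum (S R : ℝ≥0) (j : ℕ) :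
    tB (S : ℝ≥0∞) (R : ℝ≥0∞) j = ∑' i, ((cB (j, i) * S ^ mB (j, i) * R ^ rB (j, i) : ℝ≥0) : ℝ≥0∞) := by
  rw [tsum_eq_sum (s := range (j + 1))]
  · simp [tB, cB, mB, rB]
  · intro i hi
    have : j < 2 * i + 1 := by simp at hi; omega
    simp [cB, Nat.choose_eq_zero_of_lt this]

lemma PA_tm (g : ℕ → ℝ≥0) (x S R : ℝ≥0) : PA g x S R = ∑' p, (tm cA mA rA g x S R p : ℝ≥0∞) := by
  rw [ENNReal.tsum_prod', PA]
  congr 1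
  ext j
  rw [tT_tsum, ← ENNReal.tsum_mul_left]
  congr 1
  ext i
  simp only [tm]
  push_cast
  ring

lemma PB_tm (g : ℕ → ℝ≥0) (x S R : ℝ≥0) : PB g x S R = ∑' p, (tm cB mB rB g x S R p : ℝ≥0∞) := by
  rw [ENNReal.tsum_prod', PB]
  congr 1
  ext j
  rw [tB_tsum, ← ENNReal.tsum_mul_left]
  congr 1
  ext i
  simp only [tm]
  push_cast
  ring

/-- weights with the weight of `k` multiplied by `u` -/
noncomputable def gu (g : ℕ → ℝ≥0) (k : ℕ) (u : ℝ≥0) (j : ℕ) : ℝ≥0 := if j = k then u * g j else g j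

noncomputable def sU (c m r : ℕ × ℕ → ℕ) (g : ℕ → ℝ≥0) (x S R : ℝ≥0) (k : ℕ) : ℝ :=
  ∑' p : ℕ × ℕ, (tm c m r g x S R p : ℝ) * (if p.1 + 1 = k then 1 else 0)
noncomputable def sK (c m r : ℕ × ℕ → ℕ) (g : ℕ → ℝ≥0) (x S R : ℝ≥0) : ℝ :=
  ∑' p : ℕ × ℕ, (tm c m r g x S R p : ℝ) * ((p.1 : ℝ) + 1)
noncomputable def sI (c m r : ℕ × ℕ → ℕ) (g : ℕ → ℝ≥0) (x S R : ℝ≥0) : ℝ :=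
  ∑' p : ℕ × ℕ, (tm c m r g x S R p : ℝ) * (m p : ℝ)

lemma tm_summable {c m r : ℕ × ℕ → ℕ} {g : ℕ → ℝ≥0} {x S R : ℝ≥0} {δ : ℝ}
    (h : ∑' p, (tm c m r g (x * ex δ) S R p : ℝ≥0∞) ≠ ⊤) :
    Summable fun p : ℕ × ℕ => (tm c m r g x S R p : ℝ) * Real.exp (δ * ((p.1 : ℝ) + 1)) := by
  have := NNReal.summable_coe.2 (ENNReal.tsum_coe_ne_top_iff_summable.1 h)
  refine this.congr fun p => ?_
  simp only [tm]
  push_cast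
  rw [ex_coe, mul_pow, ← Real.exp_nat_mul]
  push_cast
  ring_nf

lemma tm_sums {c m r : ℕ × ℕ → ℕ} (hm : ∀ p, m p ≤ p.1) {g : ℕ → ℝ≥0} {x S R : ℝ≥0} {δ : ℝ} (hδ : 0 < δ)
    (h : ∑' p, (tm c m r g (x * ex δ) S R p : ℝ≥0∞) ≠ ⊤) (k : ℕ) :
    (Summable fun p : ℕ × ℕ => (tm c m r g x S R p : ℝ) * (if p.1 + 1 = k then 1 else 0)) ∧
    (Summable fun p : ℕ × ℕ => (tm c m r g x S R p : ℝ) * ((p.1 : ℝ) + 1)) ∧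
    (Summable fun p : ℕ × ℕ => (tm c m r g x S R p : ℝ) * (m p : ℝ)) := by
  have hk : ∀ p : ℕ × ℕ, (1 : ℝ) ≤ (p.1 : ℝ) + 1 := fun p => by simp
  have key := fun e he => summable_mul_k (fun p => (tm c m r g x S R p : ℝ)) (fun p : ℕ × ℕ => (p.1 : ℝ) + 1) e
    (fun _ => NNReal.coe_nonneg _) hk 1 δ hδ he (tm_summable h)
  refine ⟨key _ fun p => ?_, key _ fun p => ?_, key _ fun p => ?_⟩
  · have := hk p
    split_ifs <;> simp <;> positivity
  · rw [abs_of_nonneg (by linarith [hk p]), one_mul]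
  · have : (m p : ℝ) ≤ p.1 := by exact_mod_cast hm p
    rw [abs_of_nonneg (by positivity)]
    linarith

lemma PF_sub {c m r : ℕ × ℕ → ℕ} (hm : ∀ p, m p ≤ p.1) {g : ℕ → ℝ≥0} {x S R : ℝ≥0} {δ : ℝ} (hδ : 0 < δ)
    (h : ∑' p, (tm c m r g (x * ex δ) S R p : ℝ≥0∞) ≠ ⊤) (k : ℕ) (μ b ε : ℝ) (hε : 0 < ε) :
    ∃ s0 : ℝ, 0 < s0 ∧ ∀ s : ℝ, |s| ≤ s0 →
      ∑' p, (tm c m r (gu g k (ex s)) (x * ex (-(μ * s) - ε * |s|)) (S * ex (b * s)) R p : ℝ≥0∞) ≤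
      ENNReal.ofReal (∑' p, (tm c m r g x S R p : ℝ) +
        s * (sU c m r g x S R k - μ * sK c m r g x S R + b * sI c m r g x S R)) := by
  have hk : ∀ p : ℕ × ℕ, (1 : ℝ) ≤ (p.1 : ℝ) + 1 := fun p => by simp
  obtain ⟨hU, hK, hI⟩ := tm_sums hm hδ h k
  obtain ⟨s0, hs0, hs⟩ := lemQ (fun p => (tm c m r g x S R p : ℝ)) (fun p : ℕ × ℕ => (p.1 : ℝ) + 1)
    (fun p => (if p.1 + 1 = k then 1 else 0) - μ * ((p.1 : ℝ) + 1) + b * (m p : ℝ))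
    (fun _ => NNReal.coe_nonneg _) hk (1 + |μ| + |b|) δ ε (by positivity) hδ hε (by
      intro p
      have h1 : (m p : ℝ) ≤ (p.1 : ℝ) + 1 := by
        have : (m p : ℝ) ≤ p.1 := by exact_mod_cast hm p
        linarith
      have h2 : |(if p.1 + 1 = k then (1 : ℝ) else 0)| ≤ (p.1 : ℝ) + 1 := by
        have := hk p
        split_ifs <;> simp <;> positivity
      calc _ ≤ |(if p.1 + 1 = k then (1 : ℝ) else 0)| + |μ * ((p.1 : ℝ) + 1)| + |b * (m p : ℝ)| :=
            (abs_add_le _ _).trans (by gcongr; exact abs_sub _ _)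
        _ ≤ ((p.1 : ℝ) + 1) + |μ| * ((p.1 : ℝ) + 1) + |b| * ((p.1 : ℝ) + 1) := by
            rw [abs_mul, abs_mul, abs_of_nonneg (show (0 : ℝ) ≤ (p.1 : ℝ) + 1 by positivity),
              abs_of_nonneg (show (0 : ℝ) ≤ (m p : ℝ) by positivity)]
            gcongr
        _ = _ := by ring) (tm_summable h)
  refine ⟨s0, hs0, fun s hs' => ?_⟩
  obtain ⟨q1, q2⟩ := hs s hs'
  have hid : ∀ p, ((tm c m r (gu g k (ex s)) (x * ex (-(μ * s) - ε * |s|)) (S * ex (b * s)) R p : ℝ≥0) : ℝ) =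
      (tm c m r g x S R p : ℝ) * Real.exp (s * ((if p.1 + 1 = k then 1 else 0) - μ * ((p.1 : ℝ) + 1) + b * (m p : ℝ))
        - ε * |s| * ((p.1 : ℝ) + 1)) := by
    intro p
    have e1 : ((gu g k (ex s) (p.1 + 1) : ℝ≥0) : ℝ) = g (p.1 + 1) * Real.exp (s * (if p.1 + 1 = k then 1 else 0)) := by
      unfold gu
      split_ifs
      · push_cast
        rw [ex_coe, mul_one, mul_comm]
      · simp
    simp only [tm]
    push_cast
    rw [e1, ex_coe, ex_coe, mul_pow, mul_pow, ← Real.exp_nat_mul, ← Real.exp_nat_mul]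
    have e2 : s * ((if p.1 + 1 = k then 1 else 0) - μ * ((p.1 : ℝ) + 1) + b * (m p : ℝ)) - ε * |s| * ((p.1 : ℝ) + 1) =
      s * (if p.1 + 1 = k then 1 else 0) + ((p.1 + 1 : ℕ) : ℝ) * (-(μ * s) - ε * |s|) + (m p : ℝ) * (b * s) := by
      push_cast
      ring
    rw [e2, Real.exp_add, Real.exp_add]
    ring
  have hE : ∑' p, (tm c m r (gu g k (ex s)) (x * ex (-(μ * s) - ε * |s|)) (S * ex (b * s)) R p : ℝ≥0∞) =
      ENNReal.ofReal (∑' p, (tm c m r g x S R p : ℝ) * Real.exp (s * ((if p.1 + 1 = k then 1 else 0)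
        - μ * ((p.1 : ℝ) + 1) + b * (m p : ℝ)) - ε * |s| * ((p.1 : ℝ) + 1))) := by
    rw [ENNReal.ofReal_tsum_of_nonneg (fun p => mul_nonneg (NNReal.coe_nonneg _) (Real.exp_pos _).le) q1]
    congr 1
    ext p
    rw [← hid, ENNReal.ofReal_coe_nnreal]
  rw [hE]
  apply ENNReal.ofReal_le_ofReal
  refine q2.trans (le_of_eq ?_)
  congr 2
  unfold sU sK sI
  rw [← tsum_mul_left, ← tsum_mul_left, ← Summable.tsum_sub hU (hK.mul_left _),
    ← Summable.tsum_add (hU.sub (hK.mul_left _)) (hI.mul_left _)]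
  congr 1
  ext p
  ring

lemma mA_le (p : ℕ × ℕ) : mA p ≤ p.1 := Nat.sub_le _ _
lemma mB_le (p : ℕ × ℕ) : mB p ≤ p.1 := Nat.sub_le _ _

lemma PF_coe {c m r : ℕ × ℕ → ℕ} {g : ℕ → ℝ≥0} {x S R V : ℝ≥0}
    (h : ∑' p, (tm c m r g x S R p : ℝ≥0∞) = V) : ∑' p, (tm c m r g x S R p : ℝ) = V := by
  have h1 : Summable (tm c m r g x S R) := ENNReal.tsum_coe_ne_top_iff_summable.1 (by rw [h]; simp)
  rw [← ENNReal.coe_tsum h1] at h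
  rw [← NNReal.coe_tsum]
  exact_mod_cast h

lemma sub_sol_exists (g : ℕ → ℝ≥0) (x S R : ℝ≥0) (δ : ℝ) (hδ : 0 < δ)
    (hA : PA g (x * ex δ) S R ≠ ⊤) (hB : PB g (x * ex δ) S R ≠ ⊤) (hS : PA g x S R = S) (hR : 1 + PB g x S R = R)
    (k : ℕ) (μ b : ℝ)
    (eA : sU cA mA rA g x S R k - μ * sK cA mA rA g x S R + b * sI cA mA rA g x S R = b * S)
    (eB : sU cB mB rB g x S R k - μ * sK cB mB rB g x S R + b * sI cB mB rB g x S R = 0)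
    (ε : ℝ) (hε : 0 < ε) :
    ∃ s0 : ℝ, 0 < s0 ∧ ∀ s : ℝ, |s| ≤ s0 → ∃ S' : ℝ≥0,
      PA (gu g k (ex s)) (x * ex (-(μ * s) - ε * |s|)) S' R ≤ S' ∧
      1 + PB (gu g k (ex s)) (x * ex (-(μ * s) - ε * |s|)) S' R ≤ R := by
  rw [PA_tm] at hA hS
  rw [PB_tm] at hB hR
  obtain ⟨s1, hs1, h1⟩ := PF_sub mA_le hδ hA k μ b ε hε
  obtain ⟨s2, hs2, h2⟩ := PF_sub mB_le hδ hB k μ b ε hε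
  refine ⟨min s1 s2, lt_min hs1 hs2, fun s hs => ⟨S * ex (b * s), ?_, ?_⟩⟩
  · rw [PA_tm]
    refine (h1 s (hs.trans (min_le_left _ _))).trans ?_
    rw [eA, PF_coe hS, ← ENNReal.ofReal_coe_nnreal]
    apply ENNReal.ofReal_le_ofReal
    push_cast
    rw [ex_coe]
    have := Real.add_one_le_exp (b * s)
    have := mul_le_mul_of_nonneg_left this (NNReal.coe_nonneg S)
    linarith
  · rw [PB_tm]
    refine le_trans ?_ hR.le
    refine add_le_add_right ?_ 1
    refine (h2 s (hs.trans (min_le_right _ _))).trans ?_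
    rw [eB, mul_zero, add_zero]
    have hne : ∑' p, (tm cB mB rB g x S R p : ℝ≥0∞) ≠ ⊤ := by
      intro hh
      rw [hh] at hR
      simp at hR
    rw [← ENNReal.coe_toNNReal hne, PF_coe (ENNReal.coe_toNNReal hne).symm, ENNReal.ofReal_coe_nnreal]
end

section
open Finset PowerSeries
open scoped NNReal ENNReal

lemma sU_pos {c m r : ℕ × ℕ → ℕ} (hm : ∀ p, m p ≤ p.1) {g : ℕ → ℝ≥0} {x S R : ℝ≥0} {δ : ℝ} (hδ : 0 < δ)
    (h : ∑' p, (tm c m r g (x * ex δ) S R p : ℝ≥0∞) ≠ ⊤) (p : ℕ × ℕ) (hp : 0 < tm c m r g x S R p) :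
    0 < sU c m r g x S R (p.1 + 1) ∧ 0 < sK c m r g x S R := by
  obtain ⟨hU, hK, hI⟩ := tm_sums hm hδ h (p.1 + 1)
  constructor
  · refine hU.tsum_pos (fun q => ?_) p (by simpa using hp)
    exact mul_nonneg (NNReal.coe_nonneg _) (by split_ifs <;> simp)
  · refine hK.tsum_pos (fun q => by positivity) p ?_
    have : (0 : ℝ) < tm c m r g x S R p := by exact_mod_cast hp
    positivity

lemma s_nonneg (c m r : ℕ × ℕ → ℕ) (g : ℕ → ℝ≥0) (x S R : ℝ≥0) (k : ℕ) :
    0 ≤ sU c m r g x S R k ∧ 0 ≤ sK c m r g x S R ∧ 0 ≤ sI c m r g x S R :=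
  ⟨tsum_nonneg fun q => mul_nonneg (NNReal.coe_nonneg _) (by split_ifs <;> simp),
    tsum_nonneg fun q => by positivity, tsum_nonneg fun q => by positivity⟩

lemma mu_exists (g : ℕ → ℝ≥0) (x S R : ℝ≥0) (δ : ℝ) (hδ : 0 < δ)
    (hA : PA g (x * ex δ) S R ≠ ⊤) (hB : PB g (x * ex δ) S R ≠ ⊤) (hS : PA g x S R = S) (hR : 0 < R) (hx : 0 < x)
    (k l : ℕ) (hl : 3 ≤ l) (hgl : 0 < g l) (hk : 0 < k) (hgk : 0 < g k) (hJ : sI cA mA rA g x S R ≤ S) :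
    ∃ μ : ℝ, 0 < μ ∧ ∃ b : ℝ,
      sU cA mA rA g x S R k - μ * sK cA mA rA g x S R + b * sI cA mA rA g x S R = b * S ∧
      sU cB mB rB g x S R k - μ * sK cB mB rB g x S R + b * sI cB mB rB g x S R = 0 := by
  rw [PA_tm] at hA hS
  rw [PB_tm] at hB
  obtain ⟨k, rfl⟩ : ∃ k', k = k' + 1 := ⟨k - 1, by omega⟩
  obtain ⟨l, rfl⟩ : ∃ k', l = k' + 1 := ⟨l - 1, by omega⟩
  rcases eq_or_ne S 0 with rfl | hS0
  · have h0 : ∀ p, tm cA mA rA g x 0 R p = 0 := by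
      intro p
      simpa using ENNReal.tsum_eq_zero.1 hS p
    have hne : ∃ p : ℕ × ℕ, p.1 = k ∧ 0 < tm cB mB rB g x 0 R p := by
      rcases Nat.even_or_odd' k with ⟨i, rfl | rfl⟩
      · exfalso
        have := h0 (2 * i, i)
        simp [tm, cA, mA, rA, hgk.ne', hx.ne', hR.ne', Nat.choose_eq_zero_iff] at this
        omega
      · refine ⟨(2 * i + 1, i), rfl, ?_⟩
        have : 0 < (2 * i + 1).choose i := Nat.choose_pos (by omega)
        simp [tm, cB, mB, rB, hgk, hx, hR, this]
    obtain ⟨p, rfl, hp⟩ := hne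
    obtain ⟨h1, h2⟩ := sU_pos mB_le hδ hB p hp
    refine ⟨_, div_pos h1 h2, 0, ?_, ?_⟩
    · simp [sU, sK, sI, h0]
    · field_simp
      ring
  · have hSp : 0 < S := pos_iff_ne_zero.2 hS0
    obtain ⟨h1, h2⟩ := sU_pos mA_le hδ hA (k, 0) (by simp [tm, cA, mA, rA, hgk, hx, hSp])
    simp only at h1
    have h3 : 0 < sI cB mB rB g x S R := by
      refine (tm_sums mB_le hδ hB 0).2.2.tsum_pos (fun q => by positivity) (l, 0) ?_
      have hl' : 0 < l := by omega
      have e1 : 0 < tm cB mB rB g x S R (l, 0) := by simp [tm, cB, mB, rB, hgl, hx, hSp, hR, hl']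
      have e2 : 0 < mB (l, 0) := by simp [mB]; omega
      have e1' : (0 : ℝ) < tm cB mB rB g x S R (l, 0) := by exact_mod_cast e1
      positivity
    obtain ⟨h4, h5, -⟩ := s_nonneg cB mB rB g x S R (k + 1)
    generalize sU cA mA rA g x S R (k + 1) = Au at *
    generalize sK cA mA rA g x S R = Ak at *
    generalize sI cA mA rA g x S R = Ai at *
    generalize sU cB mB rB g x S R (k + 1) = Bu at *
    generalize sK cB mB rB g x S R = Bk at *
    generalize sI cB mB rB g x S R = Bi at *
    have hd : 0 < Ak * Bi + Bk * (S - Ai) :=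
      add_pos_of_pos_of_nonneg (mul_pos h2 h3) (mul_nonneg h5 (by linarith))
    have hn : 0 < Au * Bi + Bu * (S - Ai) :=
      add_pos_of_pos_of_nonneg (mul_pos h1 h3) (mul_nonneg h4 (by linarith))
    obtain ⟨μ, hμ⟩ : ∃ μ : ℝ, μ = (Au * Bi + Bu * (S - Ai)) / (Ak * Bi + Bk * (S - Ai)) := ⟨_, rfl⟩
    have hμ' : μ * (Ak * Bi + Bk * (S - Ai)) = Au * Bi + Bu * (S - Ai) := by
      rw [hμ, div_mul_cancel₀ _ hd.ne']
    refine ⟨μ, hμ ▸ div_pos hn hd, (μ * Bk - Bu) / Bi, ?_, ?_⟩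
    · field_simp
      linarith
    · field_simp
      ring
end

section
open Finset PowerSeries
open scoped NNReal ENNReal

lemma sum_range_pairs (f : ℕ → ℝ) (N : ℕ) :
    ∑ m ∈ range (2 * N), f m = ∑ i ∈ range N, (f (2 * i) + f (2 * i + 1)) := by
  induction N with
  | zero => simp
  | succ N ih => rw [mul_add, mul_one, sum_range_succ, sum_range_succ, ih, sum_range_succ]; ring

lemma even_sum (S y : ℝ) (n : ℕ) :
    2 * ∑ i ∈ range (n + 1), (n.choose (2 * i) : ℝ) * S ^ (n - 2 * i) * y ^ (2 * i) = (S + y) ^ n + (S - y) ^ n := by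
  have h : ∀ z : ℝ, (S + z) ^ n = ∑ i ∈ range (n + 1),
      ((n.choose (2 * i) : ℝ) * S ^ (n - 2 * i) * z ^ (2 * i) +
        (n.choose (2 * i + 1) : ℝ) * S ^ (n - (2 * i + 1)) * z ^ (2 * i + 1)) := by
    intro z
    rw [← sum_range_pairs (fun m => (n.choose m : ℝ) * S ^ (n - m) * z ^ m), add_comm, add_pow]
    rw [← sum_subset (range_mono (show n + 1 ≤ 2 * (n + 1) by omega))]
    · exact sum_congr rfl fun m _ => by ring
    · intro m _ hm
      rw [Nat.choose_eq_zero_of_lt (by simpa using hm)]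
      simp
  rw [sub_eq_add_neg, h y, h (-y), ← sum_add_distrib, mul_sum]
  refine sum_congr rfl fun i _ => ?_
  rw [(even_two_mul i).neg_pow, (odd_two_mul_add_one i).neg_pow]
  ring

lemma tT_le_real (S y : ℝ) (hS : 0 ≤ S) (hy : 0 ≤ y) (n : ℕ) : tT S (y ^ 2) n ≤ (S + 2 * y) ^ n := by
  have h := even_sum S (2 * y) n
  have h1 : (S - 2 * y) ^ n ≤ (S + 2 * y) ^ n := by
    refine (le_abs_self _).trans ?_
    rw [abs_pow]
    refine pow_le_pow_left₀ (abs_nonneg _) ?_ n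
    rw [abs_le]
    constructor <;> linarith
  have h2 : tT S (y ^ 2) n ≤ ∑ i ∈ range (n + 1), (n.choose (2 * i) : ℝ) * S ^ (n - 2 * i) * (2 * y) ^ (2 * i) := by
    unfold tT
    refine sum_le_sum fun i _ => ?_
    have : ((2 * i).choose i : ℝ) ≤ 2 ^ (2 * i) := by exact_mod_cast Nat.choose_le_two_pow (2 * i) i
    push_cast
    calc (n.choose (2 * i) : ℝ) * ((2 * i).choose i : ℝ) * S ^ (n - 2 * i) * (y ^ 2) ^ i
        ≤ (n.choose (2 * i) : ℝ) * 2 ^ (2 * i) * S ^ (n - 2 * i) * (y ^ 2) ^ i := by gcongr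
      _ = _ := by rw [mul_pow, pow_mul y]; ring
  linarith

lemma le_tT_real (S y : ℝ) (hS : 0 ≤ S) (hy : 0 ≤ y) (n : ℕ) (hn : Even n) :
    (S + 2 * y) ^ n ≤ 2 * ((n : ℝ) + 1) * tT S (y ^ 2) n := by
  have h := even_sum S (2 * y) n
  have h1 : 0 ≤ (S - 2 * y) ^ n := hn.pow_nonneg _
  have h2 : ∑ i ∈ range (n + 1), (n.choose (2 * i) : ℝ) * S ^ (n - 2 * i) * (2 * y) ^ (2 * i) ≤
      ((n : ℝ) + 1) * tT S (y ^ 2) n := by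
    unfold tT
    rw [mul_sum]
    refine sum_le_sum fun i _ => ?_
    by_cases hi : n < 2 * i
    · simp [Nat.choose_eq_zero_of_lt hi]
    have h3 : 4 ^ i ≤ (n + 1) * (2 * i).choose i := by
      rcases Nat.eq_zero_or_pos i with rfl | hi0
      · simp
      · refine (Nat.four_pow_le_two_mul_self_mul_centralBinom i hi0).trans ?_
        rw [Nat.centralBinom_eq_two_mul_choose]
        exact Nat.mul_le_mul_right _ (by omega)
    have h3' : (4 : ℝ) ^ i ≤ ((n : ℝ) + 1) * ((2 * i).choose i : ℝ) := by exact_mod_cast h3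
    push_cast
    calc (n.choose (2 * i) : ℝ) * S ^ (n - 2 * i) * (2 * y) ^ (2 * i)
        = (n.choose (2 * i) : ℝ) * S ^ (n - 2 * i) * (y ^ 2) ^ i * 4 ^ i := by
          rw [mul_pow, pow_mul y, pow_mul 2]; norm_num; ring
      _ ≤ (n.choose (2 * i) : ℝ) * S ^ (n - 2 * i) * (y ^ 2) ^ i * (((n : ℝ) + 1) * ((2 * i).choose i : ℝ)) := by
          gcongr
      _ = _ := by ring
  linarith

lemma tT_coe (S R : ℝ≥0) (n : ℕ) : ((tT S R n : ℝ≥0) : ℝ) = tT (S : ℝ) (R : ℝ) n :=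
  (tT_map NNReal.toRealHom S R n)
lemma tT_coe' (S R : ℝ≥0) (n : ℕ) : ((tT S R n : ℝ≥0) : ℝ≥0∞) = tT (S : ℝ≥0∞) (R : ℝ≥0∞) n :=
  (tT_map ENNReal.ofNNRealHom S R n)
lemma tB_coe' (S R : ℝ≥0) (n : ℕ) : ((tB S R n : ℝ≥0) : ℝ≥0∞) = tB (S : ℝ≥0∞) (R : ℝ≥0∞) n :=
  (tB_map ENNReal.ofNNRealHom S R n)

lemma tT_le (S y : ℝ≥0) (n : ℕ) : tT S (y ^ 2) n ≤ (S + 2 * y) ^ n := by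
  rw [← NNReal.coe_le_coe, tT_coe]
  push_cast
  exact tT_le_real _ _ S.2 y.2 n

lemma tB_le (S y : ℝ≥0) (n : ℕ) : tB S (y ^ 2) n ≤ (S + 2 * y) ^ (n + 1) := by
  refine le_trans ?_ (tT_le S y (n + 1))
  rw [tT_succ]
  refine le_add_left ?_
  exact le_mul_of_one_le_left (zero_le) one_le_two

lemma le_tT (S y : ℝ≥0) (n : ℕ) (hn : Even n) : (S + 2 * y) ^ n ≤ 2 * ((n : ℝ≥0) + 1) * tT S (y ^ 2) n := by
  rw [← NNReal.coe_le_coe]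
  push_cast
  rw [tT_coe]
  push_cast
  exact le_tT_real _ _ S.2 y.2 n hn

lemma pow_le_tT (S R : ℝ≥0∞) (n : ℕ) : S ^ n ≤ tT S R n := by
  unfold tT
  refine le_trans ?_ (single_le_sum (fun _ _ => zero_le) (show 0 ∈ range (n + 1) by simp))
  simp

lemma pow_le_tT_even (S R : ℝ≥0∞) (i : ℕ) : R ^ i ≤ tT S R (2 * i) := by
  unfold tT
  refine le_trans ?_ (single_le_sum (fun _ _ => zero_le) (show i ∈ range (2 * i + 1) by simp; omega))
  simp only [Nat.choose_self, one_mul, Nat.sub_self, pow_zero, mul_one]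
  refine le_mul_of_one_le_left zero_le ?_
  exact_mod_cast Nat.choose_pos (show i ≤ 2 * i by omega)

lemma pow_le_tB_odd (S R : ℝ≥0∞) (i : ℕ) : R ^ (i + 1) ≤ tB S R (2 * i + 1) := by
  unfold tB
  refine le_trans ?_ (single_le_sum (fun _ _ => zero_le) (show i ∈ range (2 * i + 1 + 1) by simp; omega))
  simp only [Nat.choose_self, one_mul, Nat.sub_self, pow_zero, mul_one]
  refine le_mul_of_one_le_left zero_le ?_
  exact_mod_cast Nat.choose_pos (show i ≤ 2 * i + 1 by omega)

lemma pow_le_tB_even (S R : ℝ≥0∞) (i : ℕ) : S * R ^ (i + 1) ≤ tB S R (2 * i + 2) := by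
  unfold tB
  refine le_trans ?_ (single_le_sum (fun _ _ => zero_le) (show i ∈ range (2 * i + 2 + 1) by simp; omega))
  rw [show 2 * i + 2 - (2 * i + 1) = 1 by omega, pow_one, mul_assoc]
  refine le_mul_of_one_le_left zero_le ?_
  exact_mod_cast Nat.mul_pos (Nat.choose_pos (by omega)) (Nat.choose_pos (by omega))
end

section
open Finset PowerSeries
open scoped NNReal ENNReal

def Fn (g : ℕ → ℝ≥0) (x : ℝ≥0) : Prop := ev x (fS g) ≠ ⊤ ∧ ev x (fR g) ≠ ⊤

lemma Fn_mono {g : ℕ → ℝ≥0} {x y : ℝ≥0} (h : x ≤ y) (hy : Fn g y) : Fn g x :=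
  ⟨ne_top_of_le_ne_top hy.1 (ev_mono h _), ne_top_of_le_ne_top hy.2 (ev_mono h _)⟩

lemma PA_ge (g : ℕ → ℝ≥0) (l : ℕ) (hl : g (l + 1) = 1) (x : ℝ≥0) (S R : ℝ≥0∞) :
    (x : ℝ≥0∞) ^ (l + 1) * tT S R l ≤ PA g x S R := by
  refine le_trans ?_ (ENNReal.le_tsum l)
  simp [hl]
lemma PB_ge (g : ℕ → ℝ≥0) (l : ℕ) (hl : g (l + 1) = 1) (x : ℝ≥0) (S R : ℝ≥0∞) :
    (x : ℝ≥0∞) ^ (l + 1) * tB S R l ≤ PB g x S R := by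
  refine le_trans ?_ (ENNReal.le_tsum l)
  simp [hl]

lemma Fn_start (g : ℕ → ℝ≥0) (hg : ∀ j, g j ≤ 1) : Fn g (1 / 10) := by
  have hb : ∀ F : ℕ → ℝ≥0, (∀ n, F n ≤ 5 ^ (n + 1)) →
      ∑' j, (g (j + 1) : ℝ≥0∞) * ((1 / 10 : ℝ≥0) : ℝ≥0∞) ^ (j + 1) * (F j : ℝ≥0∞) ≤ 1 := by
    intro F hF
    have h2 : ∑' j : ℕ, ((2 : ℝ≥0∞)⁻¹) ^ (j + 1) = 1 := by
      rw [ENNReal.tsum_geometric_add_one, ENNReal.one_sub_inv_two, inv_inv]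
      exact ENNReal.inv_mul_cancel (by simp) (by simp)
    rw [← h2]
    refine ENNReal.tsum_le_tsum fun j => ?_
    have h3 : g (j + 1) * (1 / 10) ^ (j + 1) * F j ≤ (2⁻¹) ^ (j + 1) := by
      calc g (j + 1) * (1 / 10) ^ (j + 1) * F j ≤ 1 * (1 / 10) ^ (j + 1) * 5 ^ (j + 1) := by
            gcongr
            · exact hg _
            · exact hF _
        _ = (2⁻¹) ^ (j + 1) := by
            rw [one_mul, ← mul_pow]
            congr 1
            rw [← NNReal.coe_inj]
            push_cast
            norm_num
    have h4 : ((g (j + 1) * (1 / 10) ^ (j + 1) * F j : ℝ≥0) : ℝ≥0∞) ≤ (((2⁻¹) ^ (j + 1) : ℝ≥0) : ℝ≥0∞) := by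
      exact_mod_cast h3
    rw [ENNReal.coe_mul, ENNReal.coe_mul, ENNReal.coe_pow, ENNReal.coe_pow, ENNReal.coe_inv two_ne_zero] at h4
    exact h4
  have q : (1 : ℝ≥0) + 2 * 2 = 5 := by norm_num
  have q2 : (4 : ℝ≥0) = 2 ^ 2 := by norm_num
  have hs := ev_sub_sol g (1 / 10) (1 : ℝ≥0) (4 : ℝ≥0) (by
      refine le_trans ?_ (le_trans (hb (fun j => tT 1 4 j) fun n => ?_) (by simp))
      · simp only [tT_coe', PA, le_refl]
      · rw [q2, ← q]
        refine (tT_le 1 2 n).trans ?_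
        rw [q]
        exact pow_le_pow_right₀ (by norm_num) (by omega)) (by
      have := hb (fun j => tB 1 4 j) fun n => by
        rw [q2, ← q]
        exact tB_le 1 2 n
      simp only [tB_coe'] at this
      have h3 : 1 + PB g (1 / 10) (1 : ℝ≥0) (4 : ℝ≥0) ≤ 1 + 1 := add_le_add_right this 1
      refine h3.trans ?_
      norm_num)
  exact ⟨ne_top_of_le_ne_top (by simp) hs.1, ne_top_of_le_ne_top (by simp) hs.2⟩

lemma one_le_fR (g : ℕ → ℝ≥0) (x : ℝ≥0) : 1 ≤ ev x (fR g) := by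
  rw [ev_fR]
  exact le_self_add

lemma Fn_bound (g : ℕ → ℝ≥0) (l : ℕ) (hl : 2 ≤ l) (hgl : g (l + 1) = 1) (x : ℝ≥0) (hx : Fn g x) :
    (ev x (fS g) ≤ 1 ∨ (x : ℝ≥0∞) ^ (l + 1) * ev x (fS g) ≤ 1) ∧ (x : ℝ≥0∞) ^ (2 * (l + 1)) * ev x (fR g) ≤ 1 := by
  have h1 := (PA_ge g l hgl x (ev x (fS g)) (ev x (fR g))).trans (ev_fS g x).ge
  have h2 := (PB_ge g l hgl x (ev x (fS g)) (ev x (fR g))).trans (le_add_self.trans (ev_fR g x).ge)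
  have h3 := one_le_fR g x
  obtain ⟨hS, hR⟩ := hx
  generalize ev x (fS g) = S at *
  generalize ev x (fR g) = R at *
  constructor
  · by_contra! hc
    have e1 : S ^ 2 ≤ S ^ l := pow_le_pow_right₀ hc.1.le hl
    have e2 : (x : ℝ≥0∞) ^ (l + 1) * S * S ≤ 1 * S := by
      calc (x : ℝ≥0∞) ^ (l + 1) * S * S = (x : ℝ≥0∞) ^ (l + 1) * S ^ 2 := by ring
        _ ≤ (x : ℝ≥0∞) ^ (l + 1) * tT S R l := by gcongr; exact e1.trans (pow_le_tT S R l)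
        _ ≤ 1 * S := by rw [one_mul]; exact h1
    have e3 := (ENNReal.mul_le_mul_iff_left (by rintro rfl; simp at hc) hS).1 e2
    exact absurd hc.2 (not_lt.2 e3)
  · have hR0 : R ≠ 0 := by rintro rfl; simp at h3
    rw [← ENNReal.mul_le_mul_iff_left hR0 hR, one_mul, mul_assoc, ← sq]
    rcases Nat.even_or_odd' l with ⟨i, rfl | rfl⟩
    · obtain ⟨i, rfl⟩ : ∃ i', i = i' + 1 := ⟨i - 1, by omega⟩
      have e1 := pow_le_tT_even S R (i + 1)
      have e2 := pow_le_tB_even S R i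
      rw [show 2 * (i + 1) = 2 * i + 2 by ring] at *
      calc (x : ℝ≥0∞) ^ (2 * (2 * i + 2 + 1)) * R ^ 2 ≤ (x : ℝ≥0∞) ^ (2 * (2 * i + 2 + 1)) * R ^ (2 * (i + 1)) := by
            gcongr
            omega
        _ = (x : ℝ≥0∞) ^ (2 * i + 2 + 1) * (((x : ℝ≥0∞) ^ (2 * i + 2 + 1) * R ^ (i + 1)) * R ^ (i + 1)) := by ring
        _ ≤ (x : ℝ≥0∞) ^ (2 * i + 2 + 1) * (((x : ℝ≥0∞) ^ (2 * i + 2 + 1) * tT S R (2 * i + 2)) * R ^ (i + 1)) := by gcongr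
        _ ≤ (x : ℝ≥0∞) ^ (2 * i + 2 + 1) * (S * R ^ (i + 1)) := by gcongr
        _ ≤ (x : ℝ≥0∞) ^ (2 * i + 2 + 1) * tB S R (2 * i + 2) := by gcongr
        _ ≤ R := h2
    · have e2 := pow_le_tB_odd S R i
      have e3 : (x : ℝ≥0∞) ^ (2 * i + 1 + 1) * R ^ 2 ≤ R := by
        refine le_trans ?_ h2
        gcongr
        refine le_trans ?_ e2
        exact pow_le_pow_right₀ h3 (by omega)
      have e4 : (x : ℝ≥0∞) ^ (2 * i + 1 + 1) ≤ 1 := by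
        rw [← ENNReal.mul_le_mul_iff_left hR0 hR, one_mul]
        refine le_trans ?_ e3
        gcongr
        exact le_self_pow₀ h3 (by norm_num)
      calc (x : ℝ≥0∞) ^ (2 * (2 * i + 1 + 1)) * R ^ 2 =
            (x : ℝ≥0∞) ^ (2 * i + 1 + 1) * ((x : ℝ≥0∞) ^ (2 * i + 1 + 1) * R ^ 2) := by ring
        _ ≤ 1 * R := by gcongr
        _ = R := one_mul _

lemma ev_left_le (F : ℝ≥0⟦X⟧) (ρ y C : ℝ≥0) (hy : y < ρ) (h : ∀ x, y < x → x < ρ → ev x F ≤ C) : ev ρ F ≤ C := by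
  rw [ev_def, ENNReal.tsum_eq_iSup_nat]
  refine iSup_le fun N => ?_
  have key : ∀ x, y < x → x < ρ → ∑ n ∈ range N, coeff n F * x ^ n ≤ C := by
    intro x h1 h2
    have := (ENNReal.sum_le_tsum (range N)).trans ((ev_def x F).symm.le.trans (h x h1 h2))
    exact_mod_cast this
  have hc : Continuous fun x : ℝ≥0 => ∑ n ∈ range N, coeff n F * x ^ n := by fun_prop
  have hne : (nhdsWithin ρ (Set.Iio ρ)).NeBot := nhdsLT_neBot_of_exists_lt ⟨y, hy⟩
  have := le_of_tendsto (x := nhdsWithin ρ (Set.Iio ρ)) (hc.tendsto ρ |>.mono_left nhdsWithin_le_nhds)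
    (by
      filter_upwards [Ioo_mem_nhdsLT hy] with x hx
      exact key x hx.1 hx.2)
  exact_mod_cast this
end

section
open Finset PowerSeries
open scoped NNReal ENNReal

noncomputable def PJ (g : ℕ → ℝ≥0) (x : ℝ≥0) (S R : ℝ≥0∞) : ℝ≥0∞ :=
  ∑' j, (g (j + 1) : ℝ≥0∞) * (x : ℝ≥0∞) ^ (j + 1) * ((j : ℝ≥0∞) * tT S R (j - 1))

noncomputable def fJ (g : ℕ → ℝ≥0) : ℝ≥0⟦X⟧ := Sg g fun j => (j : ℝ≥0⟦X⟧) * tT (fS g) (fR g) (j - 1)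

lemma ev_fJ (g : ℕ → ℝ≥0) (x : ℝ≥0) : ev x (fJ g) = PJ g x (ev x (fS g)) (ev x (fR g)) := by
  rw [fJ, ev_Sg, PJ]
  simp only [map_mul, map_natCast, tT_map]

lemma nT_eq (S R : ℝ≥0∞) (m : ℕ) : ((m + 1 : ℕ) : ℝ≥0∞) * tT S R m = ∑ i ∈ range (m + 2),
    (((m + 1).choose (2 * i + 1) * (2 * i + 1).choose i : ℕ) : ℝ≥0∞) * S ^ (m + 1 - (2 * i + 1)) *
      (((i + 1 : ℕ) : ℝ≥0∞) * R ^ i) := by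
  rw [tT_ext S R m (m + 2) (by omega), mul_sum]
  refine sum_congr rfl fun i _ => ?_
  have h1 := Nat.add_one_mul_choose_eq m (2 * i)
  have h2 := Nat.add_one_mul_choose_eq (2 * i) i
  have h3 : (2 * i + 1).choose (i + 1) = (2 * i + 1).choose i := Nat.choose_symm_half i
  have h4 : (m + 1) * (m.choose (2 * i) * (2 * i).choose i) =
      (m + 1).choose (2 * i + 1) * (2 * i + 1).choose i * (i + 1) := by
    rw [← mul_assoc, h1, mul_assoc, h2, h3, mul_assoc]
  rw [show m + 1 - (2 * i + 1) = m - 2 * i by omega]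
  calc ((m + 1 : ℕ) : ℝ≥0∞) * (((m.choose (2 * i) * (2 * i).choose i : ℕ) : ℝ≥0∞) * S ^ (m - 2 * i) * R ^ i)
      = (((m + 1) * (m.choose (2 * i) * (2 * i).choose i) : ℕ) : ℝ≥0∞) * S ^ (m - 2 * i) * R ^ i := by
        rw [Nat.cast_mul (m + 1)]
        ring
    _ = _ := by
        rw [h4, Nat.cast_mul _ (i + 1)]
        ring

lemma bern (R d : ℝ≥0∞) (i : ℕ) : R ^ (i + 1) + d * (((i + 1 : ℕ) : ℝ≥0∞) * R ^ i) ≤ (R + d) ^ (i + 1) := by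
  induction i with
  | zero => simp
  | succ i ih =>
    calc R ^ (i + 1 + 1) + d * (((i + 1 + 1 : ℕ) : ℝ≥0∞) * R ^ (i + 1))
        = (R ^ (i + 1) + d * (((i + 1 : ℕ) : ℝ≥0∞) * R ^ i)) * R + R ^ (i + 1) * d := by push_cast; ring
      _ ≤ (R + d) ^ (i + 1) * R + (R + d) ^ (i + 1) * d := by gcongr; exact le_self_add
      _ = _ := by ring

lemma tB_add (S R d : ℝ≥0∞) (n : ℕ) : tB S R n + d * ((n : ℝ≥0∞) * tT S R (n - 1)) ≤ tB S (R + d) n := by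
  cases n with
  | zero => simp [tB_zero]
  | succ m =>
    rw [Nat.add_sub_cancel, nT_eq]
    unfold tB
    rw [mul_sum, ← sum_add_distrib]
    refine sum_le_sum fun i _ => ?_
    refine le_trans (le_of_eq ?_) (mul_le_mul_right (bern R d i) _)
    ring

lemma tJ_le (S R : ℝ≥0∞) (n : ℕ) : R * ((n : ℝ≥0∞) * tT S R (n - 1)) ≤ ((n + 1 : ℕ) : ℝ≥0∞) * tB S R n := by
  cases n with
  | zero => simp [tB_zero]
  | succ m =>
    rw [Nat.add_sub_cancel, nT_eq]
    unfold tB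
    rw [mul_sum, mul_sum]
    refine sum_le_sum fun i hi => ?_
    calc _ = ((i + 1 : ℕ) : ℝ≥0∞) * ((((m + 1).choose (2 * i + 1) * (2 * i + 1).choose i : ℕ) : ℝ≥0∞) *
          S ^ (m + 1 - (2 * i + 1)) * R ^ (i + 1)) := by ring
      _ ≤ _ := by
        gcongr
        simp at hi
        omega

lemma PB_mono (g : ℕ → ℝ≥0) {x y : ℝ≥0} (h : x ≤ y) {S S' : ℝ≥0∞} (hS : S ≤ S') (R : ℝ≥0∞) :
    PB g x S R ≤ PB g y S' R := by
  unfold PB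
  refine ENNReal.tsum_le_tsum fun j => ?_
  gcongr
  exact tB_mono hS le_rfl j

lemma J_le_one (g : ℕ → ℝ≥0) (x y : ℝ≥0) (hx : 0 < x) (hxy : x < y) (hy : Fn g y) : ev x (fJ g) ≤ 1 := by
  have hSle := ev_mono hxy.le (fS g)
  have hRle := ev_mono hxy.le (fR g)
  have hRx := ev_fR g x
  have hRy := ev_fR g y
  have h1R := one_le_fR g x
  obtain ⟨hS2, hR2⟩ := hy
  rw [ev_fJ]
  generalize ev x (fS g) = S1 at *
  generalize ev x (fR g) = R1 at *
  generalize ev y (fS g) = S2 at *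
  generalize ev y (fR g) = R2 at *
  have hR1 : R1 ≠ ⊤ := ne_top_of_le_ne_top hR2 hRle
  have hPBt : PB g x S1 R1 ≠ ⊤ := by
    intro h
    rw [h] at hRx
    simp at hRx
    exact hR1 hRx
  rcases eq_or_ne R1 R2 with rfl | hne
  · have h0 : PB g x S1 R1 = 0 := by
      by_contra h0
      have e1 : PB g y S2 R1 = PB g x S1 R1 := by
        have := hRx.symm.trans hRy
        exact ((ENNReal.add_right_inj ENNReal.one_ne_top).1 this).symm
      have e2 : ((y / x : ℝ≥0) : ℝ≥0∞) * PB g x S1 R1 ≤ 1 * PB g x S1 R1 := by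
        rw [one_mul]
        refine le_trans ?_ ((PB_mono g le_rfl hSle R1).trans e1.le)
        unfold PB
        rw [← ENNReal.tsum_mul_left]
        refine ENNReal.tsum_le_tsum fun j => ?_
        have e3 : y / x * x ^ (j + 1) ≤ y ^ (j + 1) := by
          rw [pow_succ, pow_succ, mul_comm (x ^ j), ← mul_assoc, div_mul_cancel₀ _ hx.ne', mul_comm]
          gcongr
        have e3' : ((y / x : ℝ≥0) : ℝ≥0∞) * (x : ℝ≥0∞) ^ (j + 1) ≤ (y : ℝ≥0∞) ^ (j + 1) := by exact_mod_cast e3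
        calc _ = (g (j + 1) : ℝ≥0∞) * (((y / x : ℝ≥0) : ℝ≥0∞) * (x : ℝ≥0∞) ^ (j + 1)) * tB S1 R1 j := by ring
          _ ≤ _ := by gcongr
      have e4 := (ENNReal.mul_le_mul_iff_left h0 hPBt).1 e2
      have e5 : y / x ≤ 1 := by exact_mod_cast e4
      rw [div_le_one hx] at e5
      exact absurd hxy (not_lt.2 e5)
    have hJ : PJ g x S1 R1 = 0 := by
      unfold PJ
      rw [ENNReal.tsum_eq_zero]
      intro j
      have h0j := ENNReal.tsum_eq_zero.1 h0 j
      rcases mul_eq_zero.1 h0j with h | h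
      · rw [h, zero_mul]
      · have := tJ_le S1 R1 j
        rw [h, mul_zero, nonpos_iff_eq_zero, mul_eq_zero] at this
        rcases this with h | h
        · rw [h] at h1R
          simp at h1R
        · rw [h, mul_zero]
    rw [hJ]
    exact zero_le
  · obtain ⟨d, rfl⟩ : ∃ d, R2 = R1 + d := le_iff_exists_add.1 hRle
    have hd0 : d ≠ 0 := by rintro rfl; simp at hne
    have hdt : d ≠ ⊤ := by rintro rfl; simp at hR2
    have key : PB g x S1 R1 + d * PJ g x S1 R1 ≤ PB g x S1 (R1 + d) := by
      unfold PB PJ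
      rw [← ENNReal.tsum_mul_left, ← ENNReal.tsum_add]
      refine ENNReal.tsum_le_tsum fun j => ?_
      calc _ = (g (j + 1) : ℝ≥0∞) * (x : ℝ≥0∞) ^ (j + 1) * (tB S1 R1 j + d * ((j : ℝ≥0∞) * tT S1 R1 (j - 1))) := by ring
        _ ≤ _ := by gcongr; exact tB_add _ _ _ _
    have e1 : R1 + d * PJ g x S1 R1 ≤ R1 + d := by
      calc R1 + d * PJ g x S1 R1 = 1 + (PB g x S1 R1 + d * PJ g x S1 R1) := by
            rw [← add_assoc, ← hRx]
        _ ≤ 1 + PB g y S2 (R1 + d) := by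
            gcongr
            exact key.trans (PB_mono g hxy.le hSle _)
        _ = _ := hRy.symm
    have e2 : d * PJ g x S1 R1 ≤ d * 1 := by
      rw [mul_one]
      exact (ENNReal.add_le_add_iff_left hR1).1 e1
    exact (ENNReal.mul_le_mul_iff_right hd0 hdt).1 e2

lemma rho_exists (g : ℕ → ℝ≥0) (hg : ∀ j, g j ≤ 1) (l : ℕ) (hl : 2 ≤ l) (hgl : g (l + 1) = 1) :
    ∃ ρ : ℝ≥0, 0 < ρ ∧ Fn g ρ ∧ ev ρ (fJ g) ≤ 1 ∧ ∀ x, ρ < x → ¬ Fn g x := by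
  have h0 := Fn_start g hg
  have hbd : ∀ x, Fn g x → x ≤ 1 := by
    intro x hx
    have h1 := (Fn_bound g l hl hgl x hx).2
    have h2 : (x : ℝ≥0∞) ^ (2 * (l + 1)) ≤ 1 := le_trans (le_mul_of_one_le_right zero_le (one_le_fR g x)) h1
    have h3 : x ^ (2 * (l + 1)) ≤ 1 := by exact_mod_cast h2
    exact (pow_le_one_iff (by omega)).1 h3
  have hB : BddAbove {x | Fn g x} := ⟨1, hbd⟩
  set ρ := sSup {x | Fn g x} with hρ
  have hlt : ∀ x, x < ρ → Fn g x := by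
    intro x hx
    obtain ⟨y, hy, hxy⟩ := exists_lt_of_lt_csSup (s := {x | Fn g x}) ⟨_, h0⟩ hx
    exact Fn_mono hxy.le hy
  have hρ0 : 1 / 10 ≤ ρ := le_csSup hB h0
  have hgt : ∀ x, ρ < x → ¬ Fn g x := fun x hx h => absurd hx (not_lt.2 (le_csSup hB h))
  have hρp : 0 < ρ := lt_of_lt_of_le (by norm_num) hρ0
  obtain ⟨y, hy0, hyρ⟩ := exists_between hρp
  have hbS : ∀ x, y < x → x < ρ → ev x (fS g) ≤ ((1 + (y ^ (l + 1))⁻¹ : ℝ≥0) : ℝ≥0∞) := by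
    intro x hyx hxρ
    obtain ⟨h1, -⟩ := Fn_bound g l hl hgl x (hlt x hxρ)
    rcases h1 with h1 | h1
    · exact h1.trans (by exact_mod_cast le_self_add)
    · have h2 : (y : ℝ≥0∞) ^ (l + 1) * ev x (fS g) ≤ 1 := le_trans (by gcongr) h1
      rw [mul_comm, ← ENNReal.le_div_iff_mul_le (Or.inl (by simp [hy0.ne'])) (Or.inl (by simp)), one_div] at h2
      refine h2.trans ?_
      rw [ENNReal.coe_add, ENNReal.coe_inv (by positivity)]
      exact_mod_cast le_add_self
  have hbR : ∀ x, y < x → x < ρ → ev x (fR g) ≤ (((y ^ (2 * (l + 1)))⁻¹ : ℝ≥0) : ℝ≥0∞) := by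
    intro x hyx hxρ
    obtain ⟨-, h1⟩ := Fn_bound g l hl hgl x (hlt x hxρ)
    have h2 : (y : ℝ≥0∞) ^ (2 * (l + 1)) * ev x (fR g) ≤ 1 := le_trans (by gcongr) h1
    rw [mul_comm, ← ENNReal.le_div_iff_mul_le (Or.inl (by simp [hy0.ne'])) (Or.inl (by simp)), one_div] at h2
    rw [ENNReal.coe_inv (by positivity)]
    exact_mod_cast h2
  refine ⟨ρ, hρp, ⟨ne_top_of_le_ne_top ENNReal.coe_ne_top (ev_left_le _ ρ y _ hyρ hbS),
    ne_top_of_le_ne_top ENNReal.coe_ne_top (ev_left_le _ ρ y _ hyρ hbR)⟩, ?_, hgt⟩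
  refine (ev_left_le _ ρ y 1 hyρ fun x hyx hxρ => ?_).trans (by simp)
  obtain ⟨z, hxz, hz⟩ := exists_between hxρ
  exact (J_le_one g x z (hy0.trans hyx) hxz (hlt z hz)).trans (by simp)
end

section
open Finset PowerSeries
open scoped NNReal ENNReal

lemma cA_sum (S R : ℝ≥0) (j : ℕ) :
    ∑' i, ((cA (j, i) * S ^ mA (j, i) * R ^ rA (j, i) * mA (j, i) : ℝ≥0) : ℝ≥0∞) =
      S * ((j : ℝ≥0∞) * tT (S : ℝ≥0∞) (R : ℝ≥0∞) (j - 1)) := by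
  cases j with
  | zero => simp [mA]
  | succ m =>
    rw [Nat.add_sub_cancel, tT_tsum, ← ENNReal.tsum_mul_left, ← ENNReal.tsum_mul_left]
    congr 1
    ext i
    rw [← ENNReal.coe_natCast, ← ENNReal.coe_mul, ← ENNReal.coe_mul]
    congr 1
    simp only [cA, mA, rA]
    have h1 := Nat.choose_mul_succ_eq m (2 * i)
    by_cases hi : 2 * i ≤ m
    · rw [show m + 1 - 2 * i = m - 2 * i + 1 by omega] at *
      have h2 : ((m.choose (2 * i) : ℝ≥0)) * ((m + 1 : ℕ) : ℝ≥0) =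
        ((m + 1).choose (2 * i) : ℝ≥0) * ((m - 2 * i + 1 : ℕ) : ℝ≥0) := by exact_mod_cast h1
      rw [Nat.cast_mul, Nat.cast_mul]
      calc _ = (((m + 1).choose (2 * i) : ℝ≥0) * ((m - 2 * i + 1 : ℕ) : ℝ≥0)) * ((2 * i).choose i : ℝ≥0) *
            S ^ (m - 2 * i) * S * R ^ i := by ring
        _ = _ := by rw [← h2]; ring
    · rw [show m + 1 - 2 * i = 0 by omega, Nat.choose_eq_zero_of_lt (show m < 2 * i by omega)]
      simp

lemma sI_le (g : ℕ → ℝ≥0) (x S R : ℝ≥0) (h : PJ g x S R ≤ 1) : sI cA mA rA g x S R ≤ S := by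
  have h1 : ∑' p, ((tm cA mA rA g x S R p * mA p : ℝ≥0) : ℝ≥0∞) = S * PJ g x S R := by
    rw [ENNReal.tsum_prod', PJ, ← ENNReal.tsum_mul_left]
    congr 1
    ext j
    rw [mul_left_comm, ← cA_sum, ← ENNReal.tsum_mul_left]
    congr 1
    ext i
    simp only [tm]
    push_cast
    ring
  have h2 : ∑' p, ((tm cA mA rA g x S R p * mA p : ℝ≥0) : ℝ≥0∞) ≤ S := by
    rw [h1]
    exact mul_le_of_le_one_right zero_le h
  have h3 := ENNReal.tsum_coe_ne_top_iff_summable.1 (ne_top_of_le_ne_top ENNReal.coe_ne_top h2)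
  rw [← ENNReal.coe_tsum h3] at h2
  have h4 : ∑' p, tm cA mA rA g x S R p * mA p ≤ S := by exact_mod_cast h2
  have h5 : sI cA mA rA g x S R = ((∑' p, tm cA mA rA g x S R p * mA p : ℝ≥0) : ℝ) := by
    rw [NNReal.coe_tsum, sI]
    push_cast
    rfl
  rw [h5]
  exact_mod_cast h4

lemma lin_lower (g : ℕ → ℝ≥0) (hg : ∀ j, g j = 0 ∨ g j = 1) (x S y : ℝ≥0) (hx : 0 < x) (hy : 0 < y)
    (hS : PA g x S (y ^ 2 : ℝ≥0) = S) :
    ∃ c : ℝ≥0, 0 < c ∧ ∀ m, g (m + 2) ≠ 0 → c * (S + 2 * y) ^ m ≤ ((m + 1 : ℕ) : ℝ≥0) * tT S (y ^ 2) m := by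
  set q := S + 2 * y with hq
  have hq0 : 0 < q := by positivity
  have he : ∀ m : ℕ, Even m → q ^ m ≤ 2 * ((m : ℝ≥0) + 1) * tT S (y ^ 2) m := fun m hm => le_tT S y m hm
  have heven : ∀ c ≤ 1 / 2, ∀ m, Even m → c * q ^ m ≤ ((m + 1 : ℕ) : ℝ≥0) * tT S (y ^ 2) m := by
    intro c hc m hm
    calc c * q ^ m ≤ 1 / 2 * (2 * ((m : ℝ≥0) + 1) * tT S (y ^ 2) m) := by gcongr; exact he m hm
      _ = _ := by push_cast; field_simp
  rcases eq_or_ne S 0 with h0 | h0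
  · refine ⟨1 / 2, by norm_num, fun m hm => ?_⟩
    rcases Nat.even_or_odd m with h | h
    · exact heven _ le_rfl m h
    · exfalso
      obtain ⟨i, rfl⟩ := h
      have e1 := PA_ge g (2 * (i + 1)) ((hg _).resolve_left (by rwa [show 2 * (i + 1) + 1 = 2 * i + 1 + 2 by ring])) x S (y ^ 2 : ℝ≥0)
      have e2 := pow_le_tT_even S (y ^ 2 : ℝ≥0) (i + 1)
      rw [hS, h0] at e1
      rw [h0] at e2
      simp only [ENNReal.coe_zero, nonpos_iff_eq_zero, mul_eq_zero] at e1 e2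
      rw [e1.resolve_left (by simp [hx.ne'])] at e2
      simp [hy.ne'] at e2
  · have hSp : 0 < S := pos_iff_ne_zero.2 h0
    refine ⟨min (1 / 2) (S / (2 * q)), by positivity, fun m hm => ?_⟩
    rcases Nat.even_or_odd m with h | h
    · exact heven _ (min_le_left _ _) m h
    · obtain ⟨i, rfl⟩ := h
      calc min (1 / 2) (S / (2 * q)) * q ^ (2 * i + 1) ≤ S / (2 * q) * q ^ (2 * i + 1) := by
            gcongr
            exact min_le_right _ _
        _ = S / 2 * q ^ (2 * i) := by rw [pow_succ]; field_simp
        _ ≤ S / 2 * (2 * (((2 * i : ℕ) : ℝ≥0) + 1) * tT S (y ^ 2) (2 * i)) := by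
            gcongr
            exact he _ (even_two_mul i)
        _ = ((2 * i + 1 : ℕ) : ℝ≥0) * (S * tT S (y ^ 2) (2 * i)) := by push_cast; ring
        _ ≤ ((2 * i + 1 + 1 : ℕ) : ℝ≥0) * tT S (y ^ 2) (2 * i + 1) := by
            rw [tT_succ]
            gcongr
            · exact Nat.le_succ _
            · exact le_self_add

lemma geo_fin (g : ℕ → ℝ≥0) (hg : ∀ j, g j ≤ 1) (x q : ℝ≥0) (hq : x * q < 1) (F : ℕ → ℝ≥0)
    (hF : ∀ j, F j ≤ q ^ (j + 1)) :
    ∑' j, (g (j + 1) : ℝ≥0∞) * (x : ℝ≥0∞) ^ (j + 1) * (F j : ℝ≥0∞) ≠ ⊤ := by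
  have h1 : Summable fun j => g (j + 1) * x ^ (j + 1) * F j := by
    refine NNReal.summable_of_le (fun j => ?_) ((NNReal.summable_geometric hq).mul_left (x * q))
    calc g (j + 1) * x ^ (j + 1) * F j ≤ 1 * x ^ (j + 1) * q ^ (j + 1) := by
          gcongr
          · exact hg _
          · exact hF j
      _ = _ := by ring
  have := ENNReal.tsum_coe_ne_top_iff_summable.2 h1
  push_cast at this
  exact this

lemma moment (g : ℕ → ℝ≥0) (hg : ∀ j, g j = 0 ∨ g j = 1) (x S y : ℝ≥0) (hx : 0 < x) (hy : 0 < y)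
    (hS : PA g x S (y ^ 2 : ℝ≥0) = S) (hJ : PJ g x S (y ^ 2 : ℝ≥0) ≤ 1) :
    ∃ δ : ℝ, 0 < δ ∧ PA g (x * ex δ) S (y ^ 2 : ℝ≥0) ≠ ⊤ ∧ PB g (x * ex δ) S (y ^ 2 : ℝ≥0) ≠ ⊤ := by
  have hg1 : ∀ j, g j ≤ 1 := fun j => by rcases hg j with h | h <;> simp [h]
  obtain ⟨c, hc, hlow⟩ := lin_lower g hg x S y hx hy hS
  by_cases hfin : {j : ℕ | g (j + 1) ≠ 0}.Finite
  · refine ⟨1, one_pos, ?_, ?_⟩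
    · unfold PA
      rw [tsum_eq_sum (s := hfin.toFinset) (fun j hj => by simp at hj; simp [hj])]
      refine (ENNReal.sum_lt_top.2 fun j _ => ?_).ne
      rw [← tT_coe']
      exact_mod_cast ENNReal.coe_lt_top
    · unfold PB
      rw [tsum_eq_sum (s := hfin.toFinset) (fun j hj => by simp at hj; simp [hj])]
      refine (ENNReal.sum_lt_top.2 fun j _ => ?_).ne
      rw [← tB_coe']
      exact_mod_cast ENNReal.coe_lt_top
  · set q := S + 2 * y with hq
    have hq0 : 0 < q := by positivity
    have hr : x * q < 1 := by
      by_contra! hr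
      apply hfin
      have h1 := ENNReal.finite_const_le_of_tsum_ne_top (ne_top_of_le_ne_top ENNReal.one_ne_top hJ)
        (ε := ((c * x ^ 2 : ℝ≥0) : ℝ≥0∞)) (by exact_mod_cast (by positivity))
      refine (h1.union (Set.finite_singleton 0)).subset fun j hj => ?_
      rcases j with - | m
      · right; rfl
      · left
        have h2 := hlow m hj
        have h3 : g (m + 1 + 1) = 1 := (hg _).resolve_left hj
        have h4 : c * x ^ 2 ≤ g (m + 1 + 1) * x ^ (m + 1 + 1) * (((m + 1 : ℕ) : ℝ≥0) * tT S (y ^ 2) (m + 1 - 1)) := by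
          rw [h3, one_mul, Nat.add_sub_cancel]
          calc c * x ^ 2 ≤ c * x ^ 2 * (x * q) ^ m := le_mul_of_one_le_right zero_le (one_le_pow₀ hr)
            _ = x ^ (m + 1 + 1) * (c * q ^ m) := by ring
            _ ≤ _ := by gcongr
        have h5 : ((c * x ^ 2 : ℝ≥0) : ℝ≥0∞) ≤ ((g (m + 1 + 1) * x ^ (m + 1 + 1) *
          (((m + 1 : ℕ) : ℝ≥0) * tT S (y ^ 2) (m + 1 - 1)) : ℝ≥0) : ℝ≥0∞) := ENNReal.coe_le_coe.2 h4
        rw [ENNReal.coe_mul (g (m + 1 + 1) * x ^ (m + 1 + 1)), ENNReal.coe_mul (g _), ENNReal.coe_pow x,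
          ENNReal.coe_mul ((m + 1 : ℕ) : ℝ≥0), ENNReal.coe_natCast, tT_coe'] at h5
        exact h5
    have hr0 : (0 : ℝ) < ((x * q : ℝ≥0) : ℝ) := by
      have : 0 < x * q := by positivity
      exact_mod_cast this
    have hlog : Real.log ((x * q : ℝ≥0) : ℝ) < 0 := Real.log_neg hr0 (by exact_mod_cast hr)
    refine ⟨-Real.log ((x * q : ℝ≥0) : ℝ) / 2, by linarith, ?_⟩
    set δ := -Real.log ((x * q : ℝ≥0) : ℝ) / 2 with hδ
    have hr' : x * ex δ * q < 1 := by
      rw [← NNReal.coe_lt_coe, mul_right_comm, NNReal.coe_mul (x * q), ex_coe]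
      nth_rewrite 1 [← Real.exp_log hr0]
      rw [← Real.exp_add, NNReal.coe_one, Real.exp_lt_one_iff]
      linarith
    constructor
    · have h1 := geo_fin g hg1 (x * ex δ) q hr' (fun j => q * tT S (y ^ 2) j) (fun j => by
        rw [pow_succ, mul_comm]
        exact mul_le_mul_left (tT_le S y j) q)
      intro htop
      apply h1
      have : ∀ j, (g (j + 1) : ℝ≥0∞) * ((x * ex δ : ℝ≥0) : ℝ≥0∞) ^ (j + 1) * ((q * tT S (y ^ 2) j : ℝ≥0) : ℝ≥0∞) =
        q * ((g (j + 1) : ℝ≥0∞) * ((x * ex δ : ℝ≥0) : ℝ≥0∞) ^ (j + 1) * tT (S : ℝ≥0∞) (y ^ 2 : ℝ≥0) j) := by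
        intro j
        rw [ENNReal.coe_mul q, tT_coe']
        ring
      simp_rw [this]
      rw [ENNReal.tsum_mul_left]
      unfold PA at htop
      rw [htop]
      exact ENNReal.mul_top (by exact_mod_cast hq0.ne')
    · have h1 := geo_fin g hg1 (x * ex δ) q hr' (fun j => tB S (y ^ 2) j) (fun j => tB_le S y j)
      simp only [tB_coe'] at h1
      exact h1
end

section
open Finset PowerSeries
open scoped NNReal ENNReal

lemma gu_gw (D : Set ℕ) (k : ℕ) (hk : k ∈ D) (u : ℝ≥0) : gu (gw D k 1) k u = gw D k u := by
  funext j
  unfold gu gw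
  by_cases hj : j = k
  · subst hj
    simp [hk]
  · simp [hj]

lemma gw_one (D : Set ℕ) (k : ℕ) (j : ℕ) : gw D k 1 j = 0 ∨ gw D k 1 j = 1 := by
  unfold gw
  split_ifs <;> simp

lemma gw_mem (D : Set ℕ) (k : ℕ) (j : ℕ) (hj : j ∈ D) : gw D k 1 j = 1 := by
  unfold gw
  simp [hj]

lemma asymp (D : Set ℕ) (k : ℕ) (hk : k ∈ D) (hk0 : 0 < k) (l : ℕ) (hl : 3 ≤ l) (hlD : l ∈ D) :
    ∃ ρ : ℝ≥0, 0 < ρ ∧ ∃ μ : ℝ, 0 < μ ∧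
    (∀ ε : ℝ, 0 < ε → ∃ s0 : ℝ, 0 < s0 ∧ ∀ s : ℝ, |s| ≤ s0 → ∃ C : ℝ≥0, 0 < C ∧
      ∀ N, coeff N (hs (gw D k (ex s)) [2]) * (ρ * ex (-(μ * s) - ε * |s|)) ^ N ≤ C) ∧
    (∀ δ : ℝ, 0 < δ → ∃ c : ℝ≥0, 0 < c ∧ ∀ N, coeff N (hs (gw D k 1) [2]) ≠ 0 →
      c ≤ coeff N (hs (gw D k 1) [2]) * (ρ * ex δ) ^ N) := by
  have hg := gw_one D k
  have hg1 : ∀ j, gw D k 1 j ≤ 1 := fun j => by rcases hg j with h | h <;> simp [h]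
  have hgk := gw_mem D k k hk
  have hgl := gw_mem D k l hlD
  have hgu := gu_gw D k hk
  have hW := hs_isW (gw D k 1)
  set g := gw D k 1 with hgdef
  obtain ⟨l, rfl⟩ : ∃ l', l = l' + 1 := ⟨l - 1, by omega⟩
  obtain ⟨ρ, hρ, hF, hJ, hinf⟩ := rho_exists g hg1 l (by omega) hgl
  have hR1 := one_le_fR g ρ
  have eS := ev_fS g ρ
  have eR := ev_fR g ρ
  rw [ev_fJ] at hJ
  obtain ⟨hS, hR⟩ := hF
  lift ev ρ (fS g) to ℝ≥0 using hS with S hSd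
  lift ev ρ (fR g) to ℝ≥0 using hR with R hRd
  have hR1' : 1 ≤ R := by exact_mod_cast hR1
  have hR0 : 0 < R := lt_of_lt_of_le one_pos hR1'
  obtain ⟨y, hy, rfl⟩ : ∃ y : ℝ≥0, 0 < y ∧ y ^ 2 = R :=
    ⟨NNReal.sqrt R, NNReal.sqrt_pos.2 hR0, NNReal.sq_sqrt R⟩
  obtain ⟨δ, hδ, hA, hB⟩ := moment g hg ρ S y hρ hy eS.symm hJ
  obtain ⟨μ, hμ, b, eA, eB⟩ := mu_exists g ρ S (y ^ 2) δ hδ hA hB eS.symm hR0 hρ k (l + 1) hl (by simp [hgl]) hk0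
    (by simp [hgk]) (sI_le g ρ S _ hJ)
  refine ⟨ρ, hρ, μ, hμ, fun ε hε => ?_, fun δ hδ => ?_⟩
  · obtain ⟨s0, hs0, h⟩ := sub_sol_exists g ρ S (y ^ 2) δ hδ hA hB eS.symm eR.symm k μ b eA eB ε hε
    refine ⟨s0, hs0, fun s hs' => ?_⟩
    obtain ⟨S', h1, h2⟩ := h s hs'
    rw [hgu] at h1 h2
    refine ⟨S' ^ 2 + 2 * y ^ 2, by positivity, fun N => ?_⟩
    have := upper_bound _ _ (hs_isW (gw D k (ex s))) _ _ _ h1 h2 N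
    exact_mod_cast this
  · have h1 : ρ < ρ * ex (δ / 2) := by
      refine lt_mul_of_one_lt_right hρ ?_
      rw [← NNReal.coe_lt_coe, ex_coe, NNReal.coe_one]
      exact Real.one_lt_exp_iff.2 (by linarith)
    have h2 : ρ * ex (δ / 2) < ρ * ex δ := by
      refine mul_lt_mul_of_pos_left ?_ hρ
      rw [← NNReal.coe_lt_coe, ex_coe, ex_coe]
      exact Real.exp_lt_exp.2 (by linarith)
    have h3 := hinf _ h1
    unfold Fn at h3
    rw [not_and_or, not_not, not_not] at h3
    exact lower_bound g _ hW (l + 1) hl hgl _ _ h2 h3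

lemma jensen {ι : Type*} (P : Finset ι) (hP : P.Nonempty) (X : ι → ℕ) (s : ℝ) :
    (P.card : ℝ) * Real.exp (s * ((∑ p ∈ P, (X p : ℝ)) / P.card)) ≤ ∑ p ∈ P, Real.exp s ^ X p := by
  have hc : (0 : ℝ) < P.card := by exact_mod_cast hP.card_pos
  set E := (∑ p ∈ P, (X p : ℝ)) / P.card with hE
  have hE' : ∑ p ∈ P, (X p : ℝ) = P.card * E := by rw [hE]; field_simp
  calc (P.card : ℝ) * Real.exp (s * E) = ∑ p ∈ P, Real.exp (s * E) * (1 + s * X p - s * E) := by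
        rw [← mul_sum, sum_sub_distrib, sum_add_distrib, ← mul_sum, hE']
        simp only [sum_const, nsmul_eq_mul]
        ring
    _ ≤ _ := by
        refine sum_le_sum fun p _ => ?_
        have h1 := Real.add_one_le_exp (s * X p - s * E)
        calc Real.exp (s * E) * (1 + s * X p - s * E) ≤ Real.exp (s * E) * Real.exp (s * X p - s * E) :=
              mul_le_mul_of_nonneg_left (by linarith) (Real.exp_pos _).le
          _ = Real.exp s ^ X p := by
            rw [← Real.exp_add, ← Real.exp_nat_mul]
            ring_nf

lemma EX_exp_aux {ι : Type*} (P : Finset ι) (hP : P.Nonempty) (X : ι → ℕ) (s : ℝ) (f : ℕ) (hf : 0 < f) (a b : ℝ≥0)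
    (h1 : ∑ p ∈ P, (1 : ℝ≥0) ^ X p = f * a) (h2 : ∑ p ∈ P, (ex s) ^ X p = f * b) :
    a ≠ 0 ∧ (a : ℝ) * Real.exp (s * ((∑ p ∈ P, (X p : ℝ)) / P.card)) ≤ (b : ℝ) := by
  have hf' : (0 : ℝ) < (f : ℝ) := by exact_mod_cast hf
  have h3 := jensen P hP X s
  simp only [one_pow, sum_const, nsmul_eq_mul, mul_one] at h1
  constructor
  · intro h0
    rw [h0, mul_zero] at h1
    have : P.card = 0 := by exact_mod_cast h1
    exact absurd this hP.card_pos.ne'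
  · have h1' : (P.card : ℝ) = (f : ℝ) * (a : ℝ) := by
      have := congrArg NNReal.toReal h1
      push_cast at this
      exact this
    have h2' : ∑ p ∈ P, Real.exp s ^ X p = (f : ℝ) * (b : ℝ) := by
      have := congrArg NNReal.toReal h2
      push_cast [ex_coe] at this
      exact this
    rw [h2'] at h3
    generalize (∑ p ∈ P, (X p : ℝ)) / P.card = E at h3 ⊢
    rw [h1', mul_assoc] at h3
    exact le_of_mul_le_mul_left h3 hf'

lemma EX_exp (D : Set ℕ) (k : ℕ) (hk : k ∈ D) (n : ℕ) (hn : 0 < n) (hne : (pairFinset D n).Nonempty) (s : ℝ) :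
    (coeff (2 * n) (hs (gw D k 1) [2]) : ℝ≥0) ≠ 0 ∧
    ((coeff (2 * n) (hs (gw D k 1) [2]) : ℝ≥0) : ℝ) * Real.exp (s * EX D k n) ≤
      ((coeff (2 * n) (hs (gw D k (ex s)) [2]) : ℝ≥0) : ℝ) := by
  have h1 := pair_sum D k hk 1 n hn
  have h2 := pair_sum D k hk (ex s) n hn
  generalize (coeff (2 * n) (hs (gw D k 1) [2]) : ℝ≥0) = a at *
  generalize (coeff (2 * n) (hs (gw D k (ex s)) [2]) : ℝ≥0) = b at *
  unfold EX
  exact EX_exp_aux (pairFinset D n) hne (fun p => degCount p.1 k) s _ (Nat.factorial_pos _) a b h1 h2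

lemma EX_log (a b c C ρ : ℝ) (N : ℕ) (hρ : 0 < ρ) (ha : 0 < a) (hc : 0 < c) (v δ t : ℝ) (h1 : a * Real.exp t ≤ b)
    (h2 : b * (ρ * Real.exp v) ^ N ≤ C) (h3 : c ≤ a * (ρ * Real.exp δ) ^ N) :
    t ≤ Real.log (C / c) + N * (δ - v) := by
  have hb : 0 < b := lt_of_lt_of_le (by positivity) h1
  have hC : 0 < C := lt_of_lt_of_le (by positivity) h2
  have e1 : c * Real.exp t ≤ C * Real.exp (N * (δ - v)) := by
    calc c * Real.exp t ≤ a * (ρ * Real.exp δ) ^ N * Real.exp t := by gcongr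
      _ = a * Real.exp t * (ρ * Real.exp δ) ^ N := by ring
      _ ≤ b * (ρ * Real.exp δ) ^ N := by gcongr
      _ = b * (ρ * Real.exp v) ^ N * Real.exp (N * (δ - v)) := by
        rw [mul_pow, mul_pow, ← Real.exp_nat_mul, ← Real.exp_nat_mul, mul_assoc b, mul_assoc (ρ ^ N), ← Real.exp_add]
        ring_nf
      _ ≤ _ := by gcongr
  have e2 : Real.exp t ≤ C / c * Real.exp (N * (δ - v)) := by
    rw [div_mul_eq_mul_div, le_div_iff₀ hc]
    linarith
  have := Real.log_le_log (Real.exp_pos _) e2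
  rwa [Real.log_exp, Real.log_mul (by positivity) (Real.exp_pos _).ne', Real.log_exp] at this

lemma final_limit (E : ℕ → ℝ) (P : Set ℕ) (μ : ℝ) (hμ : 0 < μ)
    (h : ∀ ε : ℝ, 0 < ε → ∃ s0 : ℝ, 0 < s0 ∧ ∃ K : ℝ, ∀ n : ℕ, 0 < n → n ∈ P → ∀ s : ℝ, |s| = s0 →
      s * E n ≤ K + (2 * n : ℝ) * (μ * s + 2 * ε * s0)) :
    Filter.Tendsto (fun n : ℕ => E n / (2 * μ * (n : ℝ))) (Filter.atTop ⊓ Filter.principal P) (nhds 1) := by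
  rw [Metric.tendsto_nhds]
  intro η hη
  obtain ⟨s0, hs0, K, hK⟩ := h (η * μ / 4) (by positivity)
  rw [Filter.eventually_inf_principal]
  filter_upwards [Filter.eventually_gt_atTop 0, Filter.eventually_gt_atTop ⌈2 * |K| / (s0 * η * μ)⌉₊] with n hn hn2 hnP
  have hn' : (0 : ℝ) < n := by exact_mod_cast hn
  have hn2' : 2 * |K| / (s0 * η * μ) < n := lt_of_le_of_lt (Nat.le_ceil _) (by exact_mod_cast hn2)
  rw [div_lt_iff₀ (by positivity)] at hn2'
  have h1 := hK n hn hnP s0 (abs_of_pos hs0)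
  have h2 := hK n hn hnP (-s0) (by rw [abs_neg, abs_of_pos hs0])
  have hKa := le_abs_self K
  have e1 : E n - 2 * μ * n < η * (2 * μ * n) := by
    have : s0 * (E n - 2 * μ * n) < s0 * (η * (2 * μ * n)) := by nlinarith
    exact lt_of_mul_lt_mul_left this hs0.le
  have e2 : -(E n - 2 * μ * n) < η * (2 * μ * n) := by
    have : s0 * (-(E n - 2 * μ * n)) < s0 * (η * (2 * μ * n)) := by nlinarith
    exact lt_of_mul_lt_mul_left this hs0.le
  have hpos : 0 < 2 * μ * (n : ℝ) := by positivity
  rw [Real.dist_eq, div_sub_one hpos.ne', abs_div, abs_of_pos hpos, div_lt_iff₀ hpos, abs_lt]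
  constructor <;> linarith

theorem main_thm (D : Set ℕ) (hpos : ∀ k ∈ D, 0 < k)
    (hD : ¬ D ⊆ ({1, 2} : Set ℕ)) (d : ℕ) (k : ℕ) (hk : k ∈ D) :
    ∃ μ : ℝ, 0 < μ ∧
      Filter.Tendsto (fun n : ℕ => EX D k n / (μ * (n : ℝ)))
        (Filter.atTop ⊓ Filter.principal {n : ℕ | d ∣ n ∧ (pairFinset D n).Nonempty})
        (nhds 1) := by
  obtain ⟨l, hlD, hl⟩ := Set.not_subset.1 hD
  have hl3 : 3 ≤ l := by
    have := hpos l hlD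
    simp at hl
    omega
  obtain ⟨ρ, hρ, μ, hμ, hU, hL⟩ := asymp D k hk (hpos k hk) l hl3 hlD
  refine ⟨2 * μ, by positivity, final_limit _ _ μ hμ fun ε hε => ?_⟩
  obtain ⟨s0, hs0, hU⟩ := hU ε hε
  obtain ⟨c, hc, hL⟩ := hL (ε * s0) (by positivity)
  obtain ⟨C1, hC1, h1⟩ := hU s0 (abs_of_pos hs0).le
  obtain ⟨C2, hC2, h2⟩ := hU (-s0) (by rw [abs_neg, abs_of_pos hs0])
  have hc' : (0 : ℝ) < c := by exact_mod_cast hc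
  have key : ∀ C : ℝ≥0, ∀ s : ℝ, |s| = s0 →
      (∀ N, coeff N (hs (gw D k (ex s)) [2]) * (ρ * ex (-(μ * s) - ε * |s|)) ^ N ≤ C) →
      ∀ n : ℕ, 0 < n → (pairFinset D n).Nonempty →
      s * EX D k n ≤ Real.log (C / c) + (2 * n : ℝ) * (μ * s + 2 * ε * s0) := by
    intro C s hs' hC n hn hne
    obtain ⟨q1, q2⟩ := EX_exp D k hk n hn hne s
    have q4 := hC (2 * n)
    have q5 := hL (2 * n) q1
    generalize (coeff (2 * n) (hs (gw D k 1) [2]) : ℝ≥0) = a at *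
    generalize (coeff (2 * n) (hs (gw D k (ex s)) [2]) : ℝ≥0) = b at *
    have q4' := NNReal.coe_le_coe.2 q4
    have q5' := NNReal.coe_le_coe.2 q5
    rw [NNReal.coe_mul, NNReal.coe_pow, NNReal.coe_mul, ex_coe] at q4' q5'
    have q3 := EX_log (a : ℝ) (b : ℝ) c C ρ (2 * n) (NNReal.coe_pos.2 hρ)
      (NNReal.coe_pos.2 (pos_iff_ne_zero.2 q1)) hc' (-(μ * s) - ε * |s|) (ε * s0) _ q2 q4' q5'
    refine q3.trans (le_of_eq ?_)
    rw [hs']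
    push_cast
    ring
  refine ⟨s0, hs0, max (Real.log (C1 / c)) (Real.log (C2 / c)), fun n hn hnP s hs' => ?_⟩
  rcases (abs_eq hs0.le).1 hs' with rfl | rfl
  · refine (key C1 _ hs' h1 n hn hnP.2).trans ?_
    gcongr
    exact le_max_left _ _
  · refine (key C2 _ hs' h2 n hn hnP.2).trans ?_
    gcongr
    exact le_max_right _ _
end

/-- **Linear growth of the expected number of vertices of degree `k`.**
With `D` and `d` as usual and `k ∈ D`, there is a constant `μ_k > 0` such that
`E[X_n^{(k)}] ~ μ_k · n` as `n → ∞` along those `n ≡ 0 (mod d)` for which maps exist. -/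
theorem expected_degree_count_linear (D : Set ℕ) (hpos : ∀ k ∈ D, 0 < k)
    (hD : ¬ D ⊆ ({1, 2} : Set ℕ)) (d : ℕ)
    (hd_even : (∀ k ∈ D, Even k) →
      (∀ i, 2 * i ∈ D → d ∣ i) ∧ ∀ e : ℕ, (∀ i, 2 * i ∈ D → e ∣ i) → e ∣ d)
    (hd_odd : ¬ (∀ k ∈ D, Even k) → d = 1)
    (k : ℕ) (hk : k ∈ D) :
    ∃ μ : ℝ, 0 < μ ∧
      Filter.Tendsto (fun n : ℕ => EX D k n / (μ * (n : ℝ)))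
        (Filter.atTop ⊓ Filter.principal {n : ℕ | d ∣ n ∧ (pairFinset D n).Nonempty})
        (nhds 1) := by
  exact main_thm D hpos hD d k hk
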